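/- Work on ℤ³. For N ≥ 1 let Λ_N = {−N,…,N}³, and let μ⁺_{β,N} be the plus-boundary Ising measure on {−1,1}^{Λ_N}: μ⁺_{β,N}(σ) is proportional to exp(β [Σ σ_u σ_v + Σ' σ_u]), where the first sum is over unordered pairs {u,v} ⊆ Λ_N with ‖u−v‖₁ = 1 and the second sum Σ' is over pairs (u,v) with u ∈ Λ_N, v ∈ ℤ³ ∖ Λ_N and ‖u−v‖₁ = 1 (counted with multiplicity). Define m_N(β) = E_{μ⁺_{β,N}}[σ_0], m*(β) = limsup_{N→∞} m_N(β), and β_c = inf{β ≥ 0 : m*(β) > 0}. Then m*(β_c) = 0, i.e. the spontaneous magnetisation of the three-dimensional Ising model vanishes at the critical point. -/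

import Mathlib

open scoped Classical
open Filter

noncomputable section

/-- The spin value `±1` attached to a Boolean. -/
def spin (b : Bool) : ℝ := if b then 1 else -1

/-- The `ℓ¹`-distance on `ℤ^d`. -/
def dist1 {d : ℕ} (u v : Fin d → ℤ) : ℤ := ∑ i, |u i - v i|

/-- The box `Λ_N = {-N,…,N}^d ⊆ ℤ^d`. -/
def cube (d N : ℕ) : Finset (Fin d → ℤ) :=
  Fintype.piFinset fun _ => Finset.Icc (-(N : ℤ)) N

/-- The set of nearest neighbours of `u` in `ℤ^d`. -/
def nbrs {d : ℕ} (u : Fin d → ℤ) : Finset (Fin d → ℤ) :=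
  (Fintype.piFinset fun i => Finset.Icc (u i - 1) (u i + 1)).filter fun v => dist1 u v = 1

/-- The number of nearest neighbours of `u` lying outside `Λ_N` (counted with
multiplicity). -/
def bCount (d N : ℕ) (u : Fin d → ℤ) : ℕ := (nbrs u \ cube d N).card

/-- The plus-boundary Ising Boltzmann weight
`exp(β[∑_{{u,v}⊆Λ_N, ‖u-v‖₁=1} σ_u σ_v + ∑_{u∈Λ_N, v∉Λ_N, ‖u-v‖₁=1} σ_u])` of a
configuration `σ ∈ {-1,1}^{Λ_N}` (the sum over unordered pairs is written as half the sum
over ordered pairs). -/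
def plusWeight (d N : ℕ) (β : ℝ) (σ : {x // x ∈ cube d N} → Bool) : ℝ :=
  Real.exp (β * ((1 / 2) * (∑ u ∈ (cube d N).attach, ∑ v ∈ (cube d N).attach,
      if dist1 (u : Fin d → ℤ) (v : Fin d → ℤ) = 1 then spin (σ u) * spin (σ v) else 0) +
    ∑ u ∈ (cube d N).attach, (bCount d N (u : Fin d → ℤ) : ℝ) * spin (σ u)))

lemma origin_mem_cube (d N : ℕ) : (fun _ => (0 : ℤ)) ∈ cube d N := by
  simp only [cube, Fintype.mem_piFinset, Finset.mem_Icc]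
  intro i
  omega

/-- `m_N(β)`: the expected spin at the origin under the plus-boundary Ising measure on
`Λ_N`. -/
def mag (d N : ℕ) (β : ℝ) : ℝ :=
  (∑ σ : {x // x ∈ cube d N} → Bool,
      plusWeight d N β σ * spin (σ ⟨fun _ => 0, origin_mem_cube d N⟩)) /
    ∑ σ : {x // x ∈ cube d N} → Bool, plusWeight d N β σ

/-- The spontaneous magnetisation `m*(β) = limsup_N m_N(β)`. -/
def mstar (d : ℕ) (β : ℝ) : ℝ := atTop.limsup fun N => mag d N β

end

set_option linter.unusedSectionVars false

lemma spin_sq (b : Bool) : spin b * spin b = 1 := by cases b <;> simp [spin]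

lemma spin_beq (a b : Bool) : spin (a == b) = spin a * spin b := by
  cases a <;> cases b <;> simp [spin]

lemma spin_le_one (b : Bool) : spin b ≤ 1 := by cases b <;> norm_num [spin]

lemma neg_one_le_spin (b : Bool) : -1 ≤ spin b := by cases b <;> norm_num [spin]

lemma spin_true : spin true = 1 := by simp [spin]

lemma spin_not (b : Bool) : spin (!b) = -spin b := by cases b <;> simp [spin]

lemma spin_eq_or (b : Bool) : spin b = 1 ∨ spin b = -1 := by cases b <;> simp [spin]

lemma spin_mul_mem (a b : Bool) : spin a * spin b = 1 ∨ spin a * spin b = -1 := by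
  cases a <;> cases b <;> simp [spin]

section Cone

variable {V W : Type*}

/-- The semiring of polynomials in the spins with nonnegative coefficients, viewed as functions on
configurations. -/
noncomputable def posCone (V : Type*) : Subsemiring ((V → Bool) → ℝ) :=
  (MvPolynomial.eval₂Hom ((Pi.constRingHom (V → Bool) ℝ).comp NNReal.toRealHom)
    (fun (x : V) (σ : V → Bool) => spin (σ x))).rangeS

lemma const_mem_posCone {c : ℝ} (hc : 0 ≤ c) : (fun _ => c) ∈ posCone V :=
  ⟨MvPolynomial.C c.toNNReal, by
    rw [MvPolynomial.coe_eval₂Hom, MvPolynomial.eval₂_C]; ext σ; simp [hc]⟩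

lemma spin_mem_posCone (x : V) : (fun σ : V → Bool => spin (σ x)) ∈ posCone V :=
  ⟨MvPolynomial.X x, by simp⟩

lemma mul_mem_posCone {f g : (V → Bool) → ℝ} (hf : f ∈ posCone V) (hg : g ∈ posCone V) :
    (fun σ => f σ * g σ) ∈ posCone V := mul_mem hf hg

lemma add_mem_posCone {f g : (V → Bool) → ℝ} (hf : f ∈ posCone V) (hg : g ∈ posCone V) :
    (fun σ => f σ + g σ) ∈ posCone V := add_mem hf hg

lemma prod_mem_posCone {ι : Type*} (s : Finset ι) {f : ι → (V → Bool) → ℝ}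
    (hf : ∀ i ∈ s, f i ∈ posCone V) : (fun σ => ∏ i ∈ s, f i σ) ∈ posCone V := by
  convert prod_mem hf using 1
  ext σ; simp

lemma exp_mul_of_sq_eq_one (c t : ℝ) (ht : t = 1 ∨ t = -1) :
    Real.exp (c * t) = Real.cosh c + Real.sinh c * t := by
  rcases ht with rfl | rfl
  · rw [mul_one, mul_one, Real.cosh_add_sinh]
  · rw [mul_neg_one, mul_neg_one, ← sub_eq_add_neg, Real.cosh_sub_sinh]

lemma exp_mem_posCone {c : ℝ} (hc : 0 ≤ c) {f : (V → Bool) → ℝ} (hf : f ∈ posCone V)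
    (h1 : ∀ σ, f σ = 1 ∨ f σ = -1) : (fun σ => Real.exp (c * f σ)) ∈ posCone V := by
  have : (fun σ => Real.exp (c * f σ)) = fun σ => Real.cosh c + Real.sinh c * f σ := by
    ext σ; exact exp_mul_of_sq_eq_one c _ (h1 σ)
  rw [this]
  exact add_mem_posCone (const_mem_posCone (Real.cosh_pos c).le)
    (mul_mem_posCone (const_mem_posCone (Real.sinh_nonneg_iff.2 hc)) hf)

lemma sum_nonneg_of_mem_posCone [Fintype V] [DecidableEq V] {f : (V → Bool) → ℝ}
    (hf : f ∈ posCone V) : 0 ≤ ∑ σ, f σ := by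
  obtain ⟨p, rfl⟩ := hf
  simp only [MvPolynomial.coe_eval₂Hom, MvPolynomial.eval₂_eq']
  simp only [Finset.sum_apply, Pi.mul_apply, Finset.prod_apply, Pi.pow_apply]
  rw [Finset.sum_comm]
  refine Finset.sum_nonneg fun d _ => ?_
  simp only [RingHom.comp_apply, Pi.constRingHom_apply, Function.const_apply]
  rw [← Finset.mul_sum]
  refine mul_nonneg (NNReal.coe_nonneg _) ?_
  have : ∑ σ : V → Bool, ∏ x, spin (σ x) ^ d x = ∏ x, ∑ b, spin b ^ d x :=
    (Fintype.prod_sum fun x b => spin b ^ d x).symm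
  rw [this]
  refine Finset.prod_nonneg fun x _ => ?_
  rw [Fintype.sum_bool]
  rcases neg_one_pow_eq_or ℝ (d x) with h | h <;> simp [spin, h]

end Cone

section Ginibre

/-- Pointwise product of two spin configurations. -/
def cmul {V : Type*} (ρ τ : V → Bool) : V → Bool := fun x => ρ x == τ x

lemma spin_cmul {V : Type*} (ρ τ : V → Bool) (x : V) :
    spin (cmul ρ τ x) = spin (ρ x) * spin (τ x) := spin_beq _ _

lemma cmul_involutive {V : Type*} (τ : V → Bool) : Function.Involutive fun ρ => cmul ρ τ := by
  intro ρ; ext x; simp only [cmul]; cases ρ x <;> cases τ x <;> rfl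

lemma sum_cmul {V : Type*} [Fintype V] [DecidableEq V] (F : (V → Bool) → ℝ) (τ : V → Bool) :
    ∑ ρ, F (cmul ρ τ) = ∑ ρ, F ρ :=
  Equiv.sum_comp ((cmul_involutive τ).toPerm) F

variable {V W : Type*} [Fintype V] [DecidableEq V] [Fintype W] [DecidableEq W]

/-- Ginibre's inequality for a pair of spin systems coupled through `φ`. -/
lemma ginibre (f : (V → Bool) → ℝ) (g : (W → Bool) → ℝ) (φ : (V → Bool) → (W → Bool))
    (χ : (W → Bool) → ℝ) (hχ : ∀ ρ τ, χ (cmul ρ τ) = χ ρ * χ τ) (hχ1 : ∀ ρ, χ ρ ≤ 1)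
    (hχφ : (fun σ => χ (φ σ)) ∈ posCone V) (p : (V → Bool) → ℝ) (hp : p ∈ posCone V)
    (H : ∀ ρ, (fun σ => f σ * g (cmul ρ (φ σ))) ∈ posCone V) :
    0 ≤ ∑ σ, ∑ τ, f σ * g τ * p σ * (χ (φ σ) - χ τ) := by
  have : ∀ σ, ∑ τ, f σ * g τ * p σ * (χ (φ σ) - χ τ) =
      ∑ ρ, (1 - χ ρ) * ((f σ * g (cmul ρ (φ σ))) * (p σ * χ (φ σ))) := by
    intro σ
    rw [← sum_cmul (fun τ => f σ * g τ * p σ * (χ (φ σ) - χ τ)) (φ σ)]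
    refine Finset.sum_congr rfl fun ρ _ => ?_
    rw [hχ]; ring
  simp only [this]
  rw [Finset.sum_comm]
  refine Finset.sum_nonneg fun ρ _ => ?_
  rw [← Finset.mul_sum]
  exact mul_nonneg (sub_nonneg.2 (hχ1 ρ))
    (sum_nonneg_of_mem_posCone (mul_mem_posCone (H ρ) (mul_mem_posCone hp hχφ)))

/-- The Ising Boltzmann weight with couplings `J` and fields `h`. -/
noncomputable def isingW (J : V → V → ℝ) (h : V → ℝ) (σ : V → Bool) : ℝ :=
  Real.exp (∑ u, ∑ v, J u v * (spin (σ u) * spin (σ v)) + ∑ u, h u * spin (σ u))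

/-- Ising expectation. -/
noncomputable def ev (J : V → V → ℝ) (h : V → ℝ) (f : (V → Bool) → ℝ) : ℝ :=
  (∑ σ, isingW J h σ * f σ) / ∑ σ, isingW J h σ

/-- The two-point function as an observable. -/
def pair (x y : V) (σ : V → Bool) : ℝ := spin (σ x) * spin (σ y)

lemma isingW_pos (J : V → V → ℝ) (h : V → ℝ) (σ : V → Bool) : 0 < isingW J h σ := Real.exp_pos _

lemma sum_isingW_pos (J : V → V → ℝ) (h : V → ℝ) : 0 < ∑ σ, isingW J h σ :=
  Finset.sum_pos (fun σ _ => isingW_pos J h σ) Finset.univ_nonempty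

lemma isingW_eq_prod (J : V → V → ℝ) (h : V → ℝ) (σ : V → Bool) :
    isingW J h σ = (∏ u, ∏ v, Real.exp (J u v * (spin (σ u) * spin (σ v)))) *
      ∏ u, Real.exp (h u * spin (σ u)) := by
  rw [isingW, Real.exp_add, Real.exp_sum, Real.exp_sum]
  simp only [Real.exp_sum]

lemma spin_mul_mem_posCone (x y : V) :
    (fun σ : V → Bool => spin (σ x) * spin (σ y)) ∈ posCone V :=
  mul_mem_posCone (spin_mem_posCone x) (spin_mem_posCone y)

lemma isingW_mem_posCone {J : V → V → ℝ} {h : V → ℝ} (hJ : ∀ u v, 0 ≤ J u v)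
    (hh : ∀ u, 0 ≤ h u) : isingW J h ∈ posCone V := by
  have : isingW J h = fun σ => (∏ u, ∏ v, Real.exp (J u v * (spin (σ u) * spin (σ v)))) *
      ∏ u, Real.exp (h u * spin (σ u)) := by
    ext σ; exact isingW_eq_prod J h σ
  rw [this]
  refine mul_mem_posCone (prod_mem_posCone _ fun u _ => prod_mem_posCone _ fun v _ => ?_)
    (prod_mem_posCone _ fun u _ => ?_)
  · exact exp_mem_posCone (hJ u v) (spin_mul_mem_posCone u v) fun σ => spin_mul_mem _ _
  · exact exp_mem_posCone (hh u) (spin_mem_posCone u) fun σ => spin_eq_or _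

lemma ev_le_of_sum_nonneg {J : V → V → ℝ} {h : V → ℝ} {J' : W → W → ℝ} {h' : W → ℝ}
    {a : (V → Bool) → ℝ} {b : (W → Bool) → ℝ}
    (H : 0 ≤ ∑ σ, ∑ τ, isingW J h σ * isingW J' h' τ * (a σ - b τ)) :
    ev J' h' b ≤ ev J h a := by
  rw [ev, ev, div_le_div_iff₀ (sum_isingW_pos _ _) (sum_isingW_pos _ _)]
  have : ∑ σ, ∑ τ, isingW J h σ * isingW J' h' τ * (a σ - b τ) =
      (∑ σ, isingW J h σ * a σ) * (∑ τ, isingW J' h' τ) -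
      (∑ τ, isingW J' h' τ * b τ) * (∑ σ, isingW J h σ) := by
    rw [Finset.sum_mul_sum, mul_comm (∑ τ, isingW J' h' τ * b τ), Finset.sum_mul_sum,
      ← Finset.sum_sub_distrib]
    refine Finset.sum_congr rfl fun σ _ => ?_
    rw [← Finset.sum_sub_distrib]
    exact Finset.sum_congr rfl fun τ _ => by ring
  linarith

lemma ev_nonneg {J : V → V → ℝ} {h : V → ℝ} (hJ : ∀ u v, 0 ≤ J u v) (hh : ∀ u, 0 ≤ h u)
    {f : (V → Bool) → ℝ} (hf : f ∈ posCone V) : 0 ≤ ev J h f :=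
  div_nonneg (sum_nonneg_of_mem_posCone (mul_mem_posCone (isingW_mem_posCone hJ hh) hf))
    (sum_isingW_pos _ _).le

lemma pair_cmul (x y : V) (ρ τ : V → Bool) : pair x y (cmul ρ τ) = pair x y ρ * pair x y τ := by
  simp only [pair, spin_cmul]; ring

lemma pair_le_one (x y : V) (ρ : V → Bool) : pair x y ρ ≤ 1 := by
  rcases spin_mul_mem (ρ x) (ρ y) with h | h <;> simp [pair, h]

lemma ev_mono_const {J : V → V → ℝ} {h : V → ℝ} {f : (V → Bool) → ℝ} {c : ℝ}
    (hf : ∀ σ, f σ ≤ c) : ev J h f ≤ c := by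
  rw [ev, div_le_iff₀ (sum_isingW_pos _ _), Finset.mul_sum]
  exact Finset.sum_le_sum fun σ _ => by
    rw [mul_comm c]; exact mul_le_mul_of_nonneg_left (hf σ) (isingW_pos _ _ _).le

/-- Correlations of a free subsystem are dominated by those of the full system. -/
lemma ev_pair_restrict (ι : V → W) (hι : Function.Injective ι) {J : V → V → ℝ} {J' : W → W → ℝ}
    (hJ' : ∀ u v, 0 ≤ J' u v) (hJ : ∀ u v, 0 ≤ J u v) (hle : ∀ u v, J u v ≤ J' (ι u) (ι v))
    {h' : W → ℝ} (hh' : ∀ u, 0 ≤ h' u) (x y : V) :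
    ev J 0 (pair x y) ≤ ev J' h' (pair (ι x) (ι y)) := by
  apply ev_le_of_sum_nonneg
  have := ginibre (isingW J' h') (isingW J 0) (fun τ v => τ (ι v)) (pair x y) (pair_cmul x y)
    (pair_le_one x y) (spin_mul_mem_posCone (ι x) (ι y)) (fun _ => 1)
    (const_mem_posCone zero_le_one) ?_
  · simpa [pair] using this
  intro ρ
  have : (fun σ : W → Bool => isingW J' h' σ * isingW J 0 (cmul ρ fun v => σ (ι v))) =
      isingW (fun u v => J' u v + ∑ a, ∑ b, if ι a = u ∧ ι b = v then
        J a b * (spin (ρ a) * spin (ρ b)) else 0) h' := by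
    ext σ
    simp only [isingW, ← Real.exp_add]
    congr 1
    have e : ∑ u, ∑ v, (∑ a, ∑ b, if ι a = u ∧ ι b = v then
        J a b * (spin (ρ a) * spin (ρ b)) else 0) * (spin (σ u) * spin (σ v)) =
        ∑ a, ∑ b, J a b * (spin (ρ a) * spin (ρ b)) * (spin (σ (ι a)) * spin (σ (ι b))) := by
      simp only [Finset.sum_mul]
      have : ∀ u, ∑ v, ∑ a, ∑ b, (if ι a = u ∧ ι b = v then
          J a b * (spin (ρ a) * spin (ρ b)) else 0) * (spin (σ u) * spin (σ v)) =
          ∑ a, ∑ b, if ι a = u then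
          J a b * (spin (ρ a) * spin (ρ b)) * (spin (σ u) * spin (σ (ι b))) else 0 := by
        intro u
        rw [Finset.sum_comm]
        refine Finset.sum_congr rfl fun a _ => ?_
        rw [Finset.sum_comm]
        refine Finset.sum_congr rfl fun b _ => ?_
        by_cases hu : ι a = u <;> simp [hu, ite_mul]
      simp only [this]
      rw [Finset.sum_comm]
      refine Finset.sum_congr rfl fun a _ => ?_
      rw [Finset.sum_comm]
      refine Finset.sum_congr rfl fun b _ => ?_
      simp
    simp only [add_mul, Finset.sum_add_distrib, e, spin_cmul]
    simp only [Pi.zero_apply, zero_mul, Finset.sum_const_zero, add_zero]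
    rw [add_right_comm]
    congr 2
    refine Finset.sum_congr rfl fun a _ => Finset.sum_congr rfl fun b _ => ?_
    ring
  rw [this]
  refine isingW_mem_posCone (fun u v => ?_) hh'
  by_cases hu : ∃ a, ι a = u
  · by_cases hv : ∃ b, ι b = v
    · obtain ⟨a, rfl⟩ := hu
      obtain ⟨b, rfl⟩ := hv
      simp only [hι.eq_iff]
      have : ∀ a', (∑ b', if a' = a ∧ b' = b then
          J a' b' * (spin (ρ a') * spin (ρ b')) else 0) =
          if a' = a then J a' b * (spin (ρ a') * spin (ρ b)) else 0 := by
        intro a'; by_cases h : a' = a <;> simp [h]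
      simp only [this, Finset.sum_ite_eq', Finset.mem_univ, if_true]
      have h1 := hle a b
      have h2 := hJ a b
      rcases spin_mul_mem (ρ a) (ρ b) with h | h <;> rw [h] <;> linarith
    · push Not at hv
      simp [hv, hJ']
  · push Not at hu
    simp [hu, hJ']

/-- Extension of a configuration by `+1`. -/
noncomputable def extendPlus (ι : V → W) (σ : V → Bool) (w : W) : Bool :=
  if h : ∃ v, ι v = w then σ h.choose else true

lemma extendPlus_apply {ι : V → W} (hι : Function.Injective ι) (σ : V → Bool) (v : V) :
    extendPlus ι σ (ι v) = σ v := by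
  have h : ∃ v', ι v' = ι v := ⟨v, rfl⟩
  rw [extendPlus, dif_pos h, hι h.choose_spec]

lemma extendPlus_mem_posCone (ι : V → W) (w : W) :
    (fun σ : V → Bool => spin (extendPlus ι σ w)) ∈ posCone V := by
  by_cases h : ∃ v, ι v = w
  · simp only [extendPlus, dif_pos h]; exact spin_mem_posCone _
  · simp only [extendPlus, dif_neg h, spin_true]; exact const_mem_posCone zero_le_one

/-- Freezing spins to `+1` increases expectations. -/
lemma ev_le_frozen (ι : V → W) {J : V → V → ℝ} {h : V → ℝ}
    {J' : W → W → ℝ} (hJ' : ∀ u v, 0 ≤ J' u v) {h' : W → ℝ} (hh' : ∀ u, 0 ≤ h' u)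
    {c : ℝ} (hc : 0 ≤ c)
    (hW : ∀ σ : V → Bool, isingW J h σ = c * isingW J' h' (extendPlus ι σ))
    (χ : (W → Bool) → ℝ) (hχ : ∀ ρ τ, χ (cmul ρ τ) = χ ρ * χ τ) (hχ1 : ∀ ρ, χ ρ ≤ 1)
    (hχφ : (fun σ => χ (extendPlus ι σ)) ∈ posCone V) :
    ev J' h' χ ≤ ev J h (fun σ => χ (extendPlus ι σ)) := by
  apply ev_le_of_sum_nonneg
  have := ginibre (isingW J h) (isingW J' h') (extendPlus ι) χ hχ hχ1 hχφ (fun _ => 1)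
    (const_mem_posCone zero_le_one) ?_
  · simpa using this
  intro ρ
  simp only [hW]
  have : ∀ σ : V → Bool, isingW J' h' (extendPlus ι σ) * isingW J' h' (cmul ρ (extendPlus ι σ)) =
      (∏ u, ∏ v, Real.exp ((J' u v * (1 + spin (ρ u) * spin (ρ v))) *
        (spin (extendPlus ι σ u) * spin (extendPlus ι σ v)))) *
      ∏ u, Real.exp ((h' u * (1 + spin (ρ u))) * spin (extendPlus ι σ u)) := by
    intro σ
    simp only [isingW_eq_prod]
    rw [mul_mul_mul_comm]
    congr 1
    · rw [← Finset.prod_mul_distrib]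
      refine Finset.prod_congr rfl fun u _ => ?_
      rw [← Finset.prod_mul_distrib]
      refine Finset.prod_congr rfl fun v _ => ?_
      rw [← Real.exp_add, spin_cmul, spin_cmul]
      congr 1; ring
    · rw [← Finset.prod_mul_distrib]
      refine Finset.prod_congr rfl fun u _ => ?_
      rw [← Real.exp_add, spin_cmul]
      congr 1; ring
  simp only [mul_assoc c, this]
  refine mul_mem_posCone (const_mem_posCone hc) (mul_mem_posCone
    (prod_mem_posCone _ fun u _ => prod_mem_posCone _ fun v _ => ?_)
    (prod_mem_posCone _ fun u _ => ?_))
  · refine exp_mem_posCone (mul_nonneg (hJ' u v) ?_)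
      (mul_mem_posCone (extendPlus_mem_posCone ι u) (extendPlus_mem_posCone ι v))
      fun σ => spin_mul_mem _ _
    rcases spin_mul_mem (ρ u) (ρ v) with h | h <;> rw [h] <;> norm_num
  · refine exp_mem_posCone (mul_nonneg (hh' u) ?_) (extendPlus_mem_posCone ι u)
      fun σ => spin_eq_or _
    linarith [neg_one_le_spin (ρ u)]

/-- The second Griffiths inequality for two spins. -/
lemma ev_mul_le_ev_pair {J : V → V → ℝ} (hJ : ∀ u v, 0 ≤ J u v) {h : V → ℝ}
    (hh : ∀ u, 0 ≤ h u) (x y : V) :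
    ev J h (fun σ => spin (σ x)) * ev J h (fun σ => spin (σ y)) ≤ ev J h (pair x y) := by
  have := ginibre (isingW J h) (isingW J h) id (fun σ => spin (σ y))
    (fun ρ τ => spin_cmul ρ τ y) (fun ρ => spin_le_one _) (spin_mem_posCone y)
    (fun σ => spin (σ x)) (spin_mem_posCone x) ?_
  · have e : ∑ σ, ∑ τ, isingW J h σ * isingW J h τ * spin (σ x) * (spin (σ y) - spin (τ y)) =
        (∑ σ, isingW J h σ * pair x y σ) * (∑ τ, isingW J h τ) -
        (∑ σ, isingW J h σ * spin (σ x)) * (∑ τ, isingW J h τ * spin (τ y)) := by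
      rw [Finset.sum_mul_sum, Finset.sum_mul_sum, ← Finset.sum_sub_distrib]
      refine Finset.sum_congr rfl fun σ _ => ?_
      rw [← Finset.sum_sub_distrib]
      exact Finset.sum_congr rfl fun τ _ => by simp only [pair]; ring
    simp only [id] at this
    rw [e] at this
    have hZ := sum_isingW_pos J h
    rw [ev, ev, ev, div_mul_div_comm, div_le_div_iff₀ (mul_pos hZ hZ) hZ]
    nlinarith
  · intro ρ
    have : (fun σ : V → Bool => isingW J h σ * isingW J h (cmul ρ (id σ))) =
        isingW (fun u v => J u v * (1 + spin (ρ u) * spin (ρ v)))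
          (fun u => h u * (1 + spin (ρ u))) := by
      ext σ
      simp only [isingW, ← Real.exp_add, id, spin_cmul]
      congr 1
      rw [add_add_add_comm]
      congr 1
      · rw [← Finset.sum_add_distrib]
        refine Finset.sum_congr rfl fun u _ => ?_
        rw [← Finset.sum_add_distrib]
        exact Finset.sum_congr rfl fun v _ => by ring
      · rw [← Finset.sum_add_distrib]
        exact Finset.sum_congr rfl fun u _ => by ring
    rw [this]
    refine isingW_mem_posCone (fun u v => mul_nonneg (hJ u v) ?_)
      fun u => mul_nonneg (hh u) ?_
    · rcases spin_mul_mem (ρ u) (ρ v) with h | h <;> rw [h] <;> norm_num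
    · linarith [neg_one_le_spin (ρ u)]

end Ginibre

section Currents

variable {V : Type*} [Fintype V] [DecidableEq V]

/-- Edge weights of the expansion of a free and a plus Ising model into a three-state edge
configuration: `0` closed, `1` open of even parity, `2` open of odd parity. -/
noncomputable def edgeW (j : ℝ) : Fin 3 → ℝ := ![1, Real.cosh (2 * j) - 1, Real.sinh (2 * j)]

lemma edgeW_nonneg {j : ℝ} (hj : 0 ≤ j) (k : Fin 3) : 0 ≤ edgeW j k := by
  fin_cases k
  · simp [edgeW]
  · simp [edgeW, Real.one_le_cosh]
  · simp [edgeW, hj]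

lemma edgeW_pos {j : ℝ} (hj : 0 < j) (k : Fin 3) : 0 < edgeW j k := by
  fin_cases k
  · simp [edgeW]
  · simp [edgeW, Real.one_lt_cosh, hj.ne']
  · simp [edgeW, hj]

lemma exp_eq_sum_edgeW (j r t : ℝ) (hr : r = 1 ∨ r = -1) (ht : t = 1 ∨ t = -1) :
    Real.exp (j * (r * t)) * Real.exp (j * t) =
      ∑ k : Fin 3, edgeW j k * (if k ≠ 0 → r = 1 then 1 else 0) * (if k = 2 then t else 1) := by
  rw [← Real.exp_add, Fin.sum_univ_three]
  rcases hr with rfl | rfl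
  · have : j * (1 * t) + j * t = 2 * j * t := by ring
    rw [this, exp_mul_of_sq_eq_one _ _ ht]
    simp [edgeW]
  · have : j * (-1 * t) + j * t = 0 := by ring
    rw [this]
    have h : ¬ (-1 : ℝ) = 1 := by norm_num
    simp [edgeW, h]

/-- Weight of an edge configuration. -/
noncomputable def curW (J : V → V → ℝ) (ω : V × V → Fin 3) : ℝ := ∏ e, edgeW (J e.1 e.2) (ω e)

/-- `ρ` is constant along the open edges of `ω`. -/
def Compat (ω : V × V → Fin 3) (ρ : V → Bool) : Prop := ∀ e, ω e ≠ 0 → ρ e.1 = ρ e.2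

/-- Sum of `f` over the spin configurations constant on the clusters of `ω`. -/
noncomputable def clusterSum (f : (V → Bool) → ℝ) (ω : V × V → Fin 3) : ℝ :=
  ∑ ρ, f ρ * if Compat ω ρ then 1 else 0

/-- Sum of `f` against the product of the odd edges and the boundary fields. -/
noncomputable def sourceSum (h : V → ℝ) (f : (V → Bool) → ℝ) (ω : V × V → Fin 3) : ℝ :=
  ∑ τ, f τ * ((∏ e, if ω e = 2 then pair e.1 e.2 τ else 1) * ∏ u, Real.exp (h u * spin (τ u)))

lemma spin_mul_eq_one_iff (a b : Bool) : spin a * spin b = 1 ↔ a = b := by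
  cases a <;> cases b <;> norm_num [spin]

lemma sum_mul_sum_eq_currents (J : V → V → ℝ) (h : V → ℝ) (f g : (V → Bool) → ℝ)
    (hf : ∀ ρ τ, f (cmul ρ τ) = f ρ * f τ) :
    (∑ σ, isingW J 0 σ * f σ) * (∑ τ, isingW J h τ * g τ) =
      ∑ ω, curW J ω * clusterSum f ω * sourceSum h (fun τ => f τ * g τ) ω := by
  have key : ∀ ρ τ : V → Bool, isingW J 0 (cmul ρ τ) * isingW J h τ =
      ∑ ω : V × V → Fin 3, curW J ω * (if Compat ω ρ then 1 else 0) *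
        ((∏ e, if ω e = 2 then pair e.1 e.2 τ else 1) * ∏ u, Real.exp (h u * spin (τ u))) := by
    intro ρ τ
    rw [isingW_eq_prod, isingW_eq_prod]
    simp only [Pi.zero_apply, zero_mul, Real.exp_zero, Finset.prod_const_one, mul_one]
    rw [← mul_assoc]
    simp only [← mul_assoc _ _ (∏ u, Real.exp (h u * spin (τ u))), ← Finset.sum_mul]
    congr 1
    rw [← Fintype.prod_prod_type', ← Fintype.prod_prod_type', ← Finset.prod_mul_distrib]
    have : ∀ e : V × V, Real.exp (J e.1 e.2 * (spin (cmul ρ τ e.1) * spin (cmul ρ τ e.2))) *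
        Real.exp (J e.1 e.2 * (spin (τ e.1) * spin (τ e.2))) =
        ∑ k : Fin 3, edgeW (J e.1 e.2) k * (if k ≠ 0 → ρ e.1 = ρ e.2 then 1 else 0) *
          (if k = 2 then pair e.1 e.2 τ else 1) := by
      intro e
      have := exp_eq_sum_edgeW (J e.1 e.2) (spin (ρ e.1) * spin (ρ e.2))
        (spin (τ e.1) * spin (τ e.2)) (spin_mul_mem _ _) (spin_mul_mem _ _)
      simp only [spin_mul_eq_one_iff] at this
      rw [pair, ← this, spin_cmul, spin_cmul]
      congr 3; ring
    rw [Finset.prod_congr rfl fun e _ => this e, Fintype.prod_sum]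
    refine Finset.sum_congr rfl fun ω _ => ?_
    rw [Finset.prod_mul_distrib, Finset.prod_mul_distrib, Finset.prod_ite_zero]
    simp [curW, Compat]
  have e1 : (∑ σ, isingW J 0 σ * f σ) * (∑ τ, isingW J h τ * g τ) =
      ∑ τ, ∑ ρ, (isingW J 0 (cmul ρ τ) * isingW J h τ) * (f ρ * (f τ * g τ)) := by
    rw [mul_comm, Finset.sum_mul_sum]
    refine Finset.sum_congr rfl fun τ _ => ?_
    rw [← sum_cmul _ τ]
    refine Finset.sum_congr rfl fun ρ _ => ?_
    rw [hf]; ring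
  rw [e1]
  simp only [key, Finset.sum_mul]
  have : ∀ τ : V → Bool, (∑ ρ : V → Bool, ∑ ω : V × V → Fin 3,
      curW J ω * (if Compat ω ρ then 1 else 0) *
        ((∏ e, if ω e = 2 then pair e.1 e.2 τ else 1) * ∏ u, Real.exp (h u * spin (τ u))) *
        (f ρ * (f τ * g τ))) = ∑ ω : V × V → Fin 3, curW J ω * clusterSum f ω *
        ((f τ * g τ) * ((∏ e, if ω e = 2 then pair e.1 e.2 τ else 1) *
          ∏ u, Real.exp (h u * spin (τ u)))) := by
    intro τ
    rw [Finset.sum_comm]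
    refine Finset.sum_congr rfl fun ω _ => ?_
    rw [clusterSum, Finset.mul_sum, Finset.sum_mul]
    exact Finset.sum_congr rfl fun ρ _ => by ring
  simp only [this]
  rw [Finset.sum_comm]
  refine Finset.sum_congr rfl fun ω _ => ?_
  rw [sourceSum, Finset.mul_sum]

/-- The graph of open edges. -/
def openGraph (ω : V × V → Fin 3) : SimpleGraph V := SimpleGraph.fromRel fun u v => ω (u, v) ≠ 0

/-- Connectivity by open edges. -/
def Linked (ω : V × V → Fin 3) (x y : V) : Prop := (openGraph ω).Reachable x y

lemma Compat.eq_of_linked {ω : V × V → Fin 3} {ρ : V → Bool} (h : Compat ω ρ) {x y : V}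
    (hxy : Linked ω x y) : ρ x = ρ y := by
  obtain ⟨w⟩ := hxy
  induction w with
  | nil => rfl
  | cons hadj _ ih =>
    rw [← ih]
    rw [openGraph, SimpleGraph.fromRel_adj] at hadj
    rcases hadj.2 with h1 | h1
    · exact h _ h1
    · exact (h _ h1).symm

lemma linked_of_ne_zero {ω : V × V → Fin 3} (e : V × V) (he : ω e ≠ 0) : Linked ω e.1 e.2 := by
  by_cases h : e.1 = e.2
  · rw [h]; exact SimpleGraph.Reachable.refl _
  · exact SimpleGraph.Adj.reachable (by
      rw [openGraph, SimpleGraph.fromRel_adj]; exact ⟨h, Or.inl he⟩)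

/-- Flip the spins in a set. -/
noncomputable def flipOn (S : V → Prop) (ρ : V → Bool) : V → Bool :=
  fun u => if S u then !ρ u else ρ u

lemma flip_involutive (S : V → Prop) : Function.Involutive (flipOn S : (V → Bool) → _) := by
  intro ρ; ext u; simp only [flipOn]; split_ifs <;> simp

lemma sum_flip (S : V → Prop) (F : (V → Bool) → ℝ) : ∑ ρ, F (flipOn S ρ) = ∑ ρ, F ρ :=
  Equiv.sum_comp (flip_involutive S).toPerm F

lemma sum_eq_zero_of_flip (S : V → Prop) (F : (V → Bool) → ℝ)
    (hF : ∀ ρ, F (flipOn S ρ) = -F ρ) : ∑ ρ, F ρ = 0 := by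
  have h := sum_flip S F
  simp only [hF, Finset.sum_neg_distrib] at h
  linarith

lemma pair_flip_of_not_linked {ω : V × V → Fin 3} {x y : V} (h : ¬ Linked ω x y) (ρ : V → Bool) :
    pair x y (flipOn (Linked ω x) ρ) = -pair x y ρ := by
  have hx : Linked ω x x := SimpleGraph.Reachable.refl _
  simp [pair, flipOn, hx, h, spin_not]

lemma linked_congr {ω : V × V → Fin 3} (x : V) {e : V × V} (he : ω e ≠ 0) :
    Linked ω x e.1 ↔ Linked ω x e.2 :=
  ⟨fun h => h.trans (linked_of_ne_zero e he), fun h => h.trans (linked_of_ne_zero e he).symm⟩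

lemma compat_flip (ω : V × V → Fin 3) (x : V) (ρ : V → Bool) :
    Compat ω (flipOn (Linked ω x) ρ) ↔ Compat ω ρ := by
  refine forall_congr' fun e => forall_congr' fun he => ?_
  simp only [flipOn, linked_congr x he]
  split_ifs <;> simp

lemma clusterSum_pair (ω : V × V → Fin 3) (x y : V) :
    clusterSum (pair x y) ω = if Linked ω x y then clusterSum (fun _ => 1) ω else 0 := by
  split_ifs with h
  · refine Finset.sum_congr rfl fun ρ _ => ?_
    by_cases hc : Compat ω ρ
    · rw [pair, hc.eq_of_linked h, spin_sq]
    · simp [hc]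
  · apply sum_eq_zero_of_flip (Linked ω x)
    intro ρ
    rw [pair_flip_of_not_linked h, compat_flip]; ring

lemma clusterSum_one_nonneg (ω : V × V → Fin 3) : 0 ≤ clusterSum (fun _ => 1) ω :=
  Finset.sum_nonneg fun ρ _ => by split_ifs <;> simp

lemma clusterSum_one_le (ω : V × V → Fin 3) (e : V × V) (k : Fin 3) :
    clusterSum (fun _ => 1) ω ≤ 2 * clusterSum (fun _ => 1) (Function.update ω e k) := by
  obtain ⟨ω0, hω0⟩ : ∃ ω0, ω0 = Function.update ω e 0 := ⟨_, rfl⟩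
  have h0 : 0 ≤ clusterSum (pair e.1 e.2) ω0 := by
    rw [clusterSum_pair]; split_ifs
    · exact clusterSum_one_nonneg _
    · exact le_rfl
  have h1 : clusterSum (fun _ => 1) ω ≤ clusterSum (fun _ => 1) ω0 := by
    refine Finset.sum_le_sum fun ρ _ => ?_
    by_cases hc : Compat ω ρ
    · have : Compat ω0 ρ := by
        intro e' he'
        by_cases h : e' = e
        · subst h; simp [hω0] at he'
        · rw [hω0, Function.update_of_ne h] at he'; exact hc e' he'
      simp [hc, this]
    · simp only [hc, if_false]; split_ifs <;> simp
  have h2 : clusterSum (fun _ => 1) ω0 + clusterSum (pair e.1 e.2) ω0 ≤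
      2 * clusterSum (fun _ => 1) (Function.update ω e k) := by
    rw [clusterSum, clusterSum, clusterSum, ← Finset.sum_add_distrib, Finset.mul_sum]
    refine Finset.sum_le_sum fun ρ _ => ?_
    by_cases hc : Compat ω0 ρ
    · rcases spin_mul_mem (ρ e.1) (ρ e.2) with h | h
      · have : Compat (Function.update ω e k) ρ := by
          intro e' he'
          by_cases h' : e' = e
          · rw [h']; exact (spin_mul_eq_one_iff _ _).1 h
          · refine hc e' ?_
            rw [Function.update_of_ne h'] at he'
            rwa [hω0, Function.update_of_ne h']
        simp only [hc, this, pair, h]; norm_num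
      · simp only [hc, pair, h]; split_ifs <;> norm_num
    · simp only [hc, if_false, mul_zero, add_zero]; split_ifs <;> simp
  linarith

lemma pair_mem_posCone (x y : V) : pair x y ∈ posCone V := spin_mul_mem_posCone x y

lemma sourceSum_nonneg {h : V → ℝ} (hh : ∀ u, 0 ≤ h u) {f : (V → Bool) → ℝ}
    (hf : f ∈ posCone V) (ω : V × V → Fin 3) : 0 ≤ sourceSum h f ω := by
  refine sum_nonneg_of_mem_posCone (mul_mem_posCone hf (mul_mem_posCone
    (prod_mem_posCone _ fun e _ => ?_) (prod_mem_posCone _ fun u _ => ?_)))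
  · split_ifs
    · exact pair_mem_posCone _ _
    · exact const_mem_posCone zero_le_one
  · exact exp_mem_posCone (hh u) (spin_mem_posCone u) fun σ => spin_eq_or _

lemma sourceSum_pair_eq_zero {h : V → ℝ} {ω : V × V → Fin 3} {x y : V} (hxy : ¬ Linked ω x y)
    (hx : ∀ z, Linked ω x z → h z = 0) : sourceSum h (pair x y) ω = 0 := by
  apply sum_eq_zero_of_flip (Linked ω x)
  intro τ
  rw [pair_flip_of_not_linked hxy, neg_mul]
  congr 3
  · refine Finset.prod_congr rfl fun e _ => ?_
    split_ifs with he
    · have he' : ω e ≠ 0 := by rw [he]; decide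
      simp only [pair, flipOn, linked_congr x he']
      split_ifs <;> simp [spin_not]
    · rfl
  · refine Finset.prod_congr rfl fun u _ => ?_
    simp only [flipOn]
    split_ifs with hu
    · rw [hx u hu]; simp
    · rfl

lemma sourceSum_update_two (h : V → ℝ) (f : (V → Bool) → ℝ) (ω : V × V → Fin 3) (e : V × V)
    (he : ω e ≠ 2) :
    sourceSum h f (Function.update ω e 2) = sourceSum h (fun τ => pair e.1 e.2 τ * f τ) ω := by
  refine Finset.sum_congr rfl fun τ _ => ?_
  have : (∏ e', if Function.update ω e 2 e' = 2 then pair e'.1 e'.2 τ else 1) =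
      pair e.1 e.2 τ * ∏ e', if ω e' = 2 then pair e'.1 e'.2 τ else 1 := by
    rw [← Finset.mul_prod_erase _ _ (Finset.mem_univ e),
      ← Finset.mul_prod_erase _ (fun e' => if ω e' = 2 then pair e'.1 e'.2 τ else 1)
        (Finset.mem_univ e)]
    simp only [Function.update_self, if_true, he, if_false, one_mul]
    congr 1
    refine Finset.prod_congr rfl fun e' he' => ?_
    rw [Function.update_of_ne (Finset.ne_of_mem_erase he')]
  rw [this]; ring

lemma sourceSum_update_one (h : V → ℝ) (f : (V → Bool) → ℝ) (ω : V × V → Fin 3) (e : V × V)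
    (he : ω e ≠ 2) :
    sourceSum h f (Function.update ω e 1) = sourceSum h f ω := by
  refine Finset.sum_congr rfl fun τ _ => ?_
  congr 2
  refine Finset.prod_congr rfl fun e' _ => ?_
  by_cases h : e' = e
  · subst h; simp [he]
  · rw [Function.update_of_ne h]

lemma pair_mul_self (x y : V) (τ : V → Bool) : pair x y τ * pair x y τ = 1 := by
  simp only [pair]; rw [mul_mul_mul_comm, spin_sq, spin_sq, one_mul]

lemma sourceSum_update_one' (h : V → ℝ) (f : (V → Bool) → ℝ) (ω : V × V → Fin 3) (e : V × V)
    (he : ω e = 2) :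
    sourceSum h f (Function.update ω e 1) = sourceSum h (fun τ => pair e.1 e.2 τ * f τ) ω := by
  have h1 := sourceSum_update_two h (fun τ => pair e.1 e.2 τ * f τ) (Function.update ω e 1) e
    (by simp)
  rw [Function.update_idem, ← he, Function.update_eq_self] at h1
  rw [h1]
  congr 1
  ext τ
  rw [← mul_assoc, pair_mul_self, one_mul]

/-- The weight of an edge configuration with sources prescribed by `f`. -/
noncomputable def mixW (J : V → V → ℝ) (h : V → ℝ) (f : (V → Bool) → ℝ) (ω : V × V → Fin 3) : ℝ :=
  curW J ω * clusterSum (fun _ => 1) ω * sourceSum h f ω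

lemma curW_nonneg {J : V → V → ℝ} (hJ : ∀ u v, 0 ≤ J u v) (ω : V × V → Fin 3) : 0 ≤ curW J ω :=
  Finset.prod_nonneg fun _ _ => edgeW_nonneg (hJ _ _) _

lemma mixW_nonneg {J : V → V → ℝ} (hJ : ∀ u v, 0 ≤ J u v) {h : V → ℝ} (hh : ∀ u, 0 ≤ h u)
    {f : (V → Bool) → ℝ} (hf : f ∈ posCone V) (ω : V × V → Fin 3) : 0 ≤ mixW J h f ω :=
  mul_nonneg (mul_nonneg (curW_nonneg hJ ω) (clusterSum_one_nonneg ω)) (sourceSum_nonneg hh hf ω)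

lemma curW_update (J : V → V → ℝ) (ω : V × V → Fin 3) (e : V × V) (k : Fin 3) :
    curW J ω * edgeW (J e.1 e.2) k = curW J (Function.update ω e k) * edgeW (J e.1 e.2) (ω e) := by
  rw [curW, curW, ← Finset.mul_prod_erase _ _ (Finset.mem_univ e),
    ← Finset.mul_prod_erase _ (fun e' => edgeW (J e'.1 e'.2) (Function.update ω e k e'))
      (Finset.mem_univ e), Function.update_self]
  have : ∏ e' ∈ Finset.univ.erase e, edgeW (J e'.1 e'.2) (Function.update ω e k e') =
      ∏ e' ∈ Finset.univ.erase e, edgeW (J e'.1 e'.2) (ω e') :=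
    Finset.prod_congr rfl fun e' he' => by
      rw [Function.update_of_ne (Finset.ne_of_mem_erase he')]
  rw [this]; ring

lemma mixW_le_update {J : V → V → ℝ} (hJ : ∀ u v, 0 ≤ J u v) {h : V → ℝ} (hh : ∀ u, 0 ≤ h u)
    {f f' : (V → Bool) → ℝ} (hf : f ∈ posCone V) (ω : V × V → Fin 3) (e : V × V) (k : Fin 3)
    (he : 0 < J e.1 e.2) (hs : sourceSum h f' ω = sourceSum h f (Function.update ω e k)) :
    mixW J h f' ω ≤ 2 * edgeW (J e.1 e.2) (ω e) / edgeW (J e.1 e.2) k *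
      mixW J h f (Function.update ω e k) := by
  have hk := edgeW_pos he k
  have h1 : curW J ω = curW J (Function.update ω e k) * edgeW (J e.1 e.2) (ω e) /
      edgeW (J e.1 e.2) k := by
    rw [← curW_update]; field_simp
  rw [mixW, mixW, hs, h1]
  have h2 := clusterSum_one_le ω e k
  have h3 : 0 ≤ curW J (Function.update ω e k) * edgeW (J e.1 e.2) (ω e) /
      edgeW (J e.1 e.2) k := by
    have := curW_nonneg hJ (Function.update ω e k)
    have := edgeW_pos he (ω e)
    positivity
  have h4 := sourceSum_nonneg hh hf (Function.update ω e k)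
  calc _ ≤ curW J (Function.update ω e k) * edgeW (J e.1 e.2) (ω e) /
      edgeW (J e.1 e.2) k * (2 * clusterSum (fun _ => 1) (Function.update ω e k)) *
      sourceSum h f (Function.update ω e k) := by gcongr
    _ = _ := by ring

lemma sum_update_le (G : (V × V → Fin 3) → ℝ) (hG : ∀ ω, 0 ≤ G ω) (e : V × V) (k k' : Fin 3) :
    ∑ ω, (if ω e = k then G (Function.update ω e k') else 0) ≤ ∑ ω, G ω := by
  rw [← Finset.sum_filter]
  have hinj : Set.InjOn (fun ω : V × V → Fin 3 => Function.update ω e k')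
      (Finset.univ.filter fun ω : V × V → Fin 3 => ω e = k) := by
    intro ω hω ω' hω' heq
    simp only [Finset.coe_filter, Finset.mem_univ, true_and, Set.mem_ofPred_eq] at hω hω'
    ext1 e'
    by_cases h : e' = e
    · rw [h, hω, hω']
    · have := congrFun heq e'
      simpa [Function.update_of_ne h] using this
  rw [← Finset.sum_image (f := G) hinj]
  exact Finset.sum_le_univ_sum_of_nonneg hG

/-- Cost of changing the parity of an edge. -/
noncomputable def toggleCost (j : ℝ) : ℝ :=
  2 * edgeW j 0 / edgeW j 2 + 2 * edgeW j 1 / edgeW j 2 + 2 * edgeW j 2 / edgeW j 1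

/-- Cost of opening an edge. -/
noncomputable def fillCost (j : ℝ) : ℝ := 1 + 2 / edgeW j 1

lemma toggleCost_nonneg {j : ℝ} (hj : 0 < j) : 0 ≤ toggleCost j := by
  have := edgeW_pos hj 0
  have := edgeW_pos hj 1
  have := edgeW_pos hj 2
  unfold toggleCost
  positivity

lemma fillCost_pos {j : ℝ} (hj : 0 < j) : 0 < fillCost j := by
  have := edgeW_pos hj 1
  unfold fillCost
  positivity

lemma sum_mixW_toggle {J : V → V → ℝ} (hJ : ∀ u v, 0 ≤ J u v) {h : V → ℝ} (hh : ∀ u, 0 ≤ h u)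
    {f : (V → Bool) → ℝ} (hf : f ∈ posCone V) (e : V × V) (he : 0 < J e.1 e.2)
    (F : (V × V → Fin 3) → ℝ) (hF : ∀ ω, 0 ≤ F ω)
    (hmono : ∀ ω k, k ≠ 0 → F ω ≤ F (Function.update ω e k)) :
    ∑ ω, mixW J h (fun τ => pair e.1 e.2 τ * f τ) ω * F ω ≤
      toggleCost (J e.1 e.2) * ∑ ω, mixW J h f ω * F ω := by
  set j := J e.1 e.2 with hj
  set f' := fun τ => pair e.1 e.2 τ * f τ
  set G := fun ω => mixW J h f ω * F ω
  have hG : ∀ ω, 0 ≤ G ω := fun ω => mul_nonneg (mixW_nonneg hJ hh hf ω) (hF ω)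
  have hstep : ∀ ω k k', ω e = k → k' ≠ 0 →
      sourceSum h f' ω = sourceSum h f (Function.update ω e k') →
      mixW J h f' ω * F ω ≤ 2 * edgeW j k / edgeW j k' * G (Function.update ω e k') := by
    intro ω k k' hk hk' hs
    have h1 := mixW_le_update hJ hh hf ω e k' he hs
    rw [hk] at h1
    have h2 : 0 ≤ 2 * edgeW j k / edgeW j k' * mixW J h f (Function.update ω e k') := by
      have := edgeW_pos he k
      have := edgeW_pos he k'
      have := mixW_nonneg hJ hh hf (Function.update ω e k')
      positivity
    calc _ ≤ (2 * edgeW j k / edgeW j k' * mixW J h f (Function.update ω e k')) *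
          F (Function.update ω e k') :=
          mul_le_mul h1 (hmono ω k' hk') (hF ω) h2
      _ = _ := by ring
  have hpt : ∀ ω, mixW J h f' ω * F ω ≤
      2 * edgeW j 0 / edgeW j 2 * (if ω e = 0 then G (Function.update ω e 2) else 0) +
      2 * edgeW j 1 / edgeW j 2 * (if ω e = 1 then G (Function.update ω e 2) else 0) +
      2 * edgeW j 2 / edgeW j 1 * (if ω e = 2 then G (Function.update ω e 1) else 0) := by
    intro ω
    have h3 : ω e = 0 ∨ ω e = 1 ∨ ω e = 2 := by
      generalize ω e = k; revert k; decide
    rcases h3 with h3 | h3 | h3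
    · have := hstep ω 0 2 h3 (by decide) (sourceSum_update_two h f ω e (by rw [h3]; decide)).symm
      simpa [h3] using this
    · have := hstep ω 1 2 h3 (by decide) (sourceSum_update_two h f ω e (by rw [h3]; decide)).symm
      simpa [h3] using this
    · have := hstep ω 2 1 h3 (by decide) (sourceSum_update_one' h f ω e h3).symm
      simpa [h3] using this
  refine (Finset.sum_le_sum fun ω _ => hpt ω).trans ?_
  rw [Finset.sum_add_distrib, Finset.sum_add_distrib, ← Finset.mul_sum, ← Finset.mul_sum,
    ← Finset.mul_sum, toggleCost, add_mul, add_mul]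
  have p0 := edgeW_pos he 0
  have p1 := edgeW_pos he 1
  have p2 := edgeW_pos he 2
  exact add_le_add (add_le_add
    (mul_le_mul_of_nonneg_left (sum_update_le G hG e _ _) (by positivity))
    (mul_le_mul_of_nonneg_left (sum_update_le G hG e _ _) (by positivity)))
    (mul_le_mul_of_nonneg_left (sum_update_le G hG e _ _) (by positivity))

/-- Open an edge, keeping parities. -/
def openEdge (e : V × V) (ω : V × V → Fin 3) : V × V → Fin 3 :=
  if ω e = 0 then Function.update ω e 1 else ω

lemma sum_mixW_openEdge {J : V → V → ℝ} (hJ : ∀ u v, 0 ≤ J u v) {h : V → ℝ} (hh : ∀ u, 0 ≤ h u)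
    {f : (V → Bool) → ℝ} (hf : f ∈ posCone V) (e : V × V) (he : 0 < J e.1 e.2)
    (F : (V × V → Fin 3) → ℝ) (hF : ∀ ω, 0 ≤ F ω) :
    ∑ ω, mixW J h f ω * F (openEdge e ω) ≤ fillCost (J e.1 e.2) * ∑ ω, mixW J h f ω * F ω := by
  set j := J e.1 e.2 with hj
  set G := fun ω => mixW J h f ω * F ω
  have hG : ∀ ω, 0 ≤ G ω := fun ω => mul_nonneg (mixW_nonneg hJ hh hf ω) (hF ω)
  have hpt : ∀ ω, mixW J h f ω * F (openEdge e ω) ≤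
      G ω + 2 / edgeW j 1 * (if ω e = 0 then G (Function.update ω e 1) else 0) := by
    intro ω
    by_cases h0 : ω e = 0
    · have h1 := mixW_le_update hJ hh hf ω e 1 he
        (sourceSum_update_one h f ω e (by rw [h0]; decide)).symm
      have h2 := mul_le_mul_of_nonneg_right h1 (hF (Function.update ω e 1))
      have e0 : edgeW j 0 = 1 := by simp [edgeW]
      rw [h0, ← hj, e0] at h2
      simp only [openEdge, h0, if_true]
      have := hG ω
      simp only [G] at this ⊢
      linarith
    · simp [openEdge, h0, G]
  refine (Finset.sum_le_sum fun ω _ => hpt ω).trans ?_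
  rw [Finset.sum_add_distrib, ← Finset.mul_sum, fillCost, add_mul, one_mul]
  have p1 := edgeW_pos he 1
  exact add_le_add le_rfl (mul_le_mul_of_nonneg_left (sum_update_le G hG e _ _) (by positivity))

/-- Open all the edges of a set, keeping parities. -/
def openEdges (S : Finset (V × V)) (ω : V × V → Fin 3) : V × V → Fin 3 :=
  fun e => if e ∈ S ∧ ω e = 0 then 1 else ω e

lemma openEdges_insert {e : V × V} {S : Finset (V × V)} (ω : V × V → Fin 3) :
    openEdges (insert e S) ω = openEdge e (openEdges S ω) := by
  ext1 e'
  unfold openEdge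
  by_cases h : e' = e
  · subst h
    by_cases h0 : ω e' = 0 <;> by_cases hS : e' ∈ S <;> simp [openEdges, h0, hS]
  · split_ifs with h1
    · simp [openEdges, h]
    · simp [openEdges, h]

lemma sum_mixW_openEdges {J : V → V → ℝ} (hJ : ∀ u v, 0 ≤ J u v) {h : V → ℝ}
    (hh : ∀ u, 0 ≤ h u) {f : (V → Bool) → ℝ} (hf : f ∈ posCone V) {j : ℝ} (hj : 0 < j)
    (S : Finset (V × V)) (hS : ∀ e ∈ S, J e.1 e.2 = j)
    (F : (V × V → Fin 3) → ℝ) (hF : ∀ ω, 0 ≤ F ω) :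
    ∑ ω, mixW J h f ω * F (openEdges S ω) ≤ fillCost j ^ S.card * ∑ ω, mixW J h f ω * F ω := by
  induction S using Finset.induction_on generalizing F with
  | empty =>
    have h0 : ∀ ω : V × V → Fin 3, openEdges ∅ ω = ω := fun ω => by funext e; simp [openEdges]
    simp [h0]
  | insert e S he ih =>
    simp only [openEdges_insert]
    refine (ih (fun e' he' => hS e' (Finset.mem_insert_of_mem he'))
      (fun ω => F (openEdge e ω)) (fun ω => hF _)).trans ?_
    have h1 := hS e (Finset.mem_insert_self _ _)
    have := sum_mixW_openEdge hJ hh hf e (by rw [h1]; exact hj) F hF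
    rw [h1] at this
    rw [Finset.card_insert_of_notMem he, pow_succ, mul_assoc]
    exact mul_le_mul_of_nonneg_left this (pow_nonneg (fillCost_pos hj).le _)

end Currents

section MixE

variable {V : Type*} [Fintype V] [DecidableEq V]

/-- Expectation in the edge configuration of the superposition of a free and a plus model. -/
noncomputable def mixE (J : V → V → ℝ) (h : V → ℝ) (F : (V × V → Fin 3) → ℝ) : ℝ :=
  (∑ ω, mixW J h (fun _ => 1) ω * F ω) / ∑ ω, mixW J h (fun _ => 1) ω

/-- `x` is linked to the set `Y`. -/
def LinkedTo (Y : Finset V) (ω : V × V → Fin 3) (x : V) : Prop := ∃ y ∈ Y, Linked ω x y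

lemma sum_mixW_one (J : V → V → ℝ) (h : V → ℝ) :
    ∑ ω, mixW J h (fun _ => 1) ω = (∑ σ, isingW J 0 σ) * ∑ τ, isingW J h τ := by
  have := sum_mul_sum_eq_currents J h (fun _ => 1) (fun _ => 1) (fun _ _ => by ring)
  simp only [mul_one] at this
  rw [this]; rfl

lemma sum_mixW_one_pos (J : V → V → ℝ) (h : V → ℝ) : 0 < ∑ ω, mixW J h (fun _ => 1) ω := by
  rw [sum_mixW_one]; exact mul_pos (sum_isingW_pos _ _) (sum_isingW_pos _ _)

lemma mixE_linked (J : V → V → ℝ) (h : V → ℝ) (x y : V) :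
    mixE J h (fun ω => if Linked ω x y then 1 else 0) =
      ev J 0 (pair x y) * ev J h (pair x y) := by
  have := sum_mul_sum_eq_currents J h (pair x y) (pair x y) (pair_cmul x y)
  rw [mixE, sum_mixW_one, ev, ev, div_mul_div_comm, this]
  congr 1
  refine Finset.sum_congr rfl fun ω _ => ?_
  rw [clusterSum_pair, mixW]
  simp only [pair_mul_self]
  split_ifs <;> ring

lemma ev_pair_sub (J : V → V → ℝ) (h : V → ℝ) (x y : V) :
    ev J h (pair x y) - ev J 0 (pair x y) =
      (∑ ω, mixW J h (pair x y) ω * if Linked ω x y then 0 else 1) /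
        ∑ ω, mixW J h (fun _ => 1) ω := by
  have h1 := sum_mul_sum_eq_currents J h (fun _ => 1) (pair x y) (fun _ _ => by ring)
  have h2 := sum_mul_sum_eq_currents J h (pair x y) (fun _ => 1) (pair_cmul x y)
  simp only [mul_one, one_mul] at h1 h2
  have p1 := sum_isingW_pos J 0
  have p2 := sum_isingW_pos J h
  have : ev J h (pair x y) - ev J 0 (pair x y) =
      ((∑ σ, isingW J 0 σ) * (∑ τ, isingW J h τ * pair x y τ) -
        (∑ σ, isingW J 0 σ * pair x y σ) * ∑ τ, isingW J h τ) /
        ∑ ω, mixW J h (fun _ => 1) ω := by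
    rw [sum_mixW_one, ev, ev]; field_simp
  rw [this, h1, h2, ← Finset.sum_sub_distrib]
  congr 1
  refine Finset.sum_congr rfl fun ω _ => ?_
  rw [clusterSum_pair, mixW]
  change curW J ω * clusterSum (fun _ => 1) ω * sourceSum h (pair x y) ω -
    curW J ω * _ * sourceSum h (pair x y) ω = _
  split_ifs <;> ring

lemma mixE_mono {J : V → V → ℝ} (hJ : ∀ u v, 0 ≤ J u v) {h : V → ℝ} (hh : ∀ u, 0 ≤ h u)
    {F G : (V × V → Fin 3) → ℝ} (hFG : ∀ ω, F ω ≤ G ω) : mixE J h F ≤ mixE J h G :=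
  div_le_div_of_nonneg_right (Finset.sum_le_sum fun ω _ => mul_le_mul_of_nonneg_left (hFG ω)
    (mixW_nonneg hJ hh (const_mem_posCone zero_le_one) ω)) (sum_mixW_one_pos J h).le

lemma mixE_const (J : V → V → ℝ) (h : V → ℝ) (c : ℝ) : mixE J h (fun _ => c) = c := by
  rw [mixE, ← Finset.sum_mul]
  exact mul_div_cancel_left₀ c (sum_mixW_one_pos J h).ne'

lemma mixE_nonneg {J : V → V → ℝ} (hJ : ∀ u v, 0 ≤ J u v) {h : V → ℝ} (hh : ∀ u, 0 ≤ h u)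
    {F : (V × V → Fin 3) → ℝ} (hF : ∀ ω, 0 ≤ F ω) : 0 ≤ mixE J h F := by
  rw [← mixE_const J h 0]; exact mixE_mono hJ hh hF

lemma mixE_add (J : V → V → ℝ) (h : V → ℝ) (F G : (V × V → Fin 3) → ℝ) :
    mixE J h (fun ω => F ω + G ω) = mixE J h F + mixE J h G := by
  simp only [mixE, mul_add, Finset.sum_add_distrib, add_div]

lemma mixE_sum {ι : Type*} (J : V → V → ℝ) (h : V → ℝ) (s : Finset ι)
    (F : ι → (V × V → Fin 3) → ℝ) :
    mixE J h (fun ω => ∑ i ∈ s, F i ω) = ∑ i ∈ s, mixE J h (F i) := by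
  simp only [mixE, Finset.mul_sum]
  rw [Finset.sum_comm, Finset.sum_div]

lemma mixE_openEdges {J : V → V → ℝ} (hJ : ∀ u v, 0 ≤ J u v) {h : V → ℝ}
    (hh : ∀ u, 0 ≤ h u) {j : ℝ} (hj : 0 < j) (S : Finset (V × V)) (hS : ∀ e ∈ S, J e.1 e.2 = j)
    (F : (V × V → Fin 3) → ℝ) (hF : ∀ ω, 0 ≤ F ω) :
    mixE J h (fun ω => F (openEdges S ω)) ≤ fillCost j ^ S.card * mixE J h F := by
  rw [mixE, mixE, ← mul_div_assoc]
  exact div_le_div_of_nonneg_right (sum_mixW_openEdges hJ hh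
    (const_mem_posCone zero_le_one) hj S hS F hF) (sum_mixW_one_pos J h).le

lemma mixE_linked_le {J : V → V → ℝ} (hJ : ∀ u v, 0 ≤ J u v) (h : V → ℝ) (x y : V) :
    mixE J h (fun ω => if Linked ω x y then 1 else 0) ≤ ev J 0 (pair x y) := by
  rw [mixE_linked]
  exact mul_le_of_le_one_right (ev_nonneg hJ (fun _ => le_rfl) (pair_mem_posCone x y))
    (ev_mono_const (pair_le_one x y))

lemma openGraph_le_update (ω : V × V → Fin 3) (e : V × V) {k : Fin 3} (hk : k ≠ 0) :
    openGraph ω ≤ openGraph (Function.update ω e k) := by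
  intro u v huv
  rw [openGraph, SimpleGraph.fromRel_adj] at huv ⊢
  have key : ∀ e', ω e' ≠ 0 → Function.update ω e k e' ≠ 0 := by
    intro e' h
    by_cases he : e' = e
    · rw [he, Function.update_self]; exact hk
    · rwa [Function.update_of_ne he]
  exact ⟨huv.1, huv.2.imp (key _) (key _)⟩

lemma LinkedTo.update {Y : Finset V} {ω : V × V → Fin 3} {x : V} (h : LinkedTo Y ω x)
    (e : V × V) {k : Fin 3} (hk : k ≠ 0) : LinkedTo Y (Function.update ω e k) x := by
  obtain ⟨y, hy, hxy⟩ := h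
  exact ⟨y, hy, hxy.mono (openGraph_le_update ω e hk)⟩

lemma sum_mixW_pair_le {J : V → V → ℝ} (hJ : ∀ u v, 0 ≤ J u v) {h : V → ℝ} (hh : ∀ u, 0 ≤ h u)
    {G : SimpleGraph V} {j : ℝ} (hj : 0 < j) (hG : ∀ u v, G.Adj u v → J u v = j)
    (F : (V × V → Fin 3) → ℝ) (hF : ∀ ω, 0 ≤ F ω)
    (hmono : ∀ ω e k, k ≠ 0 → F ω ≤ F (Function.update ω e k)) {x y : V} (w : G.Walk x y) :
    ∑ ω, mixW J h (pair x y) ω * F ω ≤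
      toggleCost j ^ w.length * ∑ ω, mixW J h (fun _ => 1) ω * F ω := by
  induction w with
  | @nil u =>
    have : pair u u = fun _ => (1 : ℝ) := by ext σ; simp [pair, spin_sq]
    simp [this]
  | @cons u v w hadj q ih =>
    have : pair u w = fun τ => pair u v τ * pair v w τ := by
      ext τ; simp only [pair]
      linear_combination (-spin (τ u) * spin (τ w)) * spin_sq (τ v)
    have h1 := hG u v hadj
    have h2 := sum_mixW_toggle hJ hh (pair_mem_posCone v w) (u, v) (by simpa [h1] using hj) F hF
      (fun ω k hk => hmono ω (u, v) k hk)
    simp only [h1] at h2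
    rw [this, SimpleGraph.Walk.length_cons, pow_succ', mul_assoc]
    exact h2.trans (mul_le_mul_of_nonneg_left ih (toggleCost_nonneg hj))

/-- The boundary influence on a two-point function is controlled by a connection to the boundary. -/
lemma ev_pair_le_add {J : V → V → ℝ} (hJ : ∀ u v, 0 ≤ J u v) {h : V → ℝ} (hh : ∀ u, 0 ≤ h u)
    {G : SimpleGraph V} {j : ℝ} (hj : 0 < j) (hG : ∀ u v, G.Adj u v → J u v = j)
    {Y : Finset V} (hY : ∀ u, h u ≠ 0 → u ∈ Y) {x y : V} (w : G.Walk x y) :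
    ev J h (pair x y) ≤ ev J 0 (pair x y) +
      toggleCost j ^ w.length * mixE J h (fun ω => if LinkedTo Y ω x then 1 else 0) := by
  rw [← sub_le_iff_le_add', ev_pair_sub, mixE, ← mul_div_assoc]
  refine div_le_div_of_nonneg_right ?_ (sum_mixW_one_pos J h).le
  refine le_trans ?_ (sum_mixW_pair_le hJ hh hj hG (fun ω => if LinkedTo Y ω x then 1 else 0)
    (fun ω => by split_ifs <;> norm_num) ?_ w)
  · refine Finset.sum_le_sum fun ω _ => ?_
    by_cases h1 : Linked ω x y
    · simp only [h1, if_true, mul_zero]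
      exact mul_nonneg (mixW_nonneg hJ hh (pair_mem_posCone x y) ω)
        (by split_ifs <;> norm_num)
    · by_cases h2 : LinkedTo Y ω x
      · simp [h1, h2]
      · have : sourceSum h (pair x y) ω = 0 := sourceSum_pair_eq_zero h1 fun z hz => by
          by_contra hne
          exact h2 ⟨z, hY z hne, hz⟩
        simp [mixW, this]
  · intro ω e k hk
    split_ifs with h1 h2
    · exact le_rfl
    · exact absurd (h1.update e hk) h2
    · norm_num
    · norm_num

end MixE

section Trifurcation

variable {V : Type*}

/-- Remove from `H` the edges inside `S`. -/
def cutGraph (H : SimpleGraph V) (S : Finset V) : SimpleGraph V where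
  Adj u v := H.Adj u v ∧ ¬(u ∈ S ∧ v ∈ S)
  symm := ⟨fun _ _ h => ⟨h.1.symm, fun h' => h.2 h'.symm⟩⟩
  loopless := ⟨fun _ h => h.1.ne rfl⟩

/-- Keep only the edges of `H` inside `S`. -/
def insideGraph (H : SimpleGraph V) (S : Finset V) : SimpleGraph V where
  Adj u v := H.Adj u v ∧ u ∈ S ∧ v ∈ S
  symm := ⟨fun _ _ h => ⟨h.1.symm, h.2.symm⟩⟩
  loopless := ⟨fun _ h => h.1.ne rfl⟩

lemma cutGraph_le (H : SimpleGraph V) (S : Finset V) : cutGraph H S ≤ H := fun _ _ h => h.1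

lemma cutGraph_anti (H : SimpleGraph V) {S T : Finset V} (h : S ⊆ T) :
    cutGraph H T ≤ cutGraph H S := fun _ _ h' => ⟨h'.1, fun h'' => h'.2 ⟨h h''.1, h h''.2⟩⟩

lemma insideGraph_le (H : SimpleGraph V) (S : Finset V) : insideGraph H S ≤ H := fun _ _ h => h.1

lemma exists_first_hit {H : SimpleGraph V} {S : Finset V} {r b : V} (h : H.Reachable r b)
    (hb : b ∈ S) : ∃ w ∈ S, (cutGraph H S).Reachable r w := by
  obtain ⟨p⟩ := h
  induction p with
  | nil => exact ⟨_, hb, SimpleGraph.Reachable.refl _⟩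
  | @cons u v _ hadj _ ih =>
    by_cases hu : u ∈ S
    · exact ⟨u, hu, SimpleGraph.Reachable.refl _⟩
    · obtain ⟨w, hw, hvw⟩ := ih hb
      have h1 : (cutGraph H S).Adj u v := ⟨hadj, fun h => hu h.1⟩
      exact ⟨w, hw, h1.reachable.trans hvw⟩

lemma reachable_cut_of_avoid {H : SimpleGraph V} {S T : Finset V} {u v : V}
    (h : (cutGraph H S).Reachable u v) (hT : ∀ w ∈ T, ¬ (cutGraph H S).Reachable u w) :
    (cutGraph H T).Reachable u v := by
  obtain ⟨p⟩ := h
  induction p with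
  | nil => exact SimpleGraph.Reachable.refl _
  | @cons u v _ hadj _ ih =>
    have h1 : (cutGraph H T).Adj u v :=
      ⟨hadj.1, fun h => hT u h.1 (SimpleGraph.Reachable.refl _)⟩
    exact h1.reachable.trans (ih fun w hw h => hT w hw (hadj.reachable.trans h))

/-- `S` is a trifurcation box: it is internally connected, and removing its edges leaves at least
three components that meet both `S` and `Y`. -/
def IsTrifurcation (H : SimpleGraph V) (Y S : Finset V) : Prop :=
  (∀ u ∈ S, ∀ v ∈ S, (insideGraph H S).Reachable u v) ∧
  ∃ v : Fin 3 → V, (∀ k, v k ∈ S) ∧ (∀ k l, k ≠ l → ¬ (cutGraph H S).Reachable (v k) (v l)) ∧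
    ∀ k, ∃ y ∈ Y, (cutGraph H S).Reachable (v k) y

/-- The representative of the component of a vertex. -/
noncomputable def compRoot (H : SimpleGraph V) (v : V) : V := (H.connectedComponentMk v).out

lemma reachable_compRoot (H : SimpleGraph V) (v : V) : H.Reachable (compRoot H v) v :=
  SimpleGraph.ConnectedComponent.exact (Quot.out_eq _)

lemma compRoot_eq {H : SimpleGraph V} {u v : V} (h : H.Reachable u v) :
    compRoot H u = compRoot H v := by
  rw [compRoot, compRoot, SimpleGraph.ConnectedComponent.sound h]

/-- Data extracted from a trifurcation box: two branches away from the root, with `y` the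
larger of the two minimal endpoints. -/
def BranchData (H : SimpleGraph V) (Y : Finset V) (rk : V → ℕ) (S : Finset V) (y : V) : Prop :=
  ∃ a ∈ S, ∃ b ∈ S, ∃ y' ∈ Y, (cutGraph H S).Reachable a y' ∧ (cutGraph H S).Reachable b y ∧
    rk y' < rk y ∧ (∀ z ∈ Y, (cutGraph H S).Reachable b z → rk y ≤ rk z) ∧
    ¬ (cutGraph H S).Reachable (compRoot H y) a ∧ ¬ (cutGraph H S).Reachable (compRoot H y) b

lemma exists_two_branches {H : SimpleGraph V} {Y S : Finset V} (h : IsTrifurcation H Y S) (r : V) :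
    ∃ a ∈ S, ∃ b ∈ S, ¬ (cutGraph H S).Reachable a b ∧ ¬ (cutGraph H S).Reachable r a ∧
      ¬ (cutGraph H S).Reachable r b ∧ (∃ y ∈ Y, (cutGraph H S).Reachable a y) ∧
      ∃ y ∈ Y, (cutGraph H S).Reachable b y := by
  obtain ⟨_, v, hv, hne, hy⟩ := h
  by_cases h0 : (cutGraph H S).Reachable r (v 0)
  · exact ⟨v 1, hv 1, v 2, hv 2, hne 1 2 (by decide),
      fun h => hne 0 1 (by decide) (h0.symm.trans h),
      fun h => hne 0 2 (by decide) (h0.symm.trans h), hy 1, hy 2⟩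
  · by_cases h1 : (cutGraph H S).Reachable r (v 1)
    · exact ⟨v 0, hv 0, v 2, hv 2, hne 0 2 (by decide), h0,
        fun h => hne 1 2 (by decide) (h1.symm.trans h), hy 0, hy 2⟩
    · exact ⟨v 0, hv 0, v 1, hv 1, hne 0 1 (by decide), h0, h1, hy 0, hy 1⟩

lemma exists_branchData {H : SimpleGraph V} {Y S : Finset V} {rk : V → ℕ}
    (hrk : Function.Injective rk) (h : IsTrifurcation H Y S) :
    ∃ y ∈ Y, BranchData H Y rk S y := by
  have hmin : ∀ c, (∃ y ∈ Y, (cutGraph H S).Reachable c y) →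
      ∃ y ∈ Y, (cutGraph H S).Reachable c y ∧
        ∀ z ∈ Y, (cutGraph H S).Reachable c z → rk y ≤ rk z := by
    rintro c ⟨y, hy, hcy⟩
    obtain ⟨m, hm, hmin⟩ := Finset.exists_min_image
      (Y.filter fun z => (cutGraph H S).Reachable c z) rk ⟨y, by simp [hy, hcy]⟩
    rw [Finset.mem_filter] at hm
    exact ⟨m, hm.1, hm.2, fun z hz hcz => hmin z (by simp [hz, hcz])⟩
  obtain ⟨v, hv, -, -⟩ := h.2
  obtain ⟨a, ha, b, hb, hab, hra, hrb, hya, hyb⟩ := exists_two_branches h (compRoot H (v 0))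
  have hroot : ∀ c ∈ S, ∀ y, (cutGraph H S).Reachable c y → compRoot H y = compRoot H (v 0) := by
    intro c hc y hy
    exact (compRoot_eq (((h.1 _ (hv 0) _ hc).mono (insideGraph_le H S)).trans
      (hy.mono (cutGraph_le H S)))).symm
  obtain ⟨m, hmY, ham, hmmin⟩ := hmin a hya
  obtain ⟨n, hnY, hbn, hnmin⟩ := hmin b hyb
  rcases lt_trichotomy (rk m) (rk n) with hlt | heq | hlt
  · exact ⟨n, hnY, a, ha, b, hb, m, hmY, ham, hbn, hlt, hnmin,
      by rwa [hroot b hb n hbn], by rwa [hroot b hb n hbn]⟩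
  · exact absurd (ham.trans ((hrk heq) ▸ hbn.symm)) hab
  · exact ⟨m, hmY, b, hb, a, ha, n, hnY, hbn, ham, hlt, hmmin,
      by rwa [hroot a ha m ham], by rwa [hroot a ha m ham]⟩

lemma branchData_absurd {H : SimpleGraph V} {Y S T : Finset V} {rk : V → ℕ} {y w : V}
    (hST : Disjoint S T) (hS : ∀ u ∈ S, ∀ v ∈ S, (insideGraph H S).Reachable u v)
    (hT : ∀ u ∈ T, ∀ v ∈ T, (insideGraph H T).Reachable u v)
    (h1 : BranchData H Y rk S y) (h2 : BranchData H Y rk T y) (hw : w ∈ S)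
    (hrw : (cutGraph H (S ∪ T)).Reachable (compRoot H y) w) : False := by
  obtain ⟨-, -, b, -, -, -, -, hby, -, hmin, -, -⟩ := h1
  obtain ⟨a', ha', b', hb', y', hy', hay', hby', hlt, -, hra, hrb⟩ := h2
  have hle : ∀ {A B : Finset V}, Disjoint A B → insideGraph H A ≤ cutGraph H B :=
    fun hAB u v h => ⟨h.1, fun h' => Finset.disjoint_left.1 hAB h.2.1 h'.1⟩
  have hrS : ∀ u ∈ S, (cutGraph H T).Reachable (compRoot H y) u := fun u hu =>
    (hrw.mono (cutGraph_anti H Finset.subset_union_right)).trans ((hS w hw u hu).mono (hle hST))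
  have h3 : (cutGraph H S).Reachable a' y' :=
    reachable_cut_of_avoid hay' fun u hu h => hra ((hrS u hu).trans h.symm)
  have h4 : (cutGraph H S).Reachable b' y :=
    reachable_cut_of_avoid hby' fun u hu h => hrb ((hrS u hu).trans h.symm)
  have h5 : (cutGraph H S).Reachable a' b' := (hT _ ha' _ hb').mono (hle hST.symm)
  exact absurd (hmin y' hy' (hby.trans (h4.symm.trans (h5.symm.trans h3)))) (not_le.2 hlt)

/-- The number of disjoint trifurcation boxes is at most the number of boundary points. -/
lemma card_trifurcation_le [Fintype V] {ι : Type*} (H : SimpleGraph V) (Y : Finset V)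
    (I : Finset ι) (B : ι → Finset V) (hB : ∀ i ∈ I, ∀ j ∈ I, i ≠ j → Disjoint (B i) (B j))
    (hI : ∀ i ∈ I, IsTrifurcation H Y (B i)) : I.card ≤ Y.card := by
  set rk : V → ℕ := fun v => (Fintype.equivFin V v : ℕ)
  have hrk : Function.Injective rk := Fin.val_injective.comp (Fintype.equivFin V).injective
  rcases I.eq_empty_or_nonempty with rfl | ⟨i₀, hi₀⟩
  · simp
  have : Nonempty V := ⟨(exists_branchData hrk (hI i₀ hi₀)).choose⟩
  choose! f hfY hf using fun i (hi : i ∈ I) => exists_branchData hrk (hI i hi)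
  refine Finset.card_le_card_of_injOn f hfY ?_
  intro i hi j hj hij
  by_contra hne
  have hj' : BranchData H Y rk (B j) (f i) := hij ▸ hf j hj
  obtain ⟨-, -, b, hb, -, -, -, hby, -⟩ := hf i hi
  have hr : H.Reachable (compRoot H (f i)) b :=
    (reachable_compRoot H _).trans (hby.mono (cutGraph_le _ _)).symm
  obtain ⟨w, hw, hrw⟩ := exists_first_hit (S := B i ∪ B j) hr (Finset.mem_union_left _ hb)
  have hd := hB i hi j hj hne
  rcases Finset.mem_union.1 hw with hw | hw
  · exact branchData_absurd hd (hI i hi).1 (hI j hj).1 (hf i hi) hj' hw hrw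
  · rw [Finset.union_comm] at hrw
    exact branchData_absurd hd.symm (hI j hj).1 (hI i hi).1 hj' (hf i hi) hw hrw

end Trifurcation

section Density

variable {V : Type*} [Fintype V] [DecidableEq V]

lemma isTrifurcation_openEdges {ω : V × V → Fin 3} {Y B : Finset V} {G : SimpleGraph V}
    {S : Finset (V × V)} (hS : ∀ u v, (u, v) ∈ S → u ∈ B ∧ v ∈ B)
    (hGS : ∀ u v, u ∈ B → v ∈ B → G.Adj u v → (u, v) ∈ S)
    (hG : ∀ u ∈ B, ∀ v ∈ B, (insideGraph G B).Reachable u v) (x : Fin 3 → V)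
    (hx : ∀ k, x k ∈ B) (hne : ∀ k l, k ≠ l → ¬ Linked ω (x k) (x l))
    (hY : ∀ k, LinkedTo Y ω (x k)) : IsTrifurcation (openGraph (openEdges S ω)) Y B := by
  have hcut : ∀ u v, (cutGraph (openGraph (openEdges S ω)) B).Adj u v ↔
      (cutGraph (openGraph ω) B).Adj u v := by
    intro u v
    simp only [cutGraph, openGraph, SimpleGraph.fromRel_adj]
    by_cases h : u ∈ B ∧ v ∈ B
    · simp [h]
    · have h1 : (u, v) ∉ S := fun h' => h (hS _ _ h')
      have h2 : (v, u) ∉ S := fun h' => h (hS _ _ h').symm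
      simp [openEdges, h1, h2]
  have hcut' : cutGraph (openGraph (openEdges S ω)) B = cutGraph (openGraph ω) B := by
    ext u v; exact hcut u v
  have hin : insideGraph G B ≤ insideGraph (openGraph (openEdges S ω)) B := by
    intro u v h
    refine ⟨?_, h.2⟩
    rw [openGraph, SimpleGraph.fromRel_adj]
    refine ⟨h.1.ne, Or.inl ?_⟩
    have := hGS u v h.2.1 h.2.2 h.1
    simp only [openEdges]
    split_ifs with h'
    · decide
    · exact fun h0 => h' ⟨this, h0⟩
  refine ⟨fun u hu v hv => (hG u hu v hv).mono hin, ?_⟩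
  rw [hcut']
  choose y hyY hy using hY
  choose w hw hyw using fun k => exists_first_hit (hy k).symm (hx k)
  refine ⟨w, hw, fun k l hkl h => hne k l hkl ?_, fun k => ⟨y k, hyY k, (hyw k).symm⟩⟩
  have h1 : ∀ k, Linked ω (x k) (w k) := fun k => (hy k).trans ((hyw k).mono (cutGraph_le _ _))
  exact (h1 k).trans ((h.mono (cutGraph_le _ _)).trans (h1 l).symm)

lemma mixE_const_mul (J : V → V → ℝ) (h : V → ℝ) (c : ℝ) (F : (V × V → Fin 3) → ℝ) :
    mixE J h (fun ω => c * F ω) = c * mixE J h F := by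
  simp only [mixE]
  rw [← mul_div_assoc, Finset.mul_sum]
  congr 1
  exact Finset.sum_congr rfl fun ω _ => by ring

lemma density_le_trifurcation {J : V → V → ℝ} (hJ : ∀ u v, 0 ≤ J u v) {h : V → ℝ}
    (hh : ∀ u, 0 ≤ h u) {j : ℝ} (hj : 0 < j) {G : SimpleGraph V}
    (hG : ∀ u v, G.Adj u v → J u v = j) {Y B : Finset V} (hB : 0 < B.card)
    (hconn : ∀ u ∈ B, ∀ v ∈ B, (insideGraph G B).Reachable u v) {θ ε : ℝ} (hθ : 0 ≤ θ)
    (h1 : θ * B.card ≤ ∑ x ∈ B, mixE J h (fun ω => if LinkedTo Y ω x then 1 else 0))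
    (h2 : ∑ x ∈ B, ∑ y ∈ B, ev J 0 (pair x y) ≤ ε * (B.card : ℝ) ^ 2) :
    θ ^ 3 - 3 * ε ≤ fillCost j ^ (B.card ^ 2) *
      mixE J h (fun ω => if IsTrifurcation (openGraph ω) Y B then 1 else 0) := by
  set b : ℝ := (B.card : ℝ)
  have hb : 0 < b := Nat.cast_pos.2 hB
  set a : V → (V × V → Fin 3) → ℝ := fun x ω => if LinkedTo Y ω x then 1 else 0
  set l : V → V → (V × V → Fin 3) → ℝ := fun x y ω => if Linked ω x y then 1 else 0
  set T : (V × V → Fin 3) → ℝ := fun ω => if IsTrifurcation (openGraph ω) Y B then 1 else 0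
  set S : Finset (V × V) := (B ×ˢ B).filter fun e => J e.1 e.2 = j
  have hT : ∀ ω, 0 ≤ T ω := fun ω => by simp only [T]; split_ifs <;> norm_num
  have ha : ∀ x ω, 0 ≤ a x ω := fun x ω => by simp only [a]; split_ifs <;> norm_num
  have hl : ∀ x y ω, 0 ≤ l x y ω := fun x y ω => by simp only [l]; split_ifs <;> norm_num
  have ha1 : ∀ x ω, a x ω ≤ 1 := fun x ω => by simp only [a]; split_ifs <;> norm_num
  have htriple : ∀ ω x y z, x ∈ B → y ∈ B → z ∈ B → a x ω * (a y ω * a z ω) ≤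
      T (openEdges S ω) + (l x y ω + l y z ω + l x z ω) := by
    intro ω x y z hx hy hz
    have hT' := hT (openEdges S ω)
    have n1 := hl x y ω
    have n2 := hl y z ω
    have n3 := hl x z ω
    have hprod : a x ω * (a y ω * a z ω) ≤ 1 :=
      mul_le_one₀ (ha1 _ _) (mul_nonneg (ha _ _) (ha _ _))
        (mul_le_one₀ (ha1 _ _) (ha _ _) (ha1 _ _))
    by_cases c1 : Linked ω x y
    · have : l x y ω = 1 := if_pos c1
      linarith
    by_cases c2 : Linked ω y z
    · have : l y z ω = 1 := if_pos c2
      linarith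
    by_cases c3 : Linked ω x z
    · have : l x z ω = 1 := if_pos c3
      linarith
    by_cases d1 : LinkedTo Y ω x
    swap
    · have : a x ω = 0 := if_neg d1
      rw [this, zero_mul]; linarith
    by_cases d2 : LinkedTo Y ω y
    swap
    · have : a y ω = 0 := if_neg d2
      rw [this, zero_mul, mul_zero]; linarith
    by_cases d3 : LinkedTo Y ω z
    swap
    · have : a z ω = 0 := if_neg d3
      rw [this, mul_zero, mul_zero]; linarith
    have hTri : IsTrifurcation (openGraph (openEdges S ω)) Y B := by
      refine isTrifurcation_openEdges (G := G) (fun u v huv => ?_) (fun u v hu hv huv => ?_) hconn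
        ![x, y, z] ?_ ?_ ?_
      · exact Finset.mem_product.1 (Finset.mem_filter.1 huv).1
      · exact Finset.mem_filter.2 ⟨Finset.mem_product.2 ⟨hu, hv⟩, hG u v huv⟩
      · intro k; fin_cases k <;> assumption
      · have c1' : ¬ Linked ω y x := fun h => c1 h.symm
        have c2' : ¬ Linked ω z y := fun h => c2 h.symm
        have c3' : ¬ Linked ω z x := fun h => c3 h.symm
        intro k l hkl
        fin_cases k <;> fin_cases l <;> first | exact absurd rfl hkl | assumption
      · intro k; fin_cases k <;> assumption
    have : T (openEdges S ω) = 1 := if_pos hTri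
    linarith
  set s : (V × V → Fin 3) → ℝ := fun ω => ∑ x ∈ B, a x ω
  set q : (V × V → Fin 3) → ℝ := fun ω => ∑ x ∈ B, ∑ y ∈ B, l x y ω
  have hcube : ∀ ω, s ω ^ 3 ≤ b ^ 3 * T (openEdges S ω) + 3 * b * q ω := by
    intro ω
    have e1 : s ω ^ 3 = ∑ x ∈ B, ∑ y ∈ B, ∑ z ∈ B, a x ω * (a y ω * a z ω) := by
      have : s ω ^ 3 = s ω * (s ω * s ω) := by ring
      rw [this]
      simp only [s]
      rw [Finset.sum_mul_sum, Finset.sum_mul_sum]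
      simp only [Finset.mul_sum]
    rw [e1]
    calc _ ≤ ∑ x ∈ B, ∑ y ∈ B, ∑ z ∈ B, (T (openEdges S ω) + (l x y ω + l y z ω + l x z ω)) :=
          Finset.sum_le_sum fun x hx => Finset.sum_le_sum fun y hy => Finset.sum_le_sum
            fun z hz => htriple ω x y z hx hy hz
      _ = _ := by
          simp only [Finset.sum_add_distrib, Finset.sum_const, nsmul_eq_mul, ← Finset.mul_sum, q]
          ring
  set t := θ * b
  have ht : 0 ≤ t := mul_nonneg hθ hb.le
  have hs0 : ∀ ω, 0 ≤ s ω := fun ω => Finset.sum_nonneg fun x _ => ha x ω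
  have hE1 : t ≤ mixE J h s := by
    rw [mixE_sum]; exact h1
  have hE2 : mixE J h q ≤ ε * b ^ 2 := by
    refine le_trans ?_ h2
    rw [mixE_sum]
    refine Finset.sum_le_sum fun x _ => ?_
    rw [mixE_sum]
    exact Finset.sum_le_sum fun y _ => mixE_linked_le hJ h x y
  have hE3 : mixE J h (fun ω => T (openEdges S ω)) ≤ fillCost j ^ (B.card ^ 2) * mixE J h T := by
    refine (mixE_openEdges hJ hh hj S (fun e he => (Finset.mem_filter.1 he).2) T hT).trans ?_
    have hcard : S.card ≤ B.card ^ 2 := by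
      refine (Finset.card_filter_le _ _).trans ?_
      rw [Finset.card_product, sq]
    have h1f : 1 ≤ fillCost j := by
      have := edgeW_pos hj 1
      rw [fillCost]
      have : 0 ≤ 2 / edgeW j 1 := by positivity
      linarith
    exact mul_le_mul_of_nonneg_right (pow_le_pow_right₀ h1f hcard) (mixE_nonneg hJ hh hT)
  have hlow : 3 * t ^ 2 * mixE J h s ≤ mixE J h (fun ω => s ω ^ 3) + 2 * t ^ 3 := by
    rw [← mixE_const J h (2 * t ^ 3), ← mixE_add, ← mixE_const_mul]
    refine mixE_mono hJ hh fun ω => ?_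
    nlinarith [mul_nonneg (sq_nonneg (s ω - t)) (add_nonneg (hs0 ω) (mul_nonneg zero_le_two ht))]
  have hup : mixE J h (fun ω => s ω ^ 3) ≤
      b ^ 3 * mixE J h (fun ω => T (openEdges S ω)) + 3 * b * mixE J h q := by
    rw [← mixE_const_mul, ← mixE_const_mul, ← mixE_add]
    exact mixE_mono hJ hh hcube
  have h3 : 3 * t ^ 2 * t ≤ 3 * t ^ 2 * mixE J h s :=
    mul_le_mul_of_nonneg_left hE1 (by positivity)
  have h4 : 3 * b * mixE J h q ≤ 3 * b * (ε * b ^ 2) :=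
    mul_le_mul_of_nonneg_left hE2 (by positivity)
  have h5 := mul_le_mul_of_nonneg_left hE3 (pow_nonneg hb.le 3)
  have h6 : b ^ 3 * (θ ^ 3 - 3 * ε) ≤ b ^ 3 * (fillCost j ^ (B.card ^ 2) * mixE J h T) := by
    have : t ^ 3 = b ^ 3 * θ ^ 3 := by simp only [t]; ring
    nlinarith
  exact le_of_mul_le_mul_left h6 (pow_pos hb 3)

/-- If in each of many disjoint boxes there is a positive density of vertices linked to `Y` while
the two-point function is small on average, then there are few boxes compared to `Y`. -/
lemma card_boxes_le {ι : Type*} {J : V → V → ℝ} (hJ : ∀ u v, 0 ≤ J u v) {h : V → ℝ}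
    (hh : ∀ u, 0 ≤ h u) {j : ℝ} (hj : 0 < j) {G : SimpleGraph V}
    (hG : ∀ u v, G.Adj u v → J u v = j) {Y : Finset V} (I : Finset ι) (B : ι → Finset V)
    (hdisj : ∀ i ∈ I, ∀ i' ∈ I, i ≠ i' → Disjoint (B i) (B i')) {b : ℕ} (hb : 0 < b)
    (hB : ∀ i ∈ I, (B i).card = b)
    (hconn : ∀ i ∈ I, ∀ u ∈ B i, ∀ v ∈ B i, (insideGraph G (B i)).Reachable u v) {θ ε : ℝ}
    (hθ : 0 ≤ θ)
    (h1 : ∀ i ∈ I, θ * b ≤ ∑ x ∈ B i, mixE J h (fun ω => if LinkedTo Y ω x then 1 else 0))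
    (h2 : ∀ i ∈ I, ∑ x ∈ B i, ∑ y ∈ B i, ev J 0 (pair x y) ≤ ε * (b : ℝ) ^ 2) :
    I.card * (θ ^ 3 - 3 * ε) ≤ fillCost j ^ (b ^ 2) * Y.card := by
  calc (I.card : ℝ) * (θ ^ 3 - 3 * ε) = ∑ i ∈ I, (θ ^ 3 - 3 * ε) := by
        rw [Finset.sum_const, nsmul_eq_mul]
    _ ≤ ∑ i ∈ I, fillCost j ^ (b ^ 2) *
          mixE J h (fun ω => if IsTrifurcation (openGraph ω) Y (B i) then 1 else 0) := by
        refine Finset.sum_le_sum fun i hi => ?_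
        have := density_le_trifurcation hJ hh hj hG (Y := Y) (B := B i) (by rw [hB i hi]; exact hb)
          (hconn i hi) hθ (by rw [hB i hi]; exact h1 i hi) (by rw [hB i hi]; exact h2 i hi)
        rwa [hB i hi] at this
    _ = fillCost j ^ (b ^ 2) * mixE J h
          (fun ω => ∑ i ∈ I, if IsTrifurcation (openGraph ω) Y (B i) then 1 else 0) := by
        rw [mixE_sum, Finset.mul_sum]
    _ ≤ _ := by
        refine mul_le_mul_of_nonneg_left ?_ (pow_nonneg (fillCost_pos hj).le _)
        rw [← mixE_const J h (Y.card : ℝ)]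
        refine mixE_mono hJ hh fun ω => ?_
        rw [← Finset.sum_filter, Finset.sum_const, nsmul_eq_mul, mul_one, Nat.cast_le]
        refine card_trifurcation_le (openGraph ω) Y _ B (fun i hi i' hi' => ?_) fun i hi => ?_
        · exact hdisj i (Finset.mem_filter.1 hi).1 i' (Finset.mem_filter.1 hi').1
        · exact (Finset.mem_filter.1 hi).2

end Density

section PosDefKernels

variable {X : Type*} [Fintype X]

lemma posSemidef_iff_form {M : Matrix X X ℝ} : M.PosSemidef ↔
    (∀ i j, M i j = M j i) ∧ ∀ c : X → ℝ, 0 ≤ ∑ i, ∑ j, c i * c j * M i j := by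
  rw [Matrix.posSemidef_iff_dotProduct_mulVec]
  refine and_congr ?_ (forall_congr' fun c => ?_)
  · rw [Matrix.IsHermitian, ← Matrix.ext_iff]
    simp only [Matrix.conjTranspose_apply, star_trivial]
    exact ⟨fun h i j => (h i j).symm, fun h i j => (h i j).symm⟩
  · simp only [dotProduct, Matrix.mulVec, star_trivial, Finset.mul_sum]
    have : ∀ i j, c i * (M i j * c j) = c i * c j * M i j := fun i j => by ring
    simp only [this]

lemma form_mul_exp_nonneg {M : X → X → ℝ} (hM : ∀ c : X → ℝ, 0 ≤ ∑ i, ∑ j, c i * c j * M i j)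
    {β : ℝ} (hβ : 0 ≤ β) (x : X → ℝ) (c : X → ℝ) :
    0 ≤ ∑ i, ∑ j, c i * c j * (M i j * Real.exp (β * (x i * x j))) := by
  have hs : HasSum (fun k : ℕ => ∑ i, ∑ j, c i * c j * (M i j *
      ((β * (x i * x j)) ^ k / k.factorial)))
      (∑ i, ∑ j, c i * c j * (M i j * Real.exp (β * (x i * x j)))) := by
    refine hasSum_sum fun i _ => hasSum_sum fun j _ => (HasSum.mul_left _ (HasSum.mul_left _ ?_))
    rw [Real.exp_eq_exp_ℝ]
    exact NormedSpace.expSeries_div_hasSum_exp (β * (x i * x j))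
  refine hs.nonneg fun k => ?_
  have : ∑ i, ∑ j, c i * c j * (M i j * ((β * (x i * x j)) ^ k / k.factorial)) =
      (β ^ k / k.factorial) * ∑ i, ∑ j, (c i * x i ^ k) * (c j * x j ^ k) * M i j := by
    simp only [Finset.mul_sum]
    refine Finset.sum_congr rfl fun i _ => Finset.sum_congr rfl fun j _ => ?_
    rw [mul_pow, mul_pow]; ring
  rw [this]
  exact mul_nonneg (by positivity) (hM _)

lemma form_mul_exp_sum_nonneg {Y : Type*} (s : Finset Y) {M : X → X → ℝ}
    (hM : ∀ c : X → ℝ, 0 ≤ ∑ i, ∑ j, c i * c j * M i j)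
    {β : ℝ} (hβ : 0 ≤ β) (x : X → Y → ℝ) (c : X → ℝ) :
    0 ≤ ∑ i, ∑ j, c i * c j * (M i j * Real.exp (β * ∑ y ∈ s, x i y * x j y)) := by
  induction s using Finset.induction_on generalizing c with
  | empty => simpa using hM c
  | insert y s hy ih =>
    have := form_mul_exp_nonneg ih hβ (fun i => x i y) c
    simp only [Finset.sum_insert hy, mul_add, Real.exp_add]
    exact this.trans (le_of_eq (Finset.sum_congr rfl fun i _ =>
      Finset.sum_congr rfl fun j _ => by ring))

lemma trace_mul_nonneg {P Q : Matrix X X ℝ} (hP : P.PosSemidef) (hQ : Q.PosSemidef) :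
    0 ≤ (P * Q).trace := by
  have h := (posSemidef_iff_form.1 (hP.hadamard hQ)).2 fun _ => 1
  have e : (P * Q).trace = ∑ i, ∑ j, P i j * Q i j := by
    simp only [Matrix.trace, Matrix.diag, Matrix.mul_apply]
    refine Finset.sum_congr rfl fun i _ => Finset.sum_congr rfl fun j _ => ?_
    rw [(posSemidef_iff_form.1 hQ).1 j i]
  rw [e]
  simpa [Matrix.hadamard] using h

/-- The correlation of a diagonal observable at distance `n` on a cycle of length `L`. -/
noncomputable def cycCorr (A T : Matrix X X ℝ) (L n : ℕ) : ℝ := (A * T ^ n * A * T ^ (L - n)).trace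

lemma cycCorr_convex {A T : Matrix X X ℝ} (hA : A.transpose = A) (hT : T.PosSemidef) {L n : ℕ}
    (hn : n + 2 ≤ L) :
    0 ≤ cycCorr A T L n + cycCorr A T L (n + 2) - 2 * cycCorr A T L (n + 1) := by
  obtain ⟨q, rfl⟩ : ∃ q, L = n + 2 + q := ⟨L - (n + 2), by omega⟩
  have hTt : T.transpose = T := by
    have := hT.1
    rwa [Matrix.IsHermitian, Matrix.conjTranspose_eq_transpose_of_trivial] at this
  have hconj : (A * T - T * A).conjTranspose = T * A - A * T := by
    rw [Matrix.conjTranspose_eq_transpose_of_trivial, Matrix.transpose_sub, Matrix.transpose_mul,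
      Matrix.transpose_mul, hA, hTt]
  have hpos := trace_mul_nonneg ((hT.pow n).mul_mul_conjTranspose_same (A * T - T * A)) (hT.pow q)
  rw [hconj] at hpos
  have e1 : cycCorr A T (n + 2 + q) n = (T * A * T ^ n * (A * T) * T ^ q).trace := by
    rw [cycCorr, show n + 2 + q - n = 1 + q + 1 by omega, pow_succ, pow_add, pow_one,
      ← Matrix.mul_assoc, Matrix.trace_mul_comm]
    simp only [Matrix.mul_assoc]
  have e2 : cycCorr A T (n + 2 + q) (n + 2) = (A * T * T ^ n * (T * A) * T ^ q).trace := by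
    rw [cycCorr, show n + 2 + q - (n + 2) = q by omega, show n + 2 = 1 + n + 1 by omega, pow_succ,
      pow_add, pow_one]
    simp only [Matrix.mul_assoc]
  have e3 : cycCorr A T (n + 2 + q) (n + 1) = (A * T * T ^ n * (A * T) * T ^ q).trace := by
    rw [cycCorr, show n + 2 + q - (n + 1) = 1 + q by omega, show n + 1 = 1 + n by omega, pow_add,
      pow_add, pow_one]
    simp only [Matrix.mul_assoc]
  have e4 : cycCorr A T (n + 2 + q) (n + 1) = (T * A * T ^ n * (T * A) * T ^ q).trace := by
    rw [cycCorr, show n + 2 + q - (n + 1) = q + 1 by omega, pow_succ, pow_succ,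
      ← Matrix.mul_assoc, Matrix.trace_mul_comm]
    simp only [Matrix.mul_assoc]
  have e5 : ((A * T - T * A) * T ^ n * (T * A - A * T) * T ^ q).trace =
      (A * T * T ^ n * (T * A) * T ^ q).trace - (A * T * T ^ n * (A * T) * T ^ q).trace -
      (T * A * T ^ n * (T * A) * T ^ q).trace + (T * A * T ^ n * (A * T) * T ^ q).trace := by
    rw [← Matrix.trace_sub, ← Matrix.trace_sub, ← Matrix.trace_add]
    congr 1
    noncomm_ring
  rw [e5, ← e2, ← e3, ← e4, ← e1] at hpos
  linarith

lemma sub_le_mul_of_convex (g : ℕ → ℝ) (L : ℕ)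
    (hg : ∀ n, n + 2 ≤ L → 0 ≤ g n + g (n + 2) - 2 * g (n + 1)) :
    ∀ n, n ≤ L → g 0 - g n ≤ n * (g 0 - g 1) := by
  have h1 : ∀ n, n + 1 ≤ L → g n - g (n + 1) ≤ g 0 - g 1 := by
    intro n
    induction n with
    | zero => intro _; exact le_rfl
    | succ n ih => intro hn; have := hg n hn; have := ih (by omega); linarith
  intro n
  induction n with
  | zero => intro _; simp
  | succ n ih =>
    intro hn
    have := h1 n hn
    have := ih (by omega)
    push_cast
    linarith

lemma one_add_sq_half_le_cosh (u : ℝ) : 1 + u ^ 2 / 2 ≤ Real.cosh u := by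
  have h := Real.hasSum_cosh u
  have := h.summable.sum_le_tsum (Finset.range 2) fun k _ => by
    rw [pow_mul]; positivity
  rw [h.tsum_eq] at this
  simpa [Finset.sum_range_succ] using this

/-- Gradient bound for one bond of a cycle with a Gaussian-type kernel. -/
lemma sum_mul_exp_sq_sub_le {Y : Type*} [Fintype Y] {M : X → X → ℝ}
    (hM : ∀ c : X → ℝ, 0 ≤ ∑ i, ∑ j, c i * c j * M i j)
    (hM0 : ∀ i j, 0 ≤ M i j) {β : ℝ} (hβ : 0 < β) (x : X → Y → ℝ)
    (φ : Y → ℝ) :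
    ∑ i, ∑ j, M i j * Real.exp (β * ∑ y, x i y * x j y) *
        (∑ y, φ y * x i y - ∑ y, φ y * x j y) ^ 2 ≤
      2 * (∑ y, φ y ^ 2) / β * ∑ i, ∑ j, M i j * Real.exp (β * ∑ y, x i y * x j y) := by
  set a : X → ℝ := fun i => ∑ y, φ y * x i y
  set Φ := ∑ y, φ y ^ 2
  set K : X → X → ℝ := fun i j => Real.exp (β * ∑ y, x i y * x j y)
  have hΦ0 : 0 ≤ Φ := Finset.sum_nonneg fun y _ => sq_nonneg _
  have hMK : 0 ≤ ∑ i, ∑ j, M i j * K i j :=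
    Finset.sum_nonneg fun i _ => Finset.sum_nonneg fun j _ =>
      mul_nonneg (hM0 i j) (Real.exp_pos _).le
  rcases hΦ0.eq_or_lt with hΦ | hΦ
  · have h0 : ∀ y, φ y = 0 := fun y => by
      have := (Finset.sum_eq_zero_iff_of_nonneg fun y _ => sq_nonneg (φ y)).1 hΦ.symm y
        (Finset.mem_univ y)
      exact pow_eq_zero_iff (two_ne_zero) |>.1 this
    have ha : ∀ i, a i = 0 := fun i => by simp [a, h0]
    change ∑ i, ∑ j, M i j * K i j * (a i - a j) ^ 2 ≤ 2 * Φ / β * ∑ i, ∑ j, M i j * K i j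
    simp [ha, ← hΦ]
  obtain ⟨t, ht⟩ : ∃ t : ℝ, t ^ 2 = 2 / (β * Φ) := ⟨_, Real.sq_sqrt (by positivity)⟩
  have ht' : β * t ^ 2 * Φ = 2 := by rw [ht]; field_simp
  set M' : X × Bool → X × Bool → ℝ := fun i j => M i.1 j.1
  have hM' : ∀ c : X × Bool → ℝ, 0 ≤ ∑ i, ∑ j, c i * c j * M' i j := by
    intro c
    have := hM fun i => c (i, true) + c (i, false)
    simp only [M', Fintype.sum_prod_type, Fintype.sum_bool]
    convert this using 2 with i
    rw [← Finset.sum_add_distrib]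
    exact Finset.sum_congr rfl fun j _ => by ring
  have hquad := form_mul_exp_sum_nonneg Finset.univ hM' hβ.le
    (fun i y => x i.1 y + if i.2 then t * φ y else 0)
    (fun i => if i.2 then -Real.exp (-(β * t * a i.1) - 1) else 1)
  have hexp : ∀ i j, Real.exp (β * ∑ y, (x i y + t * φ y) * x j y) =
      K i j * Real.exp (β * t * a j) := by
    intro i j
    have : β * ∑ y, (x i y + t * φ y) * x j y = β * ∑ y, x i y * x j y + β * t * a j := by
      simp only [a, Finset.mul_sum, ← Finset.sum_add_distrib]
      exact Finset.sum_congr rfl fun y _ => by ring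
    rw [this, Real.exp_add]
  have hexp' : ∀ i j, Real.exp (β * ∑ y, x i y * (x j y + t * φ y)) =
      K i j * Real.exp (β * t * a i) := by
    intro i j
    have : β * ∑ y, x i y * (x j y + t * φ y) = β * ∑ y, x i y * x j y + β * t * a i := by
      simp only [a, Finset.mul_sum, ← Finset.sum_add_distrib]
      exact Finset.sum_congr rfl fun y _ => by ring
    rw [this, Real.exp_add]
  have hexp2 : ∀ i j, Real.exp (β * ∑ y, (x i y + t * φ y) * (x j y + t * φ y)) =
      K i j * Real.exp (β * t * a i + β * t * a j + 2) := by
    intro i j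
    have : β * ∑ y, (x i y + t * φ y) * (x j y + t * φ y) =
        β * ∑ y, x i y * x j y + (β * t * a i + β * t * a j + β * t ^ 2 * Φ) := by
      simp only [a, Φ, Finset.mul_sum, ← Finset.sum_add_distrib]
      exact Finset.sum_congr rfl fun y _ => by ring
    rw [this, ht', Real.exp_add]
  have hcosh : ∑ i, ∑ j, M i j * K i j * Real.cosh (β * t * (a i - a j)) ≤
      Real.exp 1 * ∑ i, ∑ j, M i j * K i j := by
    simp only [Fintype.sum_prod_type, Fintype.sum_bool, M', if_true, Bool.false_eq_true, if_false,
      add_zero, hexp, hexp', hexp2] at hquad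
    have hterm : ∀ i j, -Real.exp (-(β * t * a i) - 1) * -Real.exp (-(β * t * a j) - 1) *
          (M i j * (K i j * Real.exp (β * t * a i + β * t * a j + 2))) +
        -Real.exp (-(β * t * a i) - 1) * 1 * (M i j * (K i j * Real.exp (β * t * a j))) +
        (1 * -Real.exp (-(β * t * a j) - 1) * (M i j * (K i j * Real.exp (β * t * a i))) +
        1 * 1 * (M i j * Real.exp (β * ∑ y, x i y * x j y))) =
        2 * (M i j * K i j) -
          2 * Real.exp (-1) * (M i j * K i j * Real.cosh (β * t * (a i - a j))) := by
      intro i j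
      have e1 : Real.exp (-(β * t * a i) - 1) * Real.exp (-(β * t * a j) - 1) *
          Real.exp (β * t * a i + β * t * a j + 2) = 1 := by
        rw [← Real.exp_add, ← Real.exp_add]
        refine (congrArg Real.exp ?_).trans Real.exp_zero
        ring
      have e2 : Real.exp (-(β * t * a i) - 1) * Real.exp (β * t * a j) =
          Real.exp (-1) * Real.exp (-(β * t * (a i - a j))) := by
        rw [← Real.exp_add, ← Real.exp_add]; congr 1; ring
      have e3 : Real.exp (-(β * t * a j) - 1) * Real.exp (β * t * a i) =
          Real.exp (-1) * Real.exp (β * t * (a i - a j)) := by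
        rw [← Real.exp_add, ← Real.exp_add]; congr 1; ring
      rw [Real.cosh_eq]
      change _ + (_ + 1 * 1 * (M i j * K i j)) = _
      linear_combination (M i j * K i j) * e1 - (M i j * K i j) * e2 - (M i j * K i j) * e3
    have hsum : ∑ i, ∑ j, (2 * (M i j * K i j) -
        2 * Real.exp (-1) * (M i j * K i j * Real.cosh (β * t * (a i - a j)))) ≥ 0 := by
      simp only [← hterm]
      refine hquad.trans (le_of_eq ?_)
      refine Finset.sum_congr rfl fun i _ => ?_
      rw [← Finset.sum_add_distrib]
    simp only [Finset.sum_sub_distrib, ← Finset.mul_sum] at hsum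
    have e0 : Real.exp 1 * Real.exp (-1) = 1 := by rw [← Real.exp_add]; simp
    set S₁ := ∑ i, ∑ j, M i j * K i j
    set S₂ := ∑ i, ∑ j, M i j * K i j * Real.cosh (β * t * (a i - a j))
    calc S₂ = Real.exp 1 * (Real.exp (-1) * S₂) := by rw [← mul_assoc, e0, one_mul]
      _ ≤ Real.exp 1 * S₁ := mul_le_mul_of_nonneg_left (by linarith) (Real.exp_pos 1).le
  have hlow : ∑ i, ∑ j, (M i j * K i j + β / Φ * (M i j * K i j * (a i - a j) ^ 2)) ≤
      ∑ i, ∑ j, M i j * K i j * Real.cosh (β * t * (a i - a j)) := by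
    refine Finset.sum_le_sum fun i _ => Finset.sum_le_sum fun j _ => ?_
    have h1 := one_add_sq_half_le_cosh (β * t * (a i - a j))
    have h2 : (β * t * (a i - a j)) ^ 2 / 2 = β / Φ * (a i - a j) ^ 2 := by
      rw [mul_pow, mul_pow, ht]; field_simp
    rw [h2] at h1
    have := mul_le_mul_of_nonneg_left h1
      (mul_nonneg (hM0 i j) (Real.exp_pos _).le : 0 ≤ M i j * K i j)
    linarith
  simp only [Finset.sum_add_distrib, ← Finset.mul_sum] at hlow
  have h3 : β / Φ * ∑ i, ∑ j, M i j * K i j * (a i - a j) ^ 2 ≤ 2 * ∑ i, ∑ j, M i j * K i j := by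
    have := Real.exp_one_lt_three
    nlinarith
  have h4 := mul_le_mul_of_nonneg_left h3 (by positivity : 0 ≤ Φ / β)
  have h5 : Φ / β * (β / Φ * ∑ i, ∑ j, M i j * K i j * (a i - a j) ^ 2) =
      ∑ i, ∑ j, M i j * K i j * (a i - a j) ^ 2 := by field_simp
  rw [h5] at h4
  calc _ ≤ _ := h4
    _ = _ := by ring

end PosDefKernels

section TransferMatrix

variable {X : Type*} [Fintype X]

/-- The product `N 0 * N 1 * ⋯ * N (k - 1)`. -/
noncomputable def matProd (N : ℕ → Matrix X X ℝ) : ℕ → Matrix X X ℝ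
  | 0 => 1
  | k + 1 => matProd N k * N k

lemma matProd_apply (N : ℕ → Matrix X X ℝ) (k : ℕ) (x y : X) :
    matProd N k x y = ∑ s : Fin (k + 1) → X, if s 0 = x ∧ s (Fin.last k) = y then
      ∏ i : Fin k, N i (s i.castSucc) (s i.succ) else 0 := by
  induction k generalizing y with
  | zero =>
    rw [← (Equiv.funUnique (Fin 1) X).symm.sum_comp]
    simp only [matProd, Matrix.one_apply, Finset.univ_eq_empty, Finset.prod_empty]
    rw [Finset.sum_eq_single x]
    · simp
    · intro b _ hb; simp [hb]
    · simp
  | succ k ih =>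
    rw [← (Fin.snocEquiv fun _ => X).sum_comp, Fintype.sum_prod_type, matProd, Matrix.mul_apply]
    simp only [ih, Fin.snocEquiv_apply, Finset.sum_mul]
    rw [Finset.sum_comm]
    rw [Finset.sum_comm (s := Finset.univ (α := X))]
    refine Finset.sum_congr rfl fun s _ => ?_
    have h0 : ∀ z : X, (Fin.snoc s z : Fin (k + 2) → X) 0 = s 0 := fun z => by
      rw [← Fin.castSucc_zero]; exact Fin.snoc_castSucc (α := fun _ => X) _ _ _
    by_cases hx : s 0 = x
    · rw [Finset.sum_eq_single (s (Fin.last k)), Finset.sum_eq_single y]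
      · simp only [hx, true_and, if_true, Fin.snoc_last, h0]
        rw [Fin.prod_univ_castSucc]
        simp only [← Fin.castSucc_succ, Fin.snoc_castSucc, Fin.succ_last, Fin.snoc_last,
          Fin.val_castSucc, Fin.val_last]
      · intro b _ hb; simp [hb]
      · simp
      · intro b _ hb; simp [hb.symm]
      · simp
    · simp [hx, h0]

lemma trace_matProd (N : ℕ → Matrix X X ℝ) (m : ℕ) :
    (matProd N (m + 1)).trace =
      ∑ s : Fin (m + 1) → X, ∏ i : Fin (m + 1), N i (s i) (s (i + 1)) := by
  simp only [Matrix.trace, Matrix.diag, matProd_apply]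
  rw [Finset.sum_comm, ← (Fin.snocEquiv fun _ => X).sum_comp, Fintype.sum_prod_type,
    Finset.sum_comm]
  refine Finset.sum_congr rfl fun s _ => ?_
  have h0 : ∀ z : X, (Fin.snoc s z : Fin (m + 2) → X) 0 = s 0 := fun z => by
    rw [← Fin.castSucc_zero]; exact Fin.snoc_castSucc (α := fun _ => X) _ _ _
  simp only [Fin.snocEquiv_apply, h0, Fin.snoc_last]
  rw [Finset.sum_eq_single (s 0)]
  · rw [Finset.sum_eq_single (s 0)]
    · simp only [and_self, if_true]
      refine Finset.prod_congr rfl fun i _ => ?_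
      rw [Fin.snoc_castSucc]
      congr 1
      induction i using Fin.lastCases with
      | last => rw [Fin.succ_last, Fin.snoc_last, Fin.last_add_one]
      | cast i => rw [← Fin.castSucc_succ, Fin.snoc_castSucc, ← Fin.coeSucc_eq_succ]
    · intro b _ hb; simp [hb.symm]
    · simp
  · intro b _ hb
    refine Finset.sum_eq_zero fun z _ => ?_
    rw [if_neg]; rintro ⟨h1, h2⟩; exact hb (h2.trans h1.symm)
  · simp

lemma sum_prod_cycle (T : Matrix X X ℝ) (f : X → ℝ) (m : ℕ) :
    ∑ s : Fin (m + 1) → X, f (s 0) * ∏ i, T (s i) (s (i + 1)) =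
      (Matrix.diagonal f * T ^ (m + 1)).trace := by
  set N : ℕ → Matrix X X ℝ := fun i => (if i = 0 then Matrix.diagonal f else 1) * T
  have h : ∀ k, matProd N (k + 1) = Matrix.diagonal f * T ^ (k + 1) := by
    intro k
    induction k with
    | zero => simp [matProd, N]
    | succ k ih => rw [matProd, ih, pow_succ T (k + 1)]; simp [N, Matrix.mul_assoc]
  rw [← h, trace_matProd]
  refine Finset.sum_congr rfl fun s _ => ?_
  have : ∀ i : Fin (m + 1), N i (s i) (s (i + 1)) =
      (if i = 0 then f (s i) else 1) * T (s i) (s (i + 1)) := by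
    intro i
    by_cases hi : i = 0
    · simp [N, hi]
    · have : (i : ℕ) ≠ 0 := fun h => hi (Fin.ext h)
      simp [N, hi]
  simp only [this, Finset.prod_mul_distrib, Finset.prod_ite_eq', Finset.mem_univ, if_true]

lemma sum_prod_cycle_pair (T : Matrix X X ℝ) (f : X → ℝ) (m n : ℕ) (hn0 : n ≠ 0) (hn : n < m + 1) :
    ∑ s : Fin (m + 1) → X, f (s 0) * f (s ⟨n, hn⟩) * ∏ i, T (s i) (s (i + 1)) =
      cycCorr (Matrix.diagonal f) T (m + 1) n := by
  set N : ℕ → Matrix X X ℝ := fun i => (if i = 0 ∨ i = n then Matrix.diagonal f else 1) * T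
  have h : ∀ k, k < n → matProd N (k + 1) = Matrix.diagonal f * T ^ (k + 1) := by
    intro k
    induction k with
    | zero => intro _; simp [matProd, N]
    | succ k ih =>
      intro hk
      rw [matProd, ih (by omega), pow_succ T (k + 1)]; simp [N, hk.ne, Matrix.mul_assoc]
  have h' : ∀ k, matProd N (n + k + 1) =
      Matrix.diagonal f * T ^ n * Matrix.diagonal f * T ^ (k + 1) := by
    intro k
    induction k with
    | zero =>
      obtain ⟨n, rfl⟩ := Nat.exists_eq_succ_of_ne_zero hn0
      rw [add_zero, matProd, Nat.succ_eq_add_one, h n (by omega)]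
      simp [N, Matrix.mul_assoc]
    | succ k ih =>
      have : n + k + 1 ≠ n := by omega
      rw [matProd, ← add_assoc, ih, pow_succ T (k + 1)]
      simp [N, this, Matrix.mul_assoc]
  obtain ⟨k, hk⟩ : ∃ k, m = n + k := ⟨m - n, by omega⟩
  have e : cycCorr (Matrix.diagonal f) T (m + 1) n = (matProd N (m + 1)).trace := by
    rw [cycCorr, hk, h', show n + k + 1 - n = k + 1 by omega]
  rw [e, trace_matProd]
  refine Finset.sum_congr rfl fun s _ => ?_
  have hne : (0 : Fin (m + 1)) ≠ ⟨n, hn⟩ := fun h => hn0 (Fin.ext_iff.1 h).symm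
  have : ∀ i : Fin (m + 1), N i (s i) (s (i + 1)) =
      (if i = 0 then f (s i) else 1) * (if i = ⟨n, hn⟩ then f (s i) else 1) *
        T (s i) (s (i + 1)) := by
    intro i
    by_cases hi : i = 0
    · simp [N, hi, hne]
    · have : (i : ℕ) ≠ 0 := fun h => hi (Fin.ext h)
      by_cases hi' : i = ⟨n, hn⟩
      · simp [N, hi', hne.symm]
      · have : (i : ℕ) ≠ n := fun h => hi' (Fin.ext h)
        simp [N, hi, hi', this]
  simp only [this, Finset.prod_mul_distrib, Finset.prod_ite_eq', Finset.mem_univ, if_true]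

lemma sum_cycle_shift {m : ℕ} (F : (Fin (m + 1) → X) → ℝ) (c : Fin (m + 1)) :
    ∑ s : Fin (m + 1) → X, F (fun i => s (i + c)) = ∑ s, F s :=
  ((Equiv.addRight c).symm.arrowCongr (Equiv.refl X)).sum_comp F

lemma sum_cycle_sq_sub_le {T : Matrix X X ℝ} (hT : T.PosSemidef) (a : X → ℝ) (m n : ℕ)
    (hn : n < m + 1) :
    ∑ s : Fin (m + 1) → X, (a (s 0) - a (s ⟨n, hn⟩)) ^ 2 * ∏ i, T (s i) (s (i + 1)) ≤
      n * ∑ x, ∑ y, T x y * (T ^ m) y x * (a x - a y) ^ 2 := by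
  rcases Nat.eq_zero_or_pos n with rfl | hn0
  · simp
  set g := cycCorr (Matrix.diagonal a) T (m + 1)
  have hconv := sub_le_mul_of_convex g (m + 1)
    (fun k hk => cycCorr_convex (Matrix.diagonal_transpose a) hT hk) n hn.le
  have hTs := (posSemidef_iff_form.1 hT).1
  have hTs' := (posSemidef_iff_form.1 (hT.pow m)).1
  have hg0 : g 0 = (Matrix.diagonal (fun x => a x ^ 2) * T ^ (m + 1)).trace := by
    simp only [g, cycCorr, pow_zero, mul_one, Matrix.diagonal_mul_diagonal, Nat.sub_zero, sq]
  have hg0' : g 0 = ∑ x, ∑ y, T x y * (T ^ m) y x * a x ^ 2 := by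
    rw [hg0, pow_succ']
    simp only [Matrix.trace, Matrix.diag, Matrix.diagonal_mul]
    refine Finset.sum_congr rfl fun x _ => ?_
    rw [Matrix.mul_apply, Finset.mul_sum]
    exact Finset.sum_congr rfl fun y _ => by ring
  have hg0'' : g 0 = ∑ x, ∑ y, T x y * (T ^ m) y x * a y ^ 2 := by
    rw [hg0', Finset.sum_comm]
    refine Finset.sum_congr rfl fun x _ => Finset.sum_congr rfl fun y _ => ?_
    rw [hTs y x, hTs' x y]
  have hg1 : g 1 = ∑ x, ∑ y, T x y * (T ^ m) y x * (a x * a y) := by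
    simp only [g, cycCorr, pow_one, Nat.add_sub_cancel, Matrix.trace, Matrix.diag]
    refine Finset.sum_congr rfl fun x _ => ?_
    rw [Matrix.mul_apply]
    refine Finset.sum_congr rfl fun y _ => ?_
    rw [Matrix.mul_diagonal, Matrix.diagonal_mul]
    ring
  have hsq : ∑ x, ∑ y, T x y * (T ^ m) y x * (a x - a y) ^ 2 = 2 * (g 0 - g 1) := by
    have : 2 * (g 0 - g 1) = g 0 + g 0 - 2 * g 1 := by ring
    rw [this]
    nth_rewrite 1 [hg0']
    rw [hg0'', hg1, Finset.mul_sum, ← Finset.sum_add_distrib, ← Finset.sum_sub_distrib]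
    refine Finset.sum_congr rfl fun x _ => ?_
    rw [Finset.mul_sum, ← Finset.sum_add_distrib, ← Finset.sum_sub_distrib]
    exact Finset.sum_congr rfl fun y _ => by ring
  have h0 := sum_prod_cycle T (fun x => a x ^ 2) m
  have hnn := sum_prod_cycle_pair T a m n hn0.ne' hn
  have hsh : ∑ s : Fin (m + 1) → X, a (s ⟨n, hn⟩) ^ 2 * ∏ i, T (s i) (s (i + 1)) =
      ∑ s : Fin (m + 1) → X, a (s 0) ^ 2 * ∏ i, T (s i) (s (i + 1)) := by
    rw [← sum_cycle_shift (fun s : Fin (m + 1) → X => a (s 0) ^ 2 * ∏ i, T (s i) (s (i + 1)))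
      ⟨n, hn⟩]
    refine Finset.sum_congr rfl fun s _ => ?_
    change _ = a (s (0 + ⟨n, hn⟩)) ^ 2 * ∏ i, T (s (i + ⟨n, hn⟩)) (s (i + 1 + ⟨n, hn⟩))
    rw [zero_add]
    congr 1
    rw [← Equiv.prod_comp (Equiv.addRight (⟨n, hn⟩ : Fin (m + 1)))]
    refine Finset.prod_congr rfl fun i _ => ?_
    simp only [Equiv.coe_addRight]
    rw [add_right_comm]
  have hL : ∑ s : Fin (m + 1) → X, (a (s 0) - a (s ⟨n, hn⟩)) ^ 2 * ∏ i, T (s i) (s (i + 1)) =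
      2 * (g 0 - g n) := by
    rw [hg0, ← h0]
    have : ∀ u v : ℝ, 2 * (u - v) = u + u - 2 * v := fun u v => by ring
    rw [this]
    nth_rewrite 1 [← hsh]
    change _ = _ + _ - 2 * cycCorr (Matrix.diagonal a) T (m + 1) n
    rw [← hnn, Finset.mul_sum, ← Finset.sum_add_distrib, ← Finset.sum_sub_distrib]
    exact Finset.sum_congr rfl fun s _ => by ring
  rw [hL, hsq]
  linarith

/-- Gradient bound for a cycle of slices coupled by a Gaussian-type kernel. -/
lemma sum_slices_sq_sub_le {Y : Type*} [Fintype Y] {D : X → ℝ} (hD : ∀ s, 0 ≤ D s) {β : ℝ}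
    (hβ : 0 < β) (x : X → Y → ℝ) (φ : Y → ℝ) (m n : ℕ) (hn : n < m + 1) (k : ZMod (m + 1)) :
    ∑ s : ZMod (m + 1) → X, (∑ y, φ y * x (s k) y - ∑ y, φ y * x (s (k + n)) y) ^ 2 *
        ∏ i, (D (s i) * Real.exp (β * ∑ y, x (s i) y * x (s (i + 1)) y)) ≤
      n * (2 * (∑ y, φ y ^ 2) / β) *
        ∑ s : ZMod (m + 1) → X,
          ∏ i, (D (s i) * Real.exp (β * ∑ y, x (s i) y * x (s (i + 1)) y)) := by
  set K : X → X → ℝ := fun s t => Real.exp (β * ∑ y, x s y * x t y)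
  set a : X → ℝ := fun s => ∑ y, φ y * x s y
  set T : Matrix X X ℝ := fun s t => √(D s) * K s t * √(D t)
  have hKs : ∀ s t, K s t = K t s := fun s t => by
    simp only [K]; simp only [mul_comm]
  have hT : T.PosSemidef := by
    refine posSemidef_iff_form.2 ⟨fun s t => ?_, fun c => ?_⟩
    · simp only [T]; rw [hKs]; ring
    · have h := form_mul_exp_sum_nonneg (M := fun _ _ => (1 : ℝ)) Finset.univ (fun c => ?_) hβ.le x
        fun s => c s * √(D s)
      · refine h.trans (le_of_eq ?_)
        refine Finset.sum_congr rfl fun s _ => Finset.sum_congr rfl fun t _ => ?_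
        simp only [T, K]; ring
      · simp only [mul_one, ← Finset.mul_sum, ← Finset.sum_mul]
        exact mul_self_nonneg _
  have hT0 : ∀ s t, 0 ≤ T s t := fun s t =>
    mul_nonneg (mul_nonneg (Real.sqrt_nonneg _) (Real.exp_pos _).le) (Real.sqrt_nonneg _)
  have hTm0 : ∀ l s t, 0 ≤ (T ^ l) s t := by
    intro l
    induction l with
    | zero =>
      intro s t
      rw [pow_zero, Matrix.one_apply]; split_ifs <;> norm_num
    | succ l ih =>
      intro s t
      rw [pow_succ, Matrix.mul_apply]
      exact Finset.sum_nonneg fun u _ => mul_nonneg (ih _ _) (hT0 _ _)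
  have hTm := posSemidef_iff_form.1 (hT.pow m)
  have hprod : ∀ s : ZMod (m + 1) → X, ∏ i, (D (s i) * K (s i) (s (i + 1))) =
      ∏ i, T (s i) (s (i + 1)) := by
    intro s
    simp only [T, Finset.prod_mul_distrib]
    have : ∏ i, √(D (s (i + 1))) = ∏ i, √(D (s i)) :=
      Equiv.prod_comp (Equiv.addRight (1 : ZMod (m + 1))) fun i => √(D (s i))
    rw [this, ← Finset.prod_mul_distrib, ← Finset.prod_mul_distrib, ← Finset.prod_mul_distrib]
    refine Finset.prod_congr rfl fun i _ => ?_
    rw [mul_right_comm, Real.mul_self_sqrt (hD _)]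
  have hbond := sum_mul_exp_sq_sub_le (M := fun s t => √(D s) * √(D t) * (T ^ m) t s) (fun c => by
      refine (hTm.2 fun s => c s * √(D s)).trans (le_of_eq ?_)
      refine Finset.sum_congr rfl fun s _ => Finset.sum_congr rfl fun t _ => ?_
      rw [hTm.1]; ring)
    (fun s t => mul_nonneg (by positivity) (hTm0 _ _ _)) hβ x φ
  have hZ : ∑ s, ∑ t, √(D s) * √(D t) * (T ^ m) t s * K s t =
      ∑ s : ZMod (m + 1) → X, ∏ i, T (s i) (s (i + 1)) := by
    have h := sum_prod_cycle T (fun _ => 1) m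
    simp only [one_mul, Matrix.diagonal_one] at h
    refine Eq.trans ?_ h.symm
    rw [pow_succ']
    simp only [Matrix.trace, Matrix.diag, Matrix.mul_apply]
    refine Finset.sum_congr rfl fun s _ => Finset.sum_congr rfl fun t _ => ?_
    simp only [T]; ring
  have hcyc := sum_cycle_sq_sub_le hT a m n hn
  have hshift : ∑ s : ZMod (m + 1) → X, (a (s k) - a (s (k + n))) ^ 2 *
        ∏ i, T (s i) (s (i + 1)) =
      ∑ s : Fin (m + 1) → X, (a (s 0) - a (s ⟨n, hn⟩)) ^ 2 * ∏ i, T (s i) (s (i + 1)) := by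
    have key : ∀ k' : Fin (m + 1), ∑ s : Fin (m + 1) → X,
        (a (s k') - a (s (k' + ⟨n, hn⟩))) ^ 2 * ∏ i, T (s i) (s (i + 1)) =
        ∑ s : Fin (m + 1) → X, (a (s 0) - a (s ⟨n, hn⟩)) ^ 2 * ∏ i, T (s i) (s (i + 1)) := by
      intro k'
      refine Eq.trans ?_ (sum_cycle_shift (fun s : Fin (m + 1) → X =>
        (a (s 0) - a (s ⟨n, hn⟩)) ^ 2 * ∏ i, T (s i) (s (i + 1))) k')
      refine Finset.sum_congr rfl fun s _ => ?_
      change _ = (a (s (0 + k')) - a (s (⟨n, hn⟩ + k'))) ^ 2 *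
        ∏ i, T (s (i + k')) (s (i + 1 + k'))
      rw [zero_add, add_comm _ k']
      congr 1
      refine (Equiv.prod_comp (Equiv.addRight k')
        (fun i : Fin (m + 1) => T (s i) (s (i + 1)))).symm.trans ?_
      refine Finset.prod_congr rfl fun i _ => ?_
      simp only [Equiv.coe_addRight]
      rw [add_right_comm]
    have hnc : ((n : ℕ) : ZMod (m + 1)) = (⟨n, hn⟩ : Fin (m + 1)) :=
      Fin.ext (Nat.mod_eq_of_lt hn)
    rw [hnc]
    exact key k
  change ∑ s : ZMod (m + 1) → X, (a (s k) - a (s (k + n))) ^ 2 *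
    ∏ i, (D (s i) * K (s i) (s (i + 1))) ≤ _ * ∑ s : ZMod (m + 1) → X,
      ∏ i, (D (s i) * K (s i) (s (i + 1)))
  simp only [hprod]
  rw [hshift, ← hZ, mul_assoc]
  refine hcyc.trans (mul_le_mul_of_nonneg_left ?_ (Nat.cast_nonneg n))
  refine le_trans (le_of_eq ?_) hbond
  refine Finset.sum_congr rfl fun s _ => Finset.sum_congr rfl fun t _ => ?_
  simp only [T, K, a]; ring

end TransferMatrix

section Torus

/-- The discrete torus of side `m + 1`. -/
abbrev Torus (d m : ℕ) := Fin d → ZMod (m + 1)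

/-- The reduction of a lattice point to the torus. -/
def toTorus {d : ℕ} (m : ℕ) (e : Fin d → ℤ) : Torus d m := fun i => (e i : ZMod (m + 1))

lemma mem_nbrs {d : ℕ} {u v : Fin d → ℤ} : v ∈ nbrs u ↔ dist1 u v = 1 := by
  simp only [nbrs, Finset.mem_filter, Fintype.mem_piFinset, Finset.mem_Icc, and_iff_right_iff_imp]
  intro h i
  have : |u i - v i| ≤ 1 := by
    rw [← h, dist1]
    exact Finset.single_le_sum (f := fun i => |u i - v i|) (fun _ _ => abs_nonneg _)
      (Finset.mem_univ i)
  rw [abs_le] at this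
  omega

lemma nbrs_zero_eq : nbrs (0 : Fin 3 → ℤ) =
    Finset.univ.image fun p : Fin 3 × Bool =>
      if p.2 then Pi.single p.1 1 else -Pi.single p.1 1 := by
  ext v
  simp only [mem_nbrs, dist1, Fin.sum_univ_three, Pi.zero_apply, zero_sub, abs_neg,
    Finset.mem_image, Finset.mem_univ, true_and, Prod.exists, Bool.exists_bool,
    Fin.exists_fin_succ, IsEmpty.exists_iff, or_false, funext_iff, Fin.forall_fin_succ]
  simp [Pi.single_apply]
  rcases abs_cases (v 0) with h | h <;> rcases abs_cases (v 1) with h' | h' <;>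
    rcases abs_cases (v 2) with h'' | h'' <;> omega

lemma signed_unit_injective : Function.Injective fun p : Fin 3 × Bool =>
    if p.2 then (Pi.single p.1 1 : Fin 3 → ℤ) else -Pi.single p.1 1 := by
  rintro ⟨i, a⟩ ⟨j, b⟩ h
  have h1 := congrFun h i
  by_cases hij : i = j
  · subst hij
    cases a <;> cases b <;> simp at h1 ⊢
  · cases a <;> cases b <;> simp [hij] at h1

lemma sum_nbrs_zero (f : (Fin 3 → ℤ) → ℝ) :
    ∑ e ∈ nbrs (0 : Fin 3 → ℤ), f e = ∑ i, (f (Pi.single i 1) + f (-Pi.single i 1)) := by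
  rw [nbrs_zero_eq, Finset.sum_image, Fintype.sum_prod_type]
  · simp
  · exact signed_unit_injective.injOn

/-- The nearest-neighbour coupling on the torus. -/
noncomputable def torusJ (m : ℕ) (β : ℝ) (u w : Torus 3 m) : ℝ :=
  β / 2 * ∑ e ∈ nbrs (0 : Fin 3 → ℤ), if w = u + toTorus m e then 1 else 0

lemma torusJ_nonneg {β : ℝ} (hβ : 0 ≤ β) (m : ℕ) (u w : Torus 3 m) : 0 ≤ torusJ m β u w :=
  mul_nonneg (by linarith) (Finset.sum_nonneg fun e _ => by split_ifs <;> norm_num)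

lemma isingW_torus (m : ℕ) (β : ℝ) (σ : Torus 3 m → Bool) : isingW (torusJ m β) 0 σ =
    Real.exp (β * ∑ i, ∑ u : Torus 3 m, spin (σ u) * spin (σ (u + Pi.single i 1))) := by
  simp only [isingW, torusJ, Pi.zero_apply, zero_mul, Finset.sum_const_zero, add_zero]
  congr 1
  have hs : ∀ i, toTorus m (Pi.single i 1 : Fin 3 → ℤ) = Pi.single i 1 := fun i => by
    ext j
    rcases eq_or_ne j i with rfl | h <;> simp [toTorus, *]
  have hn : ∀ i, toTorus m (-Pi.single i 1 : Fin 3 → ℤ) = -Pi.single i 1 := fun i => by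
    ext j
    rcases eq_or_ne j i with rfl | h <;> simp [toTorus, *]
  have h1 : ∀ u : Torus 3 m, ∑ w, (β / 2 * ∑ e ∈ nbrs (0 : Fin 3 → ℤ),
      if w = u + toTorus m e then (1 : ℝ) else 0) * (spin (σ u) * spin (σ w)) =
      β / 2 * ∑ i, (spin (σ u) * spin (σ (u + Pi.single i 1)) +
        spin (σ u) * spin (σ (u - Pi.single i 1))) := by
    intro u
    have : ∀ w, (β / 2 * ∑ e ∈ nbrs (0 : Fin 3 → ℤ),
      if w = u + toTorus m e then (1 : ℝ) else 0) * (spin (σ u) * spin (σ w)) =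
      β / 2 * ∑ e ∈ nbrs (0 : Fin 3 → ℤ),
        if w = u + toTorus m e then spin (σ u) * spin (σ w) else 0 := by
      intro w
      rw [mul_assoc, Finset.sum_mul]
      congr 1
      exact Finset.sum_congr rfl fun e _ => by split_ifs <;> simp
    simp only [this]
    rw [← Finset.mul_sum, Finset.sum_comm]
    simp only [Finset.sum_ite_eq', Finset.mem_univ, if_true]
    rw [sum_nbrs_zero]
    simp only [hs, hn, sub_eq_add_neg]
  rw [Finset.sum_congr rfl fun u _ => h1 u, ← Finset.mul_sum, Finset.sum_comm]
  have h2 : ∀ i, ∑ u : Torus 3 m, (spin (σ u) * spin (σ (u + Pi.single i 1)) +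
      spin (σ u) * spin (σ (u - Pi.single i 1))) =
      2 * ∑ u : Torus 3 m, spin (σ u) * spin (σ (u + Pi.single i 1)) := by
    intro i
    rw [Finset.sum_add_distrib, two_mul]
    congr 1
    rw [← Equiv.sum_comp (Equiv.addRight (Pi.single i 1 : Torus 3 m))]
    refine Finset.sum_congr rfl fun u _ => ?_
    simp only [Equiv.coe_addRight, add_sub_cancel_right]
    rw [mul_comm]
  simp only [h2]
  rw [← Finset.mul_sum]
  ring

/-- Slicing a configuration of the torus along direction `i`. -/
def sliceEquiv (m : ℕ) (i : Fin 3) :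
    (ZMod (m + 1) → Torus 2 m → Bool) ≃ (Torus 3 m → Bool) :=
  (Equiv.curry _ _ _).symm.trans
    (Equiv.arrowCongr (Fin.insertNthEquiv (fun _ => ZMod (m + 1)) i) (Equiv.refl Bool))

lemma sliceEquiv_apply (m : ℕ) (i : Fin 3) (s : ZMod (m + 1) → Torus 2 m → Bool)
    (k : ZMod (m + 1)) (y : Torus 2 m) :
    sliceEquiv m i s (i.insertNth k y) = s k y := by
  have : (Fin.insertNthEquiv (fun _ => ZMod (m + 1)) i).symm (i.insertNth k y) = (k, y) :=
    (Equiv.symm_apply_eq _).2 rfl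
  change Function.uncurry s
    ((Fin.insertNthEquiv (fun _ => ZMod (m + 1)) i).symm (i.insertNth k y)) = _
  rw [this]; rfl

lemma insertNth_add_single_self (m : ℕ) (i : Fin 3) (k c : ZMod (m + 1)) (y : Torus 2 m) :
    (i.insertNth k y : Torus 3 m) + Pi.single i c = i.insertNth (k + c) y := by
  refine (Fin.eq_insertNth_iff).2 ⟨by simp, ?_⟩
  ext j
  simp [Fin.removeNth]

lemma insertNth_add_single_succAbove (m : ℕ) (i : Fin 3) (j : Fin 2) (k c : ZMod (m + 1))
    (y : Torus 2 m) :
    (i.insertNth k y : Torus 3 m) + Pi.single (i.succAbove j) c =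
      i.insertNth k (y + Pi.single j c) := by
  refine (Fin.eq_insertNth_iff).2 ⟨by simp, ?_⟩
  ext l
  simp only [Fin.removeNth, Pi.add_apply, Fin.insertNth_apply_succAbove]
  congr 1
  rcases eq_or_ne l j with rfl | h
  · simp
  · rw [Pi.single_eq_of_ne h, Pi.single_eq_of_ne]
    exact fun h' => h (Fin.succAbove_right_injective h')

lemma isingW_torus_slice (m : ℕ) (β : ℝ) (i : Fin 3) (s : ZMod (m + 1) → Torus 2 m → Bool) :
    isingW (torusJ m β) 0 (sliceEquiv m i s) =
      ∏ k, (Real.exp (β * ∑ j : Fin 2, ∑ y, spin (s k y) * spin (s k (y + Pi.single j 1))) *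
        Real.exp (β * ∑ y, spin (s k y) * spin (s (k + 1) y))) := by
  rw [isingW_torus, Finset.prod_mul_distrib, ← Real.exp_sum, ← Real.exp_sum, ← Real.exp_add,
    ← Finset.mul_sum, ← Finset.mul_sum, ← mul_add, Fin.sum_univ_succAbove _ i, add_comm]
  have h : ∀ f : Torus 3 m → ℝ, ∑ u, f u = ∑ k, ∑ y, f (i.insertNth k y) := by
    intro f
    rw [← Equiv.sum_comp (Fin.insertNthEquiv (fun _ => ZMod (m + 1)) i), Fintype.sum_prod_type]
    rfl
  simp only [h, insertNth_add_single_self, insertNth_add_single_succAbove, sliceEquiv_apply]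
  rw [Finset.sum_comm]

lemma ev_torus_sq_sub_le {m : ℕ} {β : ℝ} (hβ : 0 < β) (i : Fin 3) (φ : Torus 2 m → ℝ) {n : ℕ}
    (hn : n < m + 1) (k : ZMod (m + 1)) :
    ev (torusJ m β) 0 (fun σ => (∑ y, φ y * spin (σ (i.insertNth k y)) -
      ∑ y, φ y * spin (σ (i.insertNth (k + n) y))) ^ 2) ≤ n * (2 * (∑ y, φ y ^ 2) / β) := by
  rw [ev, div_le_iff₀ (sum_isingW_pos _ _), ← Equiv.sum_comp (sliceEquiv m i),
    ← Equiv.sum_comp (sliceEquiv m i)]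
  simp only [isingW_torus_slice, sliceEquiv_apply]
  have := sum_slices_sq_sub_le (X := Torus 2 m → Bool)
    (D := fun t => Real.exp (β * ∑ j : Fin 2, ∑ y, spin (t y) * spin (t (y + Pi.single j 1))))
    (fun _ => (Real.exp_pos _).le) hβ (fun t y => spin (t y)) φ m n hn k
  refine le_trans (le_of_eq ?_) this
  exact Finset.sum_congr rfl fun s _ => mul_comm _ _

end Torus

section SquareNorm

variable {V : Type*} [Fintype V] [DecidableEq V]

/-- The embedding of observables into a Euclidean space carrying the `L²` norm of the Ising
measure. -/
noncomputable def evVec (J : V → V → ℝ) (h : V → ℝ) :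
    ((V → Bool) → ℝ) →ₗ[ℝ] EuclideanSpace ℝ (V → Bool) where
  toFun f := WithLp.toLp 2 fun σ => √(isingW J h σ / ∑ τ, isingW J h τ) * f σ
  map_add' f g := by ext σ; simp [mul_add]
  map_smul' c f := by ext σ; simp [mul_left_comm]

lemma norm_evVec_sq (J : V → V → ℝ) (h : V → ℝ) (f : (V → Bool) → ℝ) :
    ‖evVec J h f‖ ^ 2 = ev J h (fun σ => f σ ^ 2) := by
  rw [EuclideanSpace.norm_sq_eq, ev, Finset.sum_div]
  refine Finset.sum_congr rfl fun σ _ => ?_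
  have : 0 ≤ isingW J h σ / ∑ τ, isingW J h τ :=
    div_nonneg (isingW_pos _ _ _).le (sum_isingW_pos _ _).le
  simp only [evVec, LinearMap.coe_mk, AddHom.coe_mk, Real.norm_eq_abs, sq_abs, mul_pow,
    Real.sq_sqrt this]
  ring

lemma norm_average_le {E ι : Type*} [SeminormedAddCommGroup E] [NormedSpace ℝ E] [Fintype ι]
    (f : ι → E) {c δ : ℝ} (hc : 0 ≤ c) (hδ : c * Fintype.card ι ≤ 1) (h0 : 0 ≤ δ)
    (hf : ∀ k, ‖f k‖ ≤ δ) : ‖c • ∑ k, f k‖ ≤ δ := by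
  rw [norm_smul, Real.norm_of_nonneg hc]
  calc c * ‖∑ k, f k‖ ≤ c * (Fintype.card ι * δ) := by
        refine mul_le_mul_of_nonneg_left ((norm_sum_le _ _).trans ?_) hc
        refine (Finset.sum_le_sum fun k _ => hf k).trans ?_
        simp
    _ = c * Fintype.card ι * δ := by ring
    _ ≤ 1 * δ := mul_le_mul_of_nonneg_right hδ h0
    _ = δ := one_mul _

end SquareNorm

section BoxAverages

/-- The point of the torus with given offsets in a box. -/
def boxPt {d : ℕ} (m : ℕ) {n : ℕ} (a : Torus d m) (r : Fin d → Fin n) : Torus d m :=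
  a + fun i => ((r i : ℕ) : ZMod (m + 1))

lemma boxPt_injective {d m n : ℕ} (hn : n ≤ m + 1) (a : Torus d m) :
    Function.Injective (boxPt m a : (Fin d → Fin n) → Torus d m) := by
  intro r r' h
  have h' := add_left_cancel h
  ext i
  have := congrArg ZMod.val (congrFun h' i)
  rwa [ZMod.val_natCast, ZMod.val_natCast, Nat.mod_eq_of_lt ((r i).2.trans_le hn),
    Nat.mod_eq_of_lt ((r' i).2.trans_le hn)] at this

/-- The average spin in a box of side `n`. -/
noncomputable def boxAvg (m n : ℕ) (a : Torus 3 m) (σ : Torus 3 m → Bool) : ℝ :=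
  ((n : ℝ) ^ 3)⁻¹ * ∑ r : Fin 3 → Fin n, spin (σ (boxPt m a r))

lemma boxPt_insertNth {m n : ℕ} (i : Fin 3) (a : Torus 3 m) (k : Fin n) (r : Fin 2 → Fin n) :
    boxPt m a (i.insertNth k r : Fin 3 → Fin n) =
      i.insertNth (a i + ((k : ℕ) : ZMod (m + 1))) (boxPt m (i.removeNth a) r) := by
  refine Fin.eq_insertNth_iff.2 ⟨by simp [boxPt], ?_⟩
  ext j
  simp [boxPt, Fin.removeNth]

lemma norm_boxAvg_sub_single_le {m n : ℕ} {β : ℝ} (hβ : 0 < β) (hn0 : 0 < n) (hn : n < m + 1)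
    (i : Fin 3) (a : Torus 3 m) :
    ‖evVec (torusJ m β) 0 (boxAvg m n a - boxAvg m n (a + Pi.single i (n : ZMod (m + 1))))‖ ≤
      √(2 / (β * n)) := by
  have hnR : (0 : ℝ) < n := Nat.cast_pos.2 hn0
  set φ : Torus 2 m → ℝ := fun y => ((n : ℝ) ^ 2)⁻¹ *
    ∑ r : Fin 2 → Fin n, if y = boxPt m (i.removeNth a) r then 1 else 0
  have hφ : ∀ g : Torus 2 m → ℝ, ∑ y, φ y * g y =
      ((n : ℝ) ^ 2)⁻¹ * ∑ r : Fin 2 → Fin n, g (boxPt m (i.removeNth a) r) := by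
    intro g
    simp only [φ, mul_assoc, ← Finset.mul_sum, Finset.sum_mul]
    rw [Finset.sum_comm]
    simp
  have hφ2 : ∑ y, φ y ^ 2 = ((n : ℝ) ^ 2)⁻¹ := by
    simp only [sq (φ _)]
    rw [hφ]
    have : ∀ r : Fin 2 → Fin n, φ (boxPt m (i.removeNth a) r) = ((n : ℝ) ^ 2)⁻¹ := by
      intro r
      simp only [φ, (boxPt_injective hn.le (i.removeNth a)).eq_iff]
      simp
    simp only [this, Finset.sum_const, Finset.card_univ, Fintype.card_fun, Fintype.card_fin,
      nsmul_eq_mul, Nat.cast_pow]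
    rw [mul_inv_cancel₀ (by positivity), mul_one]
  set S : ZMod (m + 1) → (Torus 3 m → Bool) → ℝ := fun k σ =>
    ∑ y, φ y * spin (σ (i.insertNth k y))
  have hA : ∀ c, boxAvg m n (a + Pi.single i c) =
      (n : ℝ)⁻¹ • ∑ k : Fin n, S (a i + ((k : ℕ) : ZMod (m + 1)) + c) := by
    intro c
    ext σ
    rw [boxAvg, ← Equiv.sum_comp (Fin.insertNthEquiv (fun _ => Fin n) i), Fintype.sum_prod_type]
    simp only [Pi.smul_apply, Finset.sum_apply, S, hφ, smul_eq_mul]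
    rw [← Finset.mul_sum, ← mul_assoc]
    congr 1
    · rw [← mul_inv]; congr 1; ring
    · refine Finset.sum_congr rfl fun k _ => Finset.sum_congr rfl fun r _ => ?_
      have : i.removeNth (a + Pi.single i c) = i.removeNth a := by
        ext j; simp [Fin.removeNth]
      change spin (σ (boxPt m (a + Pi.single i c) (i.insertNth k r : Fin 3 → Fin n))) = _
      rw [boxPt_insertNth, this]
      simp [add_right_comm]
  have h0 := hA 0
  rw [Pi.single_zero, add_zero] at h0
  rw [h0, hA, ← smul_sub, ← Finset.sum_sub_distrib, map_smul, map_sum]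
  refine norm_average_le _ (by positivity) ?_ (Real.sqrt_nonneg _) fun k => ?_
  · simp [hnR.ne']
  · refine Real.le_sqrt_of_sq_le ?_
    rw [norm_evVec_sq]
    have := ev_torus_sq_sub_le hβ i φ hn (a i + ((k : ℕ) : ZMod (m + 1)))
    rw [hφ2] at this
    simp only [Pi.sub_apply, S, add_zero]
    refine this.trans (le_of_eq ?_)
    field_simp

lemma boxAvg_two_mul (m n : ℕ) (a : Torus 3 m) :
    boxAvg m (2 * n) a = (8 : ℝ)⁻¹ • ∑ ε : Fin 3 → Fin 2,
      boxAvg m n (a + fun i => ((n : ℕ) : ZMod (m + 1)) * ((ε i : ℕ) : ZMod (m + 1))) := by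
  ext σ
  rw [boxAvg, ← Equiv.sum_comp ((Equiv.arrowProdEquivProdArrow (Fin 3) (fun _ => Fin 2)
    (fun _ => Fin n)).symm.trans (Equiv.arrowCongr (Equiv.refl (Fin 3)) finProdFinEquiv)),
    Fintype.sum_prod_type]
  simp only [Pi.smul_apply, Finset.sum_apply, boxAvg, smul_eq_mul]
  rw [← Finset.mul_sum, ← mul_assoc]
  congr 1
  · rw [← mul_inv]; congr 1; push_cast; ring
  · refine Finset.sum_congr rfl fun ε _ => Finset.sum_congr rfl fun r _ => ?_
    congr 2
    ext i
    simp [boxPt, Equiv.arrowCongr, Equiv.arrowProdEquivProdArrow, finProdFinEquiv]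
    ring

lemma norm_boxAvg_le_double {m n : ℕ} {β : ℝ} (hβ : 0 < β) (hn0 : 0 < n) (hn : n < m + 1)
    (a : Torus 3 m) :
    ‖evVec (torusJ m β) 0 (boxAvg m n a)‖ ≤ 3 * √(2 / (β * n)) +
      ‖evVec (torusJ m β) 0 (boxAvg m (2 * n) a)‖ := by
  set δ := √(2 / (β * n))
  set E := evVec (torusJ m β) 0
  have hδ : 0 ≤ δ := Real.sqrt_nonneg _
  have h1 : ∀ (i : Fin 3) (e : Fin 2) (a : Torus 3 m), ‖E (boxAvg m n a) -
      E (boxAvg m n (a + Pi.single i ((n : ZMod (m + 1)) * ((e : ℕ) : ZMod (m + 1)))))‖ ≤ δ := by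
    intro i e a
    fin_cases e
    · simpa using hδ
    · have := norm_boxAvg_sub_single_le hβ hn0 hn i a
      rw [map_sub] at this
      simpa only [Fin.mk_one, Fin.val_one, Nat.cast_one, mul_one] using this
  have h3 : ∀ ε : Fin 3 → Fin 2, ‖E (boxAvg m n a) - E (boxAvg m n
      (a + fun i => ((n : ℕ) : ZMod (m + 1)) * ((ε i : ℕ) : ZMod (m + 1))))‖ ≤ 3 * δ := by
    intro ε
    set c : Fin 3 → ZMod (m + 1) := fun i => (n : ZMod (m + 1)) * ((ε i : ℕ) : ZMod (m + 1))
    have hc : a + c = a + Pi.single 0 (c 0) + Pi.single 1 (c 1) + Pi.single 2 (c 2) := by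
      ext i
      fin_cases i <;> simp
    have h := norm_sub_le_norm_sub_add_norm_sub (E (boxAvg m n a))
      (E (boxAvg m n (a + Pi.single 0 (c 0)))) (E (boxAvg m n (a + c)))
    have h' := norm_sub_le_norm_sub_add_norm_sub (E (boxAvg m n (a + Pi.single 0 (c 0))))
      (E (boxAvg m n (a + Pi.single 0 (c 0) + Pi.single 1 (c 1)))) (E (boxAvg m n (a + c)))
    have g0 := h1 0 (ε 0) a
    have g1 := h1 1 (ε 1) (a + Pi.single 0 (c 0))
    have g2 := h1 2 (ε 2) (a + Pi.single 0 (c 0) + Pi.single 1 (c 1))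
    rw [hc] at h h' ⊢
    simp only [c] at *
    linarith
  have h4 : ‖E (boxAvg m n a) - E (boxAvg m (2 * n) a)‖ ≤ 3 * δ := by
    have : E (boxAvg m n a) - E (boxAvg m (2 * n) a) = (8 : ℝ)⁻¹ • ∑ ε : Fin 3 → Fin 2,
        (E (boxAvg m n a) - E (boxAvg m n
      (a + fun i => ((n : ℕ) : ZMod (m + 1)) * ((ε i : ℕ) : ZMod (m + 1))))) := by
      rw [boxAvg_two_mul, map_smul, map_sum, Finset.sum_sub_distrib, smul_sub]
      congr 1
      simp only [Finset.sum_const, Finset.card_univ, Fintype.card_fun, Fintype.card_fin]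
      rw [← Nat.cast_smul_eq_nsmul ℝ, smul_smul]
      norm_num
    rw [this]
    refine norm_average_le _ (by norm_num) ?_ (by positivity) h3
    simp only [Fintype.card_fun, Fintype.card_fin]
    norm_num
  have := norm_le_insert' (E (boxAvg m n a)) (E (boxAvg m (2 * n) a))
  linarith

lemma norm_boxAvg_le {m : ℕ} {β : ℝ} (hβ : 0 < β) (a : Torus 3 m) (j : ℕ) :
    ∀ n : ℕ, 0 < n → n * 2 ^ j ≤ m + 1 →
    ‖evVec (torusJ m β) 0 (boxAvg m n a)‖ ≤ 12 * √(2 / (β * n)) +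
      ‖evVec (torusJ m β) 0 (boxAvg m (n * 2 ^ j) a)‖ := by
  induction j with
  | zero =>
    intro n _ _
    have := Real.sqrt_nonneg (2 / (β * n))
    simp only [pow_zero, mul_one]
    linarith
  | succ j ih =>
    intro n hn0 hn
    have hn' : 2 * n * 2 ^ j ≤ m + 1 := by rw [pow_succ] at hn; linarith
    have h1 := ih (2 * n) (by omega) hn'
    have hlt : n < m + 1 := by
      have : 0 < 2 ^ j := by positivity
      nlinarith
    have h2 := norm_boxAvg_le_double hβ hn0 hlt a
    have h3 : 4 * √(2 / (β * (2 * n : ℕ))) ≤ 3 * √(2 / (β * n)) := by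
      have hnR : (0 : ℝ) < n := Nat.cast_pos.2 hn0
      have e1 : √(2 / (β * (2 * n : ℕ))) ^ 2 = 1 / (β * n) := by
        rw [Real.sq_sqrt (by positivity)]; push_cast; field_simp
      have e2 : √(2 / (β * n)) ^ 2 = 2 * (1 / (β * n)) := by
        rw [Real.sq_sqrt (by positivity)]; field_simp
      have hp : 0 ≤ 1 / (β * n) := by positivity
      refine (pow_le_pow_iff_left₀ (by positivity) (by positivity) two_ne_zero).1 ?_
      rw [mul_pow, mul_pow, e1, e2]
      linarith
    have h4 : n * 2 ^ (j + 1) = 2 * n * 2 ^ j := by rw [pow_succ]; ring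
    rw [h4]
    linarith

end BoxAverages

section Freezing

variable {V W : Type*} [Fintype V] [DecidableEq V] [Fintype W] [DecidableEq W]

lemma sum_eq_sum_range_add {ι : V → W} (hι : Function.Injective ι) (f : W → ℝ) :
    ∑ w, f w = ∑ v, f (ι v) + ∑ w, if w ∈ Set.range ι then 0 else f w := by
  rw [← Finset.sum_image (f := f) (s := Finset.univ) (fun u _ v _ h => hι h)]
  have : ∑ w ∈ Finset.univ.image ι, f w = ∑ w, if w ∈ Set.range ι then f w else 0 := by
    rw [← Finset.sum_filter]
    refine Finset.sum_congr ?_ fun _ _ => rfl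
    ext w; simp
  rw [this, ← Finset.sum_add_distrib]
  exact Finset.sum_congr rfl fun w _ => by split_ifs <;> simp

lemma extendPlus_of_notMem {ι : V → W} (σ : V → Bool) {w : W} (hw : w ∉ Set.range ι) :
    extendPlus ι σ w = true := by
  rw [extendPlus, dif_neg]; exact hw

lemma isingW_extendPlus {ι : V → W} (hι : Function.Injective ι) {J : V → V → ℝ} {h : V → ℝ}
    {J' : W → W → ℝ} {h' : W → ℝ} (hJ : ∀ u v, J u v = J' (ι u) (ι v))
    (hh : ∀ u, h u = h' (ι u) + ∑ w, if w ∈ Set.range ι then 0 else J' (ι u) w + J' w (ι u)) :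
    ∃ c : ℝ, 0 ≤ c ∧ ∀ σ, isingW J h σ = c * isingW J' h' (extendPlus ι σ) := by
  refine ⟨Real.exp (-(∑ w, (if w ∈ Set.range ι then 0 else
      ∑ w', if w' ∈ Set.range ι then 0 else J' w w') + ∑ w, if w ∈ Set.range ι then 0 else h' w)),
    (Real.exp_pos _).le, fun σ => ?_⟩
  rw [isingW, isingW, ← Real.exp_add]
  congr 1
  set s : W → ℝ := fun w => spin (extendPlus ι σ w)
  have hs : ∀ v, s (ι v) = spin (σ v) := fun v => by simp only [s, extendPlus_apply hι]
  have hs' : ∀ w, w ∉ Set.range ι → s w = 1 := fun w hw => by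
    simp only [s, extendPlus_of_notMem σ hw, spin_true]
  have e1 : ∑ w, h' w * s w = ∑ v, h' (ι v) * spin (σ v) +
      ∑ w, if w ∈ Set.range ι then 0 else h' w := by
    rw [sum_eq_sum_range_add hι]
    congr 1
    · simp only [hs]
    · refine Finset.sum_congr rfl fun w _ => ?_
      split_ifs with hw
      · rfl
      · rw [hs' w hw, mul_one]
  have e2 : ∑ w, ∑ w', J' w w' * (s w * s w') =
      ∑ u, ∑ v, J u v * (spin (σ u) * spin (σ v)) +
      ∑ u, (∑ w, if w ∈ Set.range ι then 0 else J' (ι u) w) * spin (σ u) +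
      ∑ u, (∑ w, if w ∈ Set.range ι then 0 else J' w (ι u)) * spin (σ u) +
      ∑ w, (if w ∈ Set.range ι then 0 else
      ∑ w', if w' ∈ Set.range ι then 0 else J' w w') := by
    rw [sum_eq_sum_range_add hι]
    have a1 : ∀ u, ∑ w', J' (ι u) w' * (s (ι u) * s w') =
        ∑ v, J u v * (spin (σ u) * spin (σ v)) +
        (∑ w, if w ∈ Set.range ι then 0 else J' (ι u) w) * spin (σ u) := by
      intro u
      rw [sum_eq_sum_range_add hι, Finset.sum_mul]
      congr 1
      · simp only [hs, hJ]
      · refine Finset.sum_congr rfl fun w _ => ?_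
        split_ifs with hw
        · simp
        · rw [hs, hs' w hw, mul_one]
    have a2 : ∀ w, (if w ∈ Set.range ι then 0 else ∑ w', J' w w' * (s w * s w')) =
        ∑ u, (if w ∈ Set.range ι then 0 else J' w (ι u)) * spin (σ u) +
        (if w ∈ Set.range ι then 0 else ∑ w', if w' ∈ Set.range ι then 0 else J' w w') := by
      intro w
      split_ifs with hw
      · simp
      · rw [sum_eq_sum_range_add hι]
        congr 1
        · simp only [hs, hs' w hw, one_mul]
        · refine Finset.sum_congr rfl fun w' _ => ?_
          split_ifs with hw'
          · rfl
          · rw [hs' w hw, hs' w' hw', mul_one, mul_one]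
    simp only [a1, a2, Finset.sum_add_distrib]
    rw [Finset.sum_comm (f := fun w u => (if w ∈ Set.range ι then 0 else J' w (ι u)) * spin (σ u))]
    simp only [← Finset.sum_mul]
    ring
  change _ = -_ + (∑ w, ∑ w', J' w w' * (s w * s w') + ∑ w, h' w * s w)
  rw [e1, e2]
  have e3 : ∑ u, h u * spin (σ u) = ∑ v, h' (ι v) * spin (σ v) +
      ∑ u, (∑ w, if w ∈ Set.range ι then 0 else J' (ι u) w) * spin (σ u) +
      ∑ u, (∑ w, if w ∈ Set.range ι then 0 else J' w (ι u)) * spin (σ u) := by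
    rw [← Finset.sum_add_distrib, ← Finset.sum_add_distrib]
    refine Finset.sum_congr rfl fun u _ => ?_
    rw [hh, ← add_mul, ← add_mul]
    congr 1
    rw [add_assoc, ← Finset.sum_add_distrib]
    congr 1
    exact Finset.sum_congr rfl fun w _ => by split_ifs <;> simp
  rw [e3]
  ring

end Freezing

section Cubes

/-- The sites of the box `Λ_N`. -/
abbrev CubeSite (N : ℕ) := {x // x ∈ cube 3 N}

/-- The nearest-neighbour coupling in a box. -/
noncomputable def cubeJ (β : ℝ) (N : ℕ) (u v : CubeSite N) : ℝ :=
  if dist1 (u : Fin 3 → ℤ) v = 1 then β / 2 else 0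

/-- The boundary field of the plus boundary condition. -/
noncomputable def cubeH (β : ℝ) (N : ℕ) (u : CubeSite N) : ℝ := β * bCount 3 N u

/-- The centre of a box. -/
def centre (N : ℕ) : CubeSite N := ⟨fun _ => 0, origin_mem_cube 3 N⟩

lemma plusWeight_eq_isingW (N : ℕ) (β : ℝ) (σ : CubeSite N → Bool) :
    plusWeight 3 N β σ = isingW (cubeJ β N) (cubeH β N) σ := by
  rw [plusWeight, isingW, mul_add, ← mul_assoc, Finset.mul_sum, Finset.mul_sum,
    Finset.univ_eq_attach]
  congr 2
  · refine Finset.sum_congr rfl fun u _ => ?_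
    rw [Finset.mul_sum]
    refine Finset.sum_congr rfl fun v _ => ?_
    rw [cubeJ]
    split_ifs
    · ring
    · simp
  · exact Finset.sum_congr rfl fun u _ => by rw [cubeH]; ring

lemma mag_eq_ev (N : ℕ) (β : ℝ) :
    mag 3 N β = ev (cubeJ β N) (cubeH β N) (fun σ => spin (σ (centre N))) := by
  simp only [mag, plusWeight_eq_isingW, ev]
  rfl

lemma cubeJ_nonneg {β : ℝ} (hβ : 0 ≤ β) (N : ℕ) (u v : CubeSite N) : 0 ≤ cubeJ β N u v := by
  rw [cubeJ]; split_ifs <;> linarith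

lemma cubeH_nonneg {β : ℝ} (hβ : 0 ≤ β) (N : ℕ) (u : CubeSite N) : 0 ≤ cubeH β N u :=
  mul_nonneg hβ (Nat.cast_nonneg _)

lemma mem_cube {N : ℕ} {u : Fin 3 → ℤ} : u ∈ cube 3 N ↔ ∀ i, -(N : ℤ) ≤ u i ∧ u i ≤ N := by
  simp [cube]

lemma dist1_comm {d : ℕ} (u v : Fin d → ℤ) : dist1 u v = dist1 v u := by
  simp only [dist1, abs_sub_comm]

lemma add_mem_nbrs_iff {u e : Fin 3 → ℤ} : u + e ∈ nbrs u ↔ e ∈ nbrs 0 := by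
  rw [mem_nbrs, mem_nbrs]; simp [dist1]

lemma abs_le_one_of_mem_nbrs {e : Fin 3 → ℤ} (he : e ∈ nbrs 0) (i : Fin 3) :
    -1 ≤ e i ∧ e i ≤ 1 := by
  have := (Finset.mem_filter.1 he).1
  simpa using Fintype.mem_piFinset.1 this i

lemma sum_nbrs (u : Fin 3 → ℤ) (g : (Fin 3 → ℤ) → ℝ) :
    ∑ v ∈ nbrs u, g v = ∑ e ∈ nbrs 0, g (u + e) := by
  refine (Finset.sum_bij (fun e _ => u + e) (fun e he => add_mem_nbrs_iff.2 he)
    (fun e _ e' _ h => add_left_cancel h) (fun v hv => ⟨v - u, ?_, by simp⟩)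
    (fun e _ => rfl)).symm
  rw [← add_mem_nbrs_iff (u := u)]; simpa using hv

lemma bCount_eq_sum (N : ℕ) (u : Fin 3 → ℤ) :
    (bCount 3 N u : ℝ) = ∑ e ∈ nbrs 0, if u + e ∈ cube 3 N then 0 else 1 := by
  rw [← sum_nbrs u fun v => if v ∈ cube 3 N then (0 : ℝ) else 1, bCount,
    ← Finset.filter_notMem_eq_sdiff, Finset.card_filter]
  push_cast
  exact Finset.sum_congr rfl fun v _ => by split_ifs <;> simp_all

lemma sum_cubeSite_dist1 (M : ℕ) (u : Fin 3 → ℤ) (g : (Fin 3 → ℤ) → ℝ) :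
    (∑ w : CubeSite M, if dist1 u w = 1 then g w else 0) =
      ∑ e ∈ nbrs 0, if u + e ∈ cube 3 M then g (u + e) else 0 := by
  rw [← sum_nbrs u fun v => if v ∈ cube 3 M then g v else 0,
    Finset.sum_coe_sort (cube 3 M) fun w => if dist1 u w = 1 then g w else (0 : ℝ),
    ← Finset.sum_filter, ← Finset.sum_filter]
  refine Finset.sum_congr ?_ fun _ _ => rfl
  ext v
  simp only [Finset.mem_filter, mem_nbrs, and_comm]

/-- Magnetisation at any site of a box dominates the magnetisation of larger boxes. -/
lemma mag_le_ev {β : ℝ} (hβ : 0 ≤ β) {N M : ℕ} (hM : 2 * N ≤ M) (x : CubeSite N) :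
    mag 3 M β ≤ ev (cubeJ β N) (cubeH β N) (fun σ => spin (σ x)) := by
  have hx := mem_cube.1 x.2
  have hsub : ∀ u : Fin 3 → ℤ, u ∈ cube 3 N → u - x ∈ cube 3 M := fun u hu => mem_cube.2 fun i => by
    have := mem_cube.1 hu i
    have := hx i
    simp only [Pi.sub_apply]
    omega
  set ι : CubeSite N → CubeSite M := fun u => ⟨u - x, hsub u u.2⟩
  have hι : Function.Injective ι := fun u v h =>
    Subtype.ext (sub_left_injective (Subtype.ext_iff.1 h))
  have hr : ∀ w : CubeSite M, w ∈ Set.range ι ↔ (w : Fin 3 → ℤ) + x ∈ cube 3 N := fun w =>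
    ⟨fun ⟨u, hu⟩ => by rw [← hu]; simp [ι], fun h => ⟨⟨_, h⟩, Subtype.ext (by simp [ι])⟩⟩
  obtain ⟨c, hc, hW⟩ := isingW_extendPlus (J := cubeJ β N) (h := cubeH β N) (J' := cubeJ β M)
    (h' := cubeH β M) hι (fun u v => if_congr (by simp [dist1, ι]) rfl rfl) fun u => by
      have e1 : ∀ w : CubeSite M, (if w ∈ Set.range ι then (0 : ℝ) else
          cubeJ β M (ι u) w + cubeJ β M w (ι u)) =
          β * if dist1 (ι u : Fin 3 → ℤ) w = 1 then
            (if (w : Fin 3 → ℤ) + x ∈ cube 3 N then 0 else 1) else 0 := by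
        intro w
        simp only [hr, cubeJ, dist1_comm (w : Fin 3 → ℤ)]
        split_ifs <;> ring
      simp only [e1]
      rw [← Finset.mul_sum, sum_cubeSite_dist1 M (ι u)
        fun w => if w + x ∈ cube 3 N then (0 : ℝ) else 1, cubeH, cubeH, bCount_eq_sum,
        bCount_eq_sum, ← mul_add, ← Finset.sum_add_distrib]
      congr 1
      refine Finset.sum_congr rfl fun e _ => ?_
      have h1 : (ι u : Fin 3 → ℤ) + e + x = u + e := by simp only [ι]; abel
      have h2 : (u : Fin 3 → ℤ) + e ∈ cube 3 N → (ι u : Fin 3 → ℤ) + e ∈ cube 3 M := fun h => by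
        have := hsub _ h
        rwa [← h1, add_sub_cancel_right] at this
      rw [h1]
      by_cases h : (u : Fin 3 → ℤ) + e ∈ cube 3 N
      · simp [h, h2 h]
      · by_cases h' : (ι u : Fin 3 → ℤ) + e ∈ cube 3 M <;> simp [h, h']
  rw [mag_eq_ev]
  have hz : ι x = centre M := Subtype.ext (by simp [ι, centre]; rfl)
  have := ev_le_frozen ι (cubeJ_nonneg hβ M) (cubeH_nonneg hβ M) hc hW
    (fun σ => spin (σ (centre M))) (fun ρ τ => spin_cmul ρ τ _) (fun ρ => spin_le_one _)
    (extendPlus_mem_posCone ι _)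
  simpa only [← hz, extendPlus_apply hι] using this

section TorusEmbedding

variable {m N : ℕ}

/-- The translate of a box inside the torus. -/
def cubeToTorus (m N : ℕ) (x : Torus 3 m) (u : CubeSite N) : Torus 3 m := x + toTorus m u

lemma toTorus_add (m : ℕ) (u v : Fin 3 → ℤ) : toTorus m (u + v) = toTorus m u + toTorus m v := by
  ext i; simp [toTorus]

lemma toTorus_inj_of_abs_lt {u v : Fin 3 → ℤ} (h : ∀ i, |u i - v i| < m + 1)
    (he : toTorus m u = toTorus m v) : u = v := by
  ext i
  have h1 := congrFun he i
  simp only [toTorus] at h1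
  have h2 := (ZMod.intCast_eq_intCast_iff_dvd_sub _ _ _).1 h1
  have h3 := Int.eq_zero_of_abs_lt_dvd h2 (by rw [abs_sub_comm]; exact_mod_cast h i)
  omega

lemma toTorus_add_nbr_eq_iff (hN : 2 * N + 1 ≤ m) {u v e : Fin 3 → ℤ} (hu : u ∈ cube 3 N)
    (hv : v ∈ cube 3 N) (he : e ∈ nbrs 0) :
    toTorus m v = toTorus m u + toTorus m e ↔ v = u + e := by
  rw [← toTorus_add]
  refine ⟨toTorus_inj_of_abs_lt fun i => ?_, fun h => h ▸ rfl⟩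
  have h1 := mem_cube.1 hu i
  have h2 := mem_cube.1 hv i
  have h3 := abs_le_one_of_mem_nbrs he i
  rw [abs_lt]
  simp only [Pi.add_apply]
  constructor <;> omega

lemma cubeToTorus_injective (hN : 2 * N + 1 ≤ m) (x : Torus 3 m) :
    Function.Injective (cubeToTorus m N x) := by
  intro u v h
  refine Subtype.ext (toTorus_inj_of_abs_lt (m := m) (fun i => ?_) (add_left_cancel h))
  have h1 := mem_cube.1 u.2 i
  have h2 := mem_cube.1 v.2 i
  rw [abs_lt]
  constructor <;> omega

lemma cubeJ_eq_torusJ (hN : 2 * N + 1 ≤ m) (β : ℝ) (x : Torus 3 m) (u v : CubeSite N) :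
    cubeJ β N u v = torusJ m β (cubeToTorus m N x u) (cubeToTorus m N x v) := by
  have : (if dist1 (u : Fin 3 → ℤ) v = 1 then (1 : ℝ) else 0) =
      ∑ e ∈ nbrs 0, if (v : Fin 3 → ℤ) = (u : Fin 3 → ℤ) + e then 1 else 0 := by
    rw [← sum_nbrs u fun w => if (v : Fin 3 → ℤ) = w then (1 : ℝ) else 0, Finset.sum_ite_eq]
    simp only [mem_nbrs]
  rw [torusJ]
  have h2 : ∑ e ∈ nbrs (0 : Fin 3 → ℤ), (if cubeToTorus m N x v = cubeToTorus m N x u + toTorus m e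
      then (1 : ℝ) else 0) =
      ∑ e ∈ nbrs 0, if (v : Fin 3 → ℤ) = (u : Fin 3 → ℤ) + e then 1 else 0 := by
    refine Finset.sum_congr rfl fun e he => ?_
    simp only [cubeToTorus, add_assoc, add_right_inj, toTorus_add_nbr_eq_iff hN u.2 v.2 he]
  rw [h2, ← this, cubeJ]
  split_ifs <;> simp

lemma torusJ_symm (β : ℝ) (u w : Torus 3 m) : torusJ m β u w = torusJ m β w u := by
  rw [torusJ, torusJ]
  congr 1
  refine Finset.sum_bij' (fun e _ => -e) (fun e _ => -e) ?_ ?_ ?_ ?_ ?_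
  · intro e he; rw [mem_nbrs] at he ⊢; simpa [dist1] using he
  · intro e he; rw [mem_nbrs] at he ⊢; simpa [dist1] using he
  · simp
  · simp
  · intro e _
    have : toTorus m (-e) = -toTorus m e := by ext i; simp [toTorus]
    rw [this, ← sub_eq_add_neg]
    exact if_congr (by rw [eq_sub_iff_add_eq, eq_comm]) rfl rfl

lemma cubeToTorus_center (x : Torus 3 m) : cubeToTorus m N x (centre N) = x := by
  ext i; simp [cubeToTorus, centre, toTorus]

lemma cubeToTorus_add_nbr_mem_range_iff (hN : 2 * N + 1 ≤ m) (x : Torus 3 m) (u : CubeSite N)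
    {e : Fin 3 → ℤ} (he : e ∈ nbrs 0) :
    cubeToTorus m N x u + toTorus m e ∈ Set.range (cubeToTorus m N x) ↔
      (u : Fin 3 → ℤ) + e ∈ cube 3 N := by
  constructor
  · rintro ⟨v, hv⟩
    simp only [cubeToTorus, add_assoc, add_right_inj] at hv
    rw [← (toTorus_add_nbr_eq_iff hN u.2 v.2 he).1 hv]
    exact v.2
  · intro h
    refine ⟨⟨_, h⟩, ?_⟩
    simp only [cubeToTorus, add_assoc, toTorus_add]

lemma cubeH_eq_sum_torusJ (hN : 2 * N + 1 ≤ m) (β : ℝ) (x : Torus 3 m) (u : CubeSite N) :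
    cubeH β N u = ∑ w, if w ∈ Set.range (cubeToTorus m N x) then (0 : ℝ) else
      torusJ m β (cubeToTorus m N x u) w + torusJ m β w (cubeToTorus m N x u) := by
  have e1 : ∀ w, (if w ∈ Set.range (cubeToTorus m N x) then (0 : ℝ) else
      torusJ m β (cubeToTorus m N x u) w + torusJ m β w (cubeToTorus m N x u)) =
      β * ∑ e ∈ nbrs 0, if w = cubeToTorus m N x u + toTorus m e then
        (if w ∈ Set.range (cubeToTorus m N x) then 0 else 1) else 0 := by
    intro w
    rw [torusJ_symm β w]
    by_cases h : w ∈ Set.range (cubeToTorus m N x)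
    · simp only [if_pos h, ite_self, Finset.sum_const_zero, mul_zero]
    · simp only [if_neg h]
      rw [torusJ]; ring
  rw [Finset.sum_congr rfl fun w _ => e1 w, ← Finset.mul_sum, Finset.sum_comm, cubeH, bCount_eq_sum]
  congr 1
  refine Finset.sum_congr rfl fun e he => ?_
  rw [Finset.sum_ite_eq', if_pos (Finset.mem_univ _)]
  exact if_congr (cubeToTorus_add_nbr_mem_range_iff hN x u he).symm rfl rfl

lemma ev_torus_pair_le_mag {β : ℝ} (hβ : 0 ≤ β) (hN : 2 * N + 1 ≤ m) (x y : Torus 3 m)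
    (hy : y ∉ Set.range (cubeToTorus m N x)) :
    ev (torusJ m β) 0 (pair x y) ≤ mag 3 N β := by
  have hι := cubeToTorus_injective hN x
  obtain ⟨c, hc, hW⟩ := isingW_extendPlus (J := cubeJ β N) (h := cubeH β N) (J' := torusJ m β)
    (h' := 0) hι (cubeJ_eq_torusJ hN β x) fun u => by
      rw [cubeH_eq_sum_torusJ hN β x u, Pi.zero_apply, zero_add]
  have he : (fun σ => pair x y (extendPlus (cubeToTorus m N x) σ)) =
      fun σ : CubeSite N → Bool => spin (σ (centre N)) := by
    ext σ
    have : extendPlus (cubeToTorus m N x) σ x = σ (centre N) := by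
      have h := extendPlus_apply hι σ (centre N)
      rwa [cubeToTorus_center] at h
    rw [pair, extendPlus_of_notMem σ hy, this, spin_true, mul_one]
  have := ev_le_frozen (cubeToTorus m N x) (torusJ_nonneg hβ m) (h' := 0) (fun _ => le_rfl) hc hW
    (pair x y) (pair_cmul x y) (pair_le_one x y) (by rw [he]; exact spin_mem_posCone _)
  rw [he] at this
  rwa [mag_eq_ev]

lemma ev_cube_pair_le_torus {β : ℝ} (hβ : 0 ≤ β) (hN : 2 * N + 1 ≤ m) (a : Torus 3 m)
    (x y : CubeSite N) : ev (cubeJ β N) 0 (pair x y) ≤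
      ev (torusJ m β) 0 (pair (cubeToTorus m N a x) (cubeToTorus m N a y)) :=
  ev_pair_restrict _ (cubeToTorus_injective hN a) (torusJ_nonneg hβ m) (cubeJ_nonneg hβ N)
    (fun u v => (cubeJ_eq_torusJ hN β a u v).le) (fun _ => le_rfl) x y

end TorusEmbedding

end Cubes

section Infrared

variable {V : Type*} [Fintype V] [DecidableEq V]

lemma ev_finset_sum {ι : Type*} (s : Finset ι) (J : V → V → ℝ) (h : V → ℝ)
    (f : ι → (V → Bool) → ℝ) : ev J h (fun σ => ∑ i ∈ s, f i σ) = ∑ i ∈ s, ev J h (f i) := by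
  simp only [ev, Finset.mul_sum, ← Finset.sum_div]
  rw [Finset.sum_comm]

lemma ev_const_mul (J : V → V → ℝ) (h : V → ℝ) (c : ℝ) (f : (V → Bool) → ℝ) :
    ev J h (fun σ => c * f σ) = c * ev J h f := by
  simp only [ev, ← mul_div_assoc, Finset.mul_sum, mul_left_comm]

lemma norm_boxAvg_sq {m n : ℕ} (β : ℝ) (a : Torus 3 m) :
    ‖evVec (torusJ m β) 0 (boxAvg m n a)‖ ^ 2 = ((n : ℝ) ^ 6)⁻¹ * ∑ r : Fin 3 → Fin n,
      ∑ r' : Fin 3 → Fin n, ev (torusJ m β) 0 (pair (boxPt m a r) (boxPt m a r')) := by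
  rw [norm_evVec_sq]
  simp only [← ev_finset_sum, ← ev_const_mul]
  congr 1
  ext σ
  simp only [boxAvg, mul_pow, sq (∑ r, _), pair, Finset.sum_mul_sum]
  congr 1
  rw [← inv_pow, ← inv_pow, ← pow_mul]

lemma mag_nonneg {β : ℝ} (hβ : 0 ≤ β) (N : ℕ) : 0 ≤ mag 3 N β := by
  rw [mag_eq_ev]
  exact ev_nonneg (cubeJ_nonneg hβ N) (cubeH_nonneg hβ N) (spin_mem_posCone _)

lemma card_cubeSite (N : ℕ) : Fintype.card (CubeSite N) = (2 * N + 1) ^ 3 := by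
  rw [Fintype.card_coe, cube, Fintype.card_piFinset]
  simp
  omega

lemma norm_boxAvg_sq_le {m n N : ℕ} {β : ℝ} (hβ : 0 ≤ β) (hN : 2 * N + 1 ≤ m) (hn0 : 0 < n)
    (hn : n ≤ m + 1) (a : Torus 3 m) :
    ‖evVec (torusJ m β) 0 (boxAvg m n a)‖ ^ 2 ≤ mag 3 N β + (2 * N + 1) ^ 3 / (n : ℝ) ^ 3 := by
  have hnR : (0 : ℝ) < n := Nat.cast_pos.2 hn0
  rw [norm_boxAvg_sq]
  have h1 : ∀ r : Fin 3 → Fin n, ∑ r' : Fin 3 → Fin n,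
      ev (torusJ m β) 0 (pair (boxPt m a r) (boxPt m a r')) ≤
      (n : ℝ) ^ 3 * mag 3 N β + (2 * N + 1) ^ 3 := by
    intro r
    have h2 : ∀ r' : Fin 3 → Fin n, ev (torusJ m β) 0 (pair (boxPt m a r) (boxPt m a r')) ≤
        mag 3 N β +
          if boxPt m a r' ∈ Set.range (cubeToTorus m N (boxPt m a r)) then 1 else 0 := by
      intro r'
      split_ifs with h
      · have := mag_nonneg hβ N
        have := ev_mono_const (J := torusJ m β) (h := 0) (pair_le_one (boxPt m a r) (boxPt m a r'))
        linarith
      · rw [add_zero]; exact ev_torus_pair_le_mag hβ hN _ _ h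
    refine (Finset.sum_le_sum fun r' _ => h2 r').trans ?_
    rw [Finset.sum_add_distrib]
    refine add_le_add (by simp) ?_
    rw [← Finset.sum_filter, Finset.sum_const, nsmul_one]
    have : (Finset.univ.filter fun r' : Fin 3 → Fin n => boxPt m a r' ∈
        Set.range (cubeToTorus m N (boxPt m a r))).card ≤ Fintype.card (CubeSite N) := by
      rw [← Finset.card_univ, ← Finset.card_image_of_injective _ (boxPt_injective hn a)]
      refine (Finset.card_le_card ?_).trans
        (Finset.card_image_le (f := cubeToTorus m N (boxPt m a r)))
      intro y hy
      obtain ⟨r', h, rfl⟩ := Finset.mem_image.1 hy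
      obtain ⟨u, hu⟩ := (Finset.mem_filter.1 h).2
      exact Finset.mem_image.2 ⟨u, Finset.mem_univ _, hu⟩
    rw [card_cubeSite] at this
    exact_mod_cast this
  have h3 := Finset.sum_le_sum fun r (_ : r ∈ (Finset.univ : Finset (Fin 3 → Fin n))) => h1 r
  refine (mul_le_mul_of_nonneg_left h3 (by positivity)).trans (le_of_eq ?_)
  simp only [Finset.sum_const, Finset.card_univ, Fintype.card_fun, Fintype.card_fin, nsmul_eq_mul,
    Nat.cast_pow]
  field_simp

lemma sum_pair_box_le_of_mag_small {β : ℝ} (hβ : 0 < β) (h0 : ∀ δ > 0, ∃ r, mag 3 r β < δ)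
    {n N : ℕ} (hn : 0 < n) (B : (Fin 3 → Fin n) → CubeSite N) (b : Fin 3 → ℤ)
    (hB : ∀ r i, (B r : Fin 3 → ℤ) i = b i + (r i : ℕ)) :
    ∑ r, ∑ r', ev (cubeJ β N) 0 (pair (B r) (B r')) ≤ (n : ℝ) ^ 6 * (288 / (β * n)) := by
  have hnR : (0 : ℝ) < n := Nat.cast_pos.2 hn
  set S := ∑ r, ∑ r', ev (cubeJ β N) 0 (pair (B r) (B r'))
  have key : ∀ η : ℝ, 0 < η → √(((n : ℝ) ^ 6)⁻¹ * S) ≤ 12 * √(2 / (β * n)) + η := by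
    intro η hη
    obtain ⟨R, hR⟩ := h0 (η ^ 2 / 2) (by positivity)
    obtain ⟨j, hj⟩ := pow_unbounded_of_one_lt ((2 * R + 1) ^ 3 / (η ^ 2 / 2) + 2 * N + 2 * R + 2)
      (one_lt_two (α := ℝ))
    have hq : 0 ≤ (2 * (R : ℝ) + 1) ^ 3 / (η ^ 2 / 2) := by positivity
    have hpos : 1 ≤ n * 2 ^ j := Nat.mul_pos hn (by positivity)
    obtain ⟨m, hm⟩ : ∃ m, n * 2 ^ j = m + 1 := ⟨n * 2 ^ j - 1, by omega⟩
    have hTle : (2 : ℝ) ^ j ≤ (m + 1 : ℝ) := by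
      have : 2 ^ j ≤ m + 1 := by rw [← hm]; exact Nat.le_mul_of_pos_left _ hn
      exact_mod_cast this
    have hNm : 2 * N + 1 ≤ m := by
      have : (2 * N + 2 : ℝ) ≤ m + 1 := by
        have : (0 : ℝ) ≤ R := Nat.cast_nonneg R
        linarith
      have : 2 * N + 2 ≤ m + 1 := by exact_mod_cast this
      omega
    have hRm : 2 * R + 1 ≤ m := by
      have : (2 * R + 2 : ℝ) ≤ m + 1 := by
        have : (0 : ℝ) ≤ N := Nat.cast_nonneg N
        linarith
      have : 2 * R + 2 ≤ m + 1 := by exact_mod_cast this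
      omega
    have htop := norm_boxAvg_sq_le hβ.le hRm (by omega : 0 < m + 1) le_rfl (toTorus m b)
    have hsmall : (2 * (R : ℝ) + 1) ^ 3 / ((m + 1 : ℕ) : ℝ) ^ 3 ≤ η ^ 2 / 2 := by
      rw [div_le_iff₀ (by positivity)]
      rw [← div_le_iff₀' (by positivity)]
      have h1 : (1 : ℝ) ≤ (m + 1 : ℕ) := by push_cast; linarith [(Nat.cast_nonneg m : (0 : ℝ) ≤ m)]
      have h2 : ((m + 1 : ℕ) : ℝ) ≤ ((m + 1 : ℕ) : ℝ) ^ 3 := le_self_pow₀ h1 (by norm_num)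
      have h3 : (0 : ℝ) ≤ R := Nat.cast_nonneg R
      have h4 : (0 : ℝ) ≤ N := Nat.cast_nonneg N
      refine le_trans ?_ h2
      push_cast
      linarith
    have htop' : ‖evVec (torusJ m β) 0 (boxAvg m (n * 2 ^ j) (toTorus m b))‖ ≤ η := by
      rw [hm]
      refine (pow_le_pow_iff_left₀ (norm_nonneg _) hη.le two_ne_zero).1 (htop.trans ?_)
      linarith
    have hchain := norm_boxAvg_le hβ (toTorus m b) j n hn hm.le
    have hSle : ((n : ℝ) ^ 6)⁻¹ * S ≤ ‖evVec (torusJ m β) 0 (boxAvg m n (toTorus m b))‖ ^ 2 := by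
      rw [norm_boxAvg_sq]
      refine mul_le_mul_of_nonneg_left ?_ (by positivity)
      refine Finset.sum_le_sum fun r _ => Finset.sum_le_sum fun r' _ => ?_
      have hpt : ∀ r, boxPt m (toTorus m b) r = cubeToTorus m N 0 (B r) := by
        intro r
        ext i
        simp [boxPt, cubeToTorus, toTorus, hB]
      rw [hpt, hpt]
      exact ev_cube_pair_le_torus hβ.le hNm 0 _ _
    calc √(((n : ℝ) ^ 6)⁻¹ * S) ≤ ‖evVec (torusJ m β) 0 (boxAvg m n (toTorus m b))‖ :=
          Real.sqrt_le_iff.2 ⟨norm_nonneg _, hSle⟩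
      _ ≤ _ := by linarith
  have h1 := le_of_forall_pos_le_add key
  have h2 := (Real.sqrt_le_left (by positivity)).1 h1
  rw [mul_pow, Real.sq_sqrt (by positivity), inv_mul_le_iff₀ (by positivity)] at h2
  refine h2.trans (le_of_eq ?_)
  field_simp
  norm_num

end Infrared

section BoxGeometry

/-- The nearest-neighbour graph on the sites of `Λ_N`. -/
def latticeGraph (N : ℕ) : SimpleGraph (CubeSite N) where
  Adj u v := dist1 (u : Fin 3 → ℤ) v = 1
  symm := ⟨fun u v h => by rw [dist1_comm]; exact h⟩
  loopless := ⟨fun u h => by simp [dist1] at h⟩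

lemma cubeJ_of_adj (β : ℝ) {N : ℕ} (u v : CubeSite N) (h : (latticeGraph N).Adj u v) :
    cubeJ β N u v = β / 2 := if_pos h

/-- The sites of `Λ_N` adjacent to its complement. -/
noncomputable def cubeBoundary (N : ℕ) : Finset (CubeSite N) :=
  Finset.univ.filter fun u => (u : Fin 3 → ℤ) ∉ cube 3 (N - 1)

lemma mem_cubeBoundary_of_cubeH_ne_zero {β : ℝ} {N : ℕ} (hN : 0 < N) (u : CubeSite N)
    (hu : cubeH β N u ≠ 0) : u ∈ cubeBoundary N := by
  refine Finset.mem_filter.2 ⟨Finset.mem_univ _, fun hmem => hu ?_⟩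
  have : bCount 3 N u = 0 := by
    rw [bCount, Finset.card_eq_zero, Finset.sdiff_eq_empty_iff_subset]
    intro v hv
    refine mem_cube.2 fun i => ?_
    have h1 := mem_cube.1 hmem i
    have h2 := Finset.mem_Icc.1 (Fintype.mem_piFinset.1 (Finset.mem_filter.1 hv).1 i)
    omega
  rw [cubeH, this]; simp

lemma card_cubeBoundary_le {N : ℕ} (hN : 0 < N) : (cubeBoundary N).card ≤ 26 * N ^ 2 := by
  have hcard : ∀ M, (cube 3 M).card = (2 * M + 1) ^ 3 := fun M => by
    rw [← card_cubeSite, Fintype.card_coe]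
  have h1 : (cubeBoundary N).map (Function.Embedding.subtype _) = cube 3 N \ cube 3 (N - 1) := by
    ext u
    simp [cubeBoundary, and_comm]
  have hsub : cube 3 (N - 1) ⊆ cube 3 N := fun u hu => mem_cube.2 fun i => by
    have := mem_cube.1 hu i
    omega
  rw [← Finset.card_map, h1, Finset.card_sdiff_of_subset hsub, hcard, hcard]
  obtain ⟨M, rfl⟩ : ∃ M, N = M + 1 := ⟨N - 1, by omega⟩
  rw [Nat.add_sub_cancel, Nat.sub_le_iff_le_add]
  nlinarith

/-- The site of `Λ_N` with the given nonnegative coordinates, truncated at `N`. -/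
def site (N : ℕ) (p : Fin 3 → ℕ) : CubeSite N :=
  ⟨fun i => ((min (p i) N : ℕ) : ℤ), mem_cube.2 fun i => by omega⟩

lemma site_apply {N : ℕ} {p : Fin 3 → ℕ} (hp : ∀ i, p i ≤ N) (i : Fin 3) :
    (site N p : Fin 3 → ℤ) i = p i := by
  simp [site, hp i]

lemma site_inj {N : ℕ} {p q : Fin 3 → ℕ} (hp : ∀ i, p i ≤ N) (hq : ∀ i, q i ≤ N)
    (h : site N p = site N q) : p = q := by
  ext i
  have := congrFun (congrArg Subtype.val h) i
  rw [site_apply hp, site_apply hq] at this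
  exact_mod_cast this

/-- The points of the box `a + [0,n)³`. -/
def boxSite (N : ℕ) (a : Fin 3 → ℕ) (n : ℕ) (r : Fin 3 → Fin n) : CubeSite N :=
  site N fun i => a i + r i

/-- The box `a + [0,n)³` as a set of sites. -/
noncomputable def boxSet (N : ℕ) (a : Fin 3 → ℕ) (n : ℕ) : Finset (CubeSite N) :=
  Finset.univ.image (boxSite N a n)

variable {N n : ℕ} {a : Fin 3 → ℕ}

lemma boxSite_bound (ha : ∀ i, a i + n ≤ N) (r : Fin 3 → Fin n) (i : Fin 3) :
    a i + r i ≤ N := by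
  have := ha i; have := (r i).2; omega

lemma boxSite_injective (ha : ∀ i, a i + n ≤ N) : Function.Injective (boxSite N a n) := by
  intro r r' h
  have := site_inj (boxSite_bound ha r) (boxSite_bound ha r') h
  ext i
  have h' : a i + (r i : ℕ) = a i + r' i := congrFun this i
  omega

lemma card_boxSet (ha : ∀ i, a i + n ≤ N) : (boxSet N a n).card = n ^ 3 := by
  rw [boxSet, Finset.card_image_of_injective _ (boxSite_injective ha)]
  simp

lemma sum_boxSet (ha : ∀ i, a i + n ≤ N) (f : CubeSite N → ℝ) :
    ∑ x ∈ boxSet N a n, f x = ∑ r, f (boxSite N a n r) :=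
  Finset.sum_image fun _ _ _ _ h => boxSite_injective ha h

lemma boxSet_disjoint {a' : Fin 3 → ℕ} (ha : ∀ i, a i + n ≤ N) (ha' : ∀ i, a' i + n ≤ N)
    (h : ∃ i, a i + n ≤ a' i ∨ a' i + n ≤ a i) : Disjoint (boxSet N a n) (boxSet N a' n) := by
  rw [Finset.disjoint_left]
  intro x hx hx'
  obtain ⟨r, -, rfl⟩ := Finset.mem_image.1 hx
  obtain ⟨r', -, h'⟩ := Finset.mem_image.1 hx'
  have := site_inj (boxSite_bound ha' r') (boxSite_bound ha r) h'
  obtain ⟨i, hi⟩ := h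
  have e : a' i + (r' i : ℕ) = a i + r i := congrFun this i
  have := (r i).2
  have := (r' i).2
  omega

lemma exists_walk_to_corner (ha : ∀ i, a i + n ≤ N) (hn : 0 < n) : ∀ (s : ℕ) (r : Fin 3 → Fin n),
    ∑ i, (r i : ℕ) = s → ∃ w : (insideGraph (latticeGraph N) (boxSet N a n)).Walk
      (boxSite N a n r) (boxSite N a n fun _ => ⟨0, hn⟩), w.length = s := by
  intro s
  induction s with
  | zero =>
    intro r hr
    have : r = fun _ => ⟨0, hn⟩ := by
      ext i
      simpa using (Finset.sum_eq_zero_iff.1 hr) i (Finset.mem_univ i)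
    subst this
    exact ⟨SimpleGraph.Walk.nil, rfl⟩
  | succ s ih =>
    intro r hr
    obtain ⟨i, hi⟩ : ∃ i, (r i : ℕ) ≠ 0 := by
      by_contra! hcon
      simp [hcon] at hr
    set r' : Fin 3 → Fin n := Function.update r i ⟨r i - 1, by omega⟩
    have hr'i : (r' i : ℕ) = r i - 1 := by simp [r']
    have hr'j : ∀ k, k ≠ i → r' k = r k := fun k hk => by simp [r', hk]
    have hsum : ∑ k, (r k : ℕ) = ∑ k, (r' k : ℕ) + 1 := by
      have hrest : ∑ k ∈ Finset.univ.erase i, (r' k : ℕ) = ∑ k ∈ Finset.univ.erase i, (r k : ℕ) :=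
        Finset.sum_congr rfl fun k hk => by rw [hr'j k (Finset.ne_of_mem_erase hk)]
      rw [← Finset.add_sum_erase _ _ (Finset.mem_univ i),
        ← Finset.add_sum_erase _ (fun k => (r' k : ℕ)) (Finset.mem_univ i), hr'i, hrest]
      omega
    obtain ⟨w, hw⟩ := ih r' (by omega)
    have hadj : (insideGraph (latticeGraph N) (boxSet N a n)).Adj (boxSite N a n r)
        (boxSite N a n r') := by
      refine ⟨?_, Finset.mem_image_of_mem _ (Finset.mem_univ _),
        Finset.mem_image_of_mem _ (Finset.mem_univ _)⟩
      change dist1 _ _ = 1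
      rw [dist1, Finset.sum_eq_single i]
      · rw [boxSite, boxSite, site_apply (boxSite_bound ha r), site_apply (boxSite_bound ha r'),
          hr'i, Nat.cast_add, Nat.cast_add, Nat.cast_sub (by omega)]
        simp
      · intro k _ hk
        rw [boxSite, boxSite, site_apply (boxSite_bound ha r), site_apply (boxSite_bound ha r'),
          hr'j k hk]
        simp
      · simp
    exact ⟨SimpleGraph.Walk.cons hadj w, by simp [hw]⟩

lemma exists_walk_in_box (ha : ∀ i, a i + n ≤ N) (r r' : Fin 3 → Fin n) :
    ∃ w : (insideGraph (latticeGraph N) (boxSet N a n)).Walk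
      (boxSite N a n r) (boxSite N a n r'), w.length ≤ 6 * n := by
  have hn : 0 < n := (r 0).pos
  obtain ⟨w, hw⟩ := exists_walk_to_corner ha hn _ r rfl
  obtain ⟨w', hw'⟩ := exists_walk_to_corner ha hn _ r' rfl
  refine ⟨w.append w'.reverse, ?_⟩
  rw [SimpleGraph.Walk.length_append, SimpleGraph.Walk.length_reverse, hw, hw']
  have hle : ∀ r : Fin 3 → Fin n, ∑ i, (r i : ℕ) ≤ 3 * n := fun r => by
    have := Finset.sum_le_sum fun i (_ : i ∈ Finset.univ) => (r i).2.le
    simpa using this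
  have := hle r
  have := hle r'
  omega

lemma sum_box_split (f : (Fin 3 → ℕ) → ℝ) (s n : ℕ) :
    ∑ r : Fin 3 → Fin (s * n), f (fun i => r i) =
      ∑ k : Fin 3 → Fin s, ∑ r : Fin 3 → Fin n, f (fun i => n * k i + r i) := by
  rw [← Fintype.sum_prod_type' fun (k : Fin 3 → Fin s) (r : Fin 3 → Fin n) =>
    f fun i => n * k i + r i]
  symm
  refine Fintype.sum_equiv ((Equiv.arrowProdEquivProdArrow (Fin 3) (fun _ => Fin s)
    (fun _ => Fin n)).symm.trans (Equiv.piCongrRight fun _ => finProdFinEquiv)) _ _ fun x => ?_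
  congr 1
  ext i
  simp [Equiv.arrowProdEquivProdArrow, add_comm]

end BoxGeometry

section Magnetisation

lemma mag_le_one (N : ℕ) (β : ℝ) : mag 3 N β ≤ 1 := by
  rw [mag_eq_ev]
  exact ev_mono_const fun σ => spin_le_one _

lemma mag_bddAbove (β : ℝ) : IsBoundedUnder (· ≤ ·) atTop fun N => mag 3 N β :=
  isBoundedUnder_of ⟨1, fun N => mag_le_one N β⟩

lemma mag_bddBelow {β : ℝ} (hβ : 0 ≤ β) : IsBoundedUnder (· ≥ ·) atTop fun N => mag 3 N β :=
  isBoundedUnder_of ⟨0, fun N => mag_nonneg hβ N⟩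

lemma mstar_nonneg {β : ℝ} (hβ : 0 ≤ β) : 0 ≤ mstar 3 β :=
  le_limsup_of_frequently_le (Frequently.of_forall fun N => mag_nonneg hβ N) (mag_bddAbove β)

lemma mstar_le_ev {β : ℝ} (hβ : 0 ≤ β) {N : ℕ} (x : CubeSite N) :
    mstar 3 β ≤ ev (cubeJ β N) (cubeH β N) (fun σ => spin (σ x)) :=
  limsup_le_of_le (mag_bddBelow hβ).isCoboundedUnder_le
    ((eventually_ge_atTop (2 * N)).mono fun _ hM => mag_le_ev hβ hM x)

lemma exists_mag_lt {β : ℝ} (hm : mstar 3 β ≤ 0) (δ : ℝ) (hδ : 0 < δ) : ∃ r, mag 3 r β < δ :=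
  (eventually_lt_of_limsup_lt (hm.trans_lt hδ) (mag_bddAbove β)).exists

lemma mag_zero (N : ℕ) : mag 3 N 0 = 0 := by
  have h : ∑ σ : CubeSite N → Bool, spin (σ (centre N)) = 0 := by
    have h1 : ∑ σ : CubeSite N → Bool, spin (σ (centre N)) =
        ∑ σ : CubeSite N → Bool, -spin (σ (centre N)) :=
      Fintype.sum_equiv (Equiv.arrowCongr (Equiv.refl _) Equiv.boolNot) _ _ fun σ => by
        simp only [Equiv.arrowCongr_apply, Function.comp, Equiv.refl_symm, Equiv.refl_apply,
          Equiv.boolNot_apply]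
        cases σ (centre N) <;> simp [spin]
    rw [Finset.sum_neg_distrib] at h1
    linarith
  rw [mag_eq_ev, ev]
  simp only [isingW, cubeJ, cubeH]
  simp [h]

lemma mstar_zero : mstar 3 0 = 0 := by
  simp only [mstar, mag_zero]
  exact limsup_const 0

lemma continuous_ev_cube (N : ℕ) (f : (CubeSite N → Bool) → ℝ) :
    Continuous fun β => ev (cubeJ β N) 0 f := by
  have hw : ∀ σ, Continuous fun β => isingW (cubeJ β N) 0 σ := by
    intro σ
    unfold isingW
    refine Real.continuous_exp.comp (Continuous.add ?_ continuous_const)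
    refine continuous_finsetSum _ fun u _ => continuous_finsetSum _ fun v _ => ?_
    refine Continuous.mul ?_ continuous_const
    unfold cubeJ
    split_ifs <;> fun_prop
  unfold ev
  exact Continuous.div (continuous_finsetSum _ fun σ _ => (hw σ).mul continuous_const)
    (continuous_finsetSum _ fun σ _ => hw σ) fun β => (sum_isingW_pos _ _).ne'

end Magnetisation

section Assembly

/-- The probability that a site is linked to the boundary of `Λ_N` in the mixed current. -/
noncomputable def linkProb (β : ℝ) (N : ℕ) (x : CubeSite N) : ℝ :=
  mixE (cubeJ β N) (cubeH β N) fun ω => if LinkedTo (cubeBoundary N) ω x then 1 else 0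

lemma linkProb_nonneg {β : ℝ} (hβ : 0 ≤ β) (N : ℕ) (x : CubeSite N) : 0 ≤ linkProb β N x :=
  mixE_nonneg (cubeJ_nonneg hβ N) (cubeH_nonneg hβ N) fun ω => by split_ifs <;> norm_num

lemma linkProb_box_ge {β m : ℝ} (hβ : 0 < β) (hm : 0 ≤ m) {N n : ℕ} (hN : 0 < N) (hn : 0 < n)
    {a : Fin 3 → ℕ} (ha : ∀ i, a i + n ≤ N)
    (hmag : ∀ x : CubeSite N, m ≤ ev (cubeJ β N) (cubeH β N) (fun σ => spin (σ x)))
    (hir : ∑ r, ∑ r', ev (cubeJ β N) 0 (pair (boxSite N a n r) (boxSite N a n r')) ≤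
      (n : ℝ) ^ 6 * (m ^ 2 / 2)) :
    m ^ 2 / 2 / max 1 (toggleCost (β / 2)) ^ (6 * n) * (n : ℝ) ^ 3 ≤
      ∑ r, linkProb β N (boxSite N a n r) := by
  have hJ := cubeJ_nonneg hβ.le N
  have hh := cubeH_nonneg hβ.le N
  set K := max 1 (toggleCost (β / 2))
  have hK : (1 : ℝ) ≤ K := le_max_left _ _
  have hKpos : 0 < K ^ (6 * n) := pow_pos (by linarith) _
  have hnR : (0 : ℝ) < n := Nat.cast_pos.2 hn
  have hcard : ((Finset.univ : Finset (Fin 3 → Fin n)).card : ℝ) = (n : ℝ) ^ 3 := by simp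
  have hpt : ∀ r r', m ^ 2 ≤ ev (cubeJ β N) 0 (pair (boxSite N a n r) (boxSite N a n r')) +
      K ^ (6 * n) * linkProb β N (boxSite N a n r) := by
    intro r r'
    obtain ⟨w, hw⟩ := exists_walk_in_box ha r r'
    have h1 := ev_pair_le_add hJ hh (half_pos hβ) (cubeJ_of_adj β)
      (fun u hu => mem_cubeBoundary_of_cubeH_ne_zero hN u hu)
      (w.mapLe (insideGraph_le (latticeGraph N) (boxSet N a n)))
    have h2 := ev_mul_le_ev_pair hJ hh (boxSite N a n r) (boxSite N a n r')
    have h3 : m ^ 2 ≤ _ := (sq m).trans_le (mul_le_mul (hmag (boxSite N a n r))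
      (hmag (boxSite N a n r')) hm (hm.trans (hmag _)))
    refine h3.trans (h2.trans (h1.trans (add_le_add le_rfl
      (mul_le_mul_of_nonneg_right ?_ (linkProb_nonneg hβ.le N _)))))
    refine (pow_le_pow_left₀ (toggleCost_nonneg (half_pos hβ)) (le_max_right 1 _) _).trans ?_
    refine pow_le_pow_right₀ hK ?_
    simpa using hw
  have hsum := Finset.sum_le_sum fun r (_ : r ∈ (Finset.univ : Finset (Fin 3 → Fin n))) =>
    Finset.sum_le_sum fun r' (_ : r' ∈ (Finset.univ : Finset (Fin 3 → Fin n))) => hpt r r'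
  simp only [Finset.sum_add_distrib, Finset.sum_const, nsmul_eq_mul, hcard,
    ← Finset.mul_sum] at hsum
  rw [div_mul_eq_mul_div, div_le_iff₀ hKpos]
  have h4 : (n : ℝ) ^ 3 * (m ^ 2 / 2 * (n : ℝ) ^ 3) ≤
      (n : ℝ) ^ 3 * ((∑ r, linkProb β N (boxSite N a n r)) * K ^ (6 * n)) := by
    nlinarith
  exact le_of_mul_le_mul_left h4 (by positivity)

lemma mstar_nonpos_of_infrared {β C : ℝ} (hβ : 0 < β) (hC : 0 < C)
    (hir : ∀ (N n : ℕ) (a : Fin 3 → ℕ), 0 < n → (∀ i, a i + n ≤ N) →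
      ∑ r, ∑ r', ev (cubeJ β N) 0 (pair (boxSite N a n r) (boxSite N a n r')) ≤
        (n : ℝ) ^ 6 * (C / n)) : mstar 3 β ≤ 0 := by
  by_contra! hm
  set m := mstar 3 β
  obtain ⟨n, hn⟩ := exists_nat_gt (C / (m ^ 2 / 2))
  have hnR : (0 : ℝ) < n := lt_trans (by positivity) hn
  have hn0 : 0 < n := Nat.cast_pos.1 hnR
  have hCn : C / n ≤ m ^ 2 / 2 := by
    rw [div_lt_iff₀ (by positivity)] at hn
    rw [div_le_iff₀ hnR]
    linarith
  set θ := m ^ 2 / 2 / max 1 (toggleCost (β / 2)) ^ (6 * n)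
  have hθ : 0 < θ := div_pos (by positivity) (pow_pos (lt_max_of_lt_left one_pos) _)
  obtain ⟨s, hs⟩ := exists_nat_gt (3 * C / (θ ^ 3 * n))
  have hsR : (0 : ℝ) < s := lt_trans (by positivity) hs
  have hs0 : 0 < s := Nat.cast_pos.1 hsR
  set ℓ := s * n
  have hℓ0 : 0 < ℓ := Nat.mul_pos hs0 hn0
  have hℓR : (0 : ℝ) < ℓ := Nat.cast_pos.2 hℓ0
  set ε := C / ℓ
  have hD : 0 < θ ^ 3 - 3 * ε := by
    rw [div_lt_iff₀ (by positivity)] at hs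
    have : 3 * ε < θ ^ 3 := by
      rw [show 3 * ε = 3 * C / ℓ by simp only [ε]; ring, div_lt_iff₀ hℓR]
      simp only [ℓ]
      push_cast
      linarith
    linarith
  set F := fillCost (β / 2) ^ ((ℓ ^ 3) ^ 2)
  have hF : 0 < F := pow_pos (fillCost_pos (half_pos hβ)) _
  have key : ∀ q : ℕ, 0 < q → (q : ℝ) * (θ ^ 3 - 3 * ε) ≤ F * (26 * (ℓ : ℝ) ^ 2) := by
    intro q hq
    have hqR : (0 : ℝ) < q := Nat.cast_pos.2 hq
    set N := ℓ * q
    have hN : 0 < N := Nat.mul_pos hℓ0 hq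
    have ha : ∀ (k : Fin 3 → Fin q) (i : Fin 3), ℓ * (k i : ℕ) + ℓ ≤ N := fun k i =>
      Nat.mul_le_mul_left ℓ (k i).2
    have hbox := card_boxes_le (cubeJ_nonneg hβ.le N) (cubeH_nonneg hβ.le N) (half_pos hβ)
      (cubeJ_of_adj β) (Y := cubeBoundary N) (Finset.univ : Finset (Fin 3 → Fin q))
      (fun k => boxSet N (fun i => ℓ * (k i : ℕ)) ℓ)
      (fun k _ k' _ hkk' => by
        obtain ⟨i, hi⟩ := Function.ne_iff.1 hkk'
        refine boxSet_disjoint (ha k) (ha k') ⟨i, ?_⟩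
        rcases lt_or_gt_of_ne hi with h | h
        · exact Or.inl (Nat.mul_le_mul_left ℓ (show (k i : ℕ) + 1 ≤ k' i from h))
        · exact Or.inr (Nat.mul_le_mul_left ℓ (show (k' i : ℕ) + 1 ≤ k i from h)))
      (b := ℓ ^ 3) (by positivity) (fun k _ => card_boxSet (ha k))
      (fun k _ u hu v hv => by
        obtain ⟨r, -, rfl⟩ := Finset.mem_image.1 hu
        obtain ⟨r', -, rfl⟩ := Finset.mem_image.1 hv
        exact (exists_walk_in_box (ha k) r r').choose.reachable)
      (θ := θ) (ε := ε) hθ.le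
      (fun k _ => by
        change _ ≤ ∑ x ∈ _, linkProb β N x
        rw [sum_boxSet (ha k)]
        have hsplit := sum_box_split
          (fun p => linkProb β N (site N fun i => ℓ * (k i : ℕ) + p i)) s n
        have hsub : ∀ t : Fin 3 → Fin s, θ * (n : ℝ) ^ 3 ≤
            ∑ r, linkProb β N (boxSite N (fun i => ℓ * (k i : ℕ) + n * t i) n r) := by
          intro t
          have hat : ∀ i, (fun i => ℓ * (k i : ℕ) + n * (t i : ℕ)) i + n ≤ N := fun i => by
            have h1 := ha k i
            have h2 : n * ((t i : ℕ) + 1) ≤ n * s := Nat.mul_le_mul_left n (t i).2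
            have h3 : n * s = ℓ := Nat.mul_comm n s
            change ℓ * (k i : ℕ) + n * (t i : ℕ) + n ≤ N
            rw [mul_add, mul_one] at h2
            omega
          exact linkProb_box_ge hβ hm.le hN hn0 hat (fun x => mstar_le_ev hβ.le x)
            ((hir N n _ hn0 hat).trans (by gcongr))
        have hsum := Finset.sum_le_sum fun t (_ : t ∈ (Finset.univ : Finset (Fin 3 → Fin s))) =>
          hsub t
        have hconst : ∑ t : Fin 3 → Fin s, θ * (n : ℝ) ^ 3 = θ * ((ℓ ^ 3 : ℕ) : ℝ) := by
          simp [ℓ]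
          ring
        rw [hconst] at hsum
        refine hsum.trans (le_of_eq ?_)
        simp only [boxSite, add_assoc]
        exact hsplit.symm)
      (fun k _ => by
        rw [sum_boxSet (ha k)]
        simp only [sum_boxSet (ha k)]
        refine (hir N ℓ _ hℓ0 (ha k)).trans (le_of_eq ?_)
        push_cast
        ring)
    have hY : ((cubeBoundary N).card : ℝ) ≤ 26 * (N : ℝ) ^ 2 := by
      exact_mod_cast card_cubeBoundary_le hN
    have h5 : (q : ℝ) ^ 3 * (θ ^ 3 - 3 * ε) ≤ F * (26 * (N : ℝ) ^ 2) := by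
      refine le_trans (le_of_eq ?_) (hbox.trans (mul_le_mul_of_nonneg_left hY hF.le))
      simp
    have h6 : (q : ℝ) ^ 2 * (q * (θ ^ 3 - 3 * ε)) ≤ (q : ℝ) ^ 2 * (F * (26 * (ℓ : ℝ) ^ 2)) := by
      refine le_trans (le_of_eq ?_) (h5.trans (le_of_eq ?_))
      · ring
      · simp only [N]; push_cast; ring
    exact le_of_mul_le_mul_left h6 (by positivity)
  obtain ⟨q, hq⟩ := exists_nat_gt (F * (26 * (ℓ : ℝ) ^ 2) / (θ ^ 3 - 3 * ε))
  have hq0 : 0 < q := Nat.cast_pos.1 (lt_trans (by positivity) hq)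
  rw [div_lt_iff₀ hD] at hq
  exact absurd (key q hq0) (not_le.2 hq)

lemma mstar_nonpos_of_below {β : ℝ} (hβ : 0 < β) (h : ∀ β', 0 ≤ β' → β' < β → mstar 3 β' ≤ 0) :
    mstar 3 β ≤ 0 := by
  refine mstar_nonpos_of_infrared (C := 288 / β) hβ (by positivity) fun N n a hn ha => ?_
  have hnR : (0 : ℝ) < n := Nat.cast_pos.2 hn
  have hlim : Tendsto (fun β' => ∑ r, ∑ r', ev (cubeJ β' N) 0
      (pair (boxSite N a n r) (boxSite N a n r'))) (nhdsWithin β (Set.Iio β))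
      (nhds (∑ r, ∑ r', ev (cubeJ β N) 0 (pair (boxSite N a n r) (boxSite N a n r')))) :=
    ((continuous_finsetSum _ fun r _ => continuous_finsetSum _ fun r' _ =>
      continuous_ev_cube N _).tendsto β).mono_left nhdsWithin_le_nhds
  have hlim' : Tendsto (fun β' : ℝ => (n : ℝ) ^ 6 * (288 / (β' * n)))
      (nhdsWithin β (Set.Iio β)) (nhds ((n : ℝ) ^ 6 * (288 / (β * n)))) := by
    refine Tendsto.mono_left ?_ nhdsWithin_le_nhds
    refine tendsto_const_nhds.mul (tendsto_const_nhds.div ?_ (by positivity))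
    exact (continuous_id.mul continuous_const).tendsto β
  rw [div_div]
  refine le_of_tendsto_of_tendsto hlim hlim' ?_
  filter_upwards [Ioo_mem_nhdsLT hβ] with β' hβ'
  exact sum_pair_box_le_of_mag_small hβ'.1 (exists_mag_lt (h β' hβ'.1.le hβ'.2)) hn
    (boxSite N a n) (fun i => a i) fun r i => by
      rw [boxSite, site_apply (boxSite_bound ha r)]
      push_cast
      rfl

end Assembly

/-- continuity of the 3d Ising phase transition.  With
`β_c = inf{β ≥ 0 : m*(β) > 0}` for the three-dimensional Ising model with plus boundary
conditions: if the set is nonempty then `m*(β_c) = 0`, and if it is empty (formally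
`β_c = +∞`) then `m*(β) = 0` for every `β ≥ 0`. -/
theorem ising3d_continuous :
    ({β : ℝ | 0 ≤ β ∧ 0 < mstar 3 β}.Nonempty →
      mstar 3 (sInf {β : ℝ | 0 ≤ β ∧ 0 < mstar 3 β}) = 0) ∧
    ({β : ℝ | 0 ≤ β ∧ 0 < mstar 3 β} = ∅ → ∀ β : ℝ, 0 ≤ β → mstar 3 β = 0) := by
  set S := {β : ℝ | 0 ≤ β ∧ 0 < mstar 3 β} with hS
  have hpos : 0 ≤ sInf S := Real.sInf_nonneg fun β hβ => hβ.1
  have hbdd : BddBelow S := ⟨0, fun β hβ => hβ.1⟩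
  refine ⟨fun _ => ?_, fun hempty β hβ => ?_⟩
  · rcases hpos.eq_or_lt with h0 | h0
    · rw [← h0, mstar_zero]
    · refine le_antisymm (mstar_nonpos_of_below h0 fun β' h1 h2 => ?_) (mstar_nonneg hpos)
      by_contra! h3
      exact notMem_of_lt_csInf h2 hbdd ⟨h1, h3⟩
  · refine le_antisymm ?_ (mstar_nonneg hβ)
    by_contra! h3
    have : β ∈ S := ⟨hβ, h3⟩
    rw [hempty] at this
    exact this
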